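/- Let 𝔸, 𝔹 be generalized algebraic theories, h ≥ 0, and suppose the pair (𝔸,𝔹) is h-derivable. Then: (Conteq¹) for any derivable X ⊢ U ≡ U' sort in 𝔸 and any context Y of 𝔹 with ht(X ⊢ U ≡ U' sort) · ht(Y) ≤ h, setting X' = (X, x:U) and X'' = (X, x:U') for a variable x not in X, the context equality X'⊗Y ≡ X''⊗Y ctx is derivable in 𝔸⊗𝔹; (Conteq²) symmetrically, for any context X of 𝔸 and derivable Y ⊢ V ≡ V' sort in 𝔹 with ht(X) · ht(Y ⊢ V ≡ V' sort) ≤ h, the context equality X⊗Y' ≡ X⊗Y'' ctx is derivable, where Y' = (Y, y:V) and Y'' = (Y, y:V'); (Moreq¹) for any derivable morphism equality f ≡ g : X → A in 𝔸 and context Y of 𝔹 with ht(f ≡ g : X → A) · ht(Y) ≤ h, the morphism equality f⊗Y ≡ g⊗Y : X⊗Y → A⊗Y is derivable in 𝔸⊗𝔹; (Moreq²) symmetrically, for any context X of 𝔸 and derivable morphism equality f ≡ g : Y → B in 𝔹 with ht(X) · ht(f ≡ g : Y → B) ≤ h, the morphism equality X⊗f ≡ X⊗g : X⊗Y → X⊗B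 is derivable. -/

import Mathlib

set_option linter.unusedVariables false

/-! # Syntax of generalized algebraic theories (following Cartmell / the paper's appendix) -/

namespace GATPaper

/-- A sort-and-term alphabet: a countably infinite set of variables, a set of sort
symbols and a set of term symbols. -/
structure Alphabet : Type 1 where
  Var : Type
  SortSym : Type
  TermSym : Type
  var_infinite : Infinite Var
  var_countable : Countable Var

attribute [instance] Alphabet.var_infinite Alphabet.var_countable

variable {A B : Alphabet}

/-- Term expressions over an alphabet. -/
inductive Expr (A : Alphabet) : Type where
  | var : A.Var → Expr A
  | app : A.TermSym → List (Expr A) → Expr A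

/-- Sort expressions: a sort symbol applied to a list of term expressions. -/
structure SortE (A : Alphabet) : Type where
  head : A.SortSym
  args : List (Expr A)

/-- Occurrence of a variable in a term expression. -/
inductive Occurs (x : A.Var) : Expr A → Prop where
  | var : Occurs x (Expr.var x)
  | app {t : A.TermSym} {es : List (Expr A)} {e : Expr A} :
      e ∈ es → Occurs x e → Occurs x (Expr.app t es)

/-- Occurrence of a variable in a sort expression. -/
def SOccurs (x : A.Var) (U : SortE A) : Prop := ∃ e ∈ U.args, Occurs x e

/-- Simultaneous substitution along a function on variables. -/
def Expr.subst (σ : A.Var → Expr A) : Expr A → Expr A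
  | .var x => σ x
  | .app t es => .app t (es.attach.map fun e => Expr.subst σ e.1)
termination_by e => sizeOf e
decreasing_by
  have := List.sizeOf_lt_of_mem e.2
  simp only [Expr.app.sizeOf_spec]
  omega

def SortE.subst (σ : A.Var → Expr A) (U : SortE A) : SortE A :=
  ⟨U.head, U.args.map (Expr.subst σ)⟩

open Classical in
/-- The function on variables determined by a finite list of substitution pairs
`(zᵢ, uᵢ)` (substituting `uᵢ` for `zᵢ`, first matching pair winning, all other
variables unchanged). -/
noncomputable def lookupV : List (A.Var × Expr A) → A.Var → Expr A
  | [], x => .var x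
  | p :: ps, x => if p.1 = x then p.2 else lookupV ps x

/-- The simultaneous substitution `e[u₁ | z₁, …, u_k | z_k]` where
`ps = [(z₁,u₁),…,(z_k,u_k)]`. -/
noncomputable def Expr.substL (e : Expr A) (ps : List (A.Var × Expr A)) : Expr A :=
  e.subst (lookupV ps)

noncomputable def SortE.substL (U : SortE A) (ps : List (A.Var × Expr A)) : SortE A :=
  U.subst (lookupV ps)

/-- A (pre)context is a finite list of (variable, sort expression) pairs. -/
abbrev PreCtx (A : Alphabet) := List (A.Var × SortE A)

/-- The list of variables of a precontext, as term expressions. -/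
def ctxVars (X : PreCtx A) : List (Expr A) := X.map fun p => Expr.var p.1

/-- The scoping condition of a precontext: the `i`-th sort expression only contains
variables among the first `i` variables. -/
def IsPreCtx (X : PreCtx A) : Prop :=
  ∀ i (hi : i < X.length) (v : A.Var),
    SOccurs v (X[i]'hi).2 → v ∈ (X.take i).map Prod.fst

/-- Substitution pairs sending the variables of `X` to the entries of `f`. -/
def mkSub (X : PreCtx A) (f : List (Expr A)) : List (A.Var × Expr A) :=
  (X.map Prod.fst).zip f

/-- `Xᵢ[f₁ | x₁, …, f_{i-1} | x_{i-1}]` (0-based: the `i`-th sort of `X`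
substituted along the first `i` entries of `f`). -/
noncomputable def subPre (X : PreCtx A) (f : List (Expr A)) (i : ℕ) (hi : i < X.length) :
    SortE A :=
  ((X[i]'hi).2).substL (mkSub (X.take i) (f.take i))

/-- Judgments: context judgments and the four kinds of standard judgments. -/
inductive Judg (A : Alphabet) : Type where
  | ctx (X : PreCtx A)
  | sort (X : PreCtx A) (U : SortE A)
  | term (X : PreCtx A) (u : Expr A) (U : SortE A)
  | sortEq (X : PreCtx A) (U V : SortE A)
  | termEq (X : PreCtx A) (u v : Expr A) (U : SortE A)

/-- The context of a judgment. -/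
def Judg.ctxOf : Judg A → PreCtx A
  | .ctx X => X
  | .sort X _ => X
  | .term X _ _ => X
  | .sortEq X _ _ => X
  | .termEq X _ _ _ => X

/-- The judgment introducing a sort symbol over the context `X`. -/
def introSort (X : PreCtx A) (S : A.SortSym) : Judg A := .sort X ⟨S, ctxVars X⟩

/-- The judgment introducing a term symbol over the context `X`, with sort `U`. -/
def introTerm (X : PreCtx A) (t : A.TermSym) (U : SortE A) : Judg A :=
  .term X (.app t (ctxVars X)) U

/-- A set of axioms is a pretheory if: no axiom is a context judgment, every
axiom's context is a precontext, every sort symbol has a unique introducing sort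
axiom and there are no other sort axioms, and likewise for term symbols. -/
structure IsPretheory (Ax : Set (Judg A)) : Prop where
  no_ctx : ∀ X : PreCtx A, Judg.ctx X ∉ Ax
  wf_ctx : ∀ J ∈ Ax, IsPreCtx J.ctxOf
  sort_intro : ∀ S : A.SortSym, ∃! X : PreCtx A, introSort X S ∈ Ax
  sort_shape : ∀ (X : PreCtx A) (U : SortE A), Judg.sort X U ∈ Ax → U.args = ctxVars X
  term_intro : ∀ t : A.TermSym, ∃! p : PreCtx A × SortE A, introTerm p.1 t p.2 ∈ Ax
  term_shape : ∀ (X : PreCtx A) (u : Expr A) (U : SortE A), Judg.term X u U ∈ Ax →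
      ∃ t : A.TermSym, u = Expr.app t (ctxVars X)

/-- One inference step of the paper's system: `Step Ax D J` holds when `J` is the
conclusion of an instance of one of the sixteen rules all of whose premises
satisfy `D`. -/
inductive Step (Ax : Set (Judg A)) (D : Judg A → Prop) : Judg A → Prop where
  | ctx_nil : Step Ax D (.ctx [])
  | ctx_cons {X : PreCtx A} {U : SortE A} {x : A.Var}
      (hs : D (.sort X U)) (hfresh : ∀ p ∈ X, p.1 ≠ x)
      (hpre : IsPreCtx (X ++ [(x, U)])) :
      Step Ax D (.ctx (X ++ [(x, U)]))
  | s1 {X : PreCtx A} {U : SortE A} (h : D (.sort X U)) : Step Ax D (.sortEq X U U)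
  | s2 {X : PreCtx A} {U V : SortE A} (h : D (.sortEq X U V)) : Step Ax D (.sortEq X V U)
  | s3 {X : PreCtx A} {U V W : SortE A}
      (h1 : D (.sortEq X U V)) (h2 : D (.sortEq X V W)) : Step Ax D (.sortEq X U W)
  | t1 {X : PreCtx A} {u : Expr A} {U : SortE A}
      (h : D (.term X u U)) : Step Ax D (.termEq X u u U)
  | t2 {X : PreCtx A} {u v : Expr A} {U : SortE A}
      (h : D (.termEq X u v U)) : Step Ax D (.termEq X v u U)
  | t3 {X : PreCtx A} {u v w : Expr A} {U : SortE A}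
      (h1 : D (.termEq X u v U)) (h2 : D (.termEq X v w U)) : Step Ax D (.termEq X u w U)
  | seqt {X : PreCtx A} {U U' : SortE A} {u : Expr A}
      (h1 : D (.sortEq X U U')) (h2 : D (.term X u U)) : Step Ax D (.term X u U')
  | seqteq {X : PreCtx A} {U U' : SortE A} {u u' : Expr A}
      (h1 : D (.sortEq X U U')) (h2 : D (.termEq X u u' U))
      (h3 : D (.term X u U')) (h4 : D (.term X u' U')) : Step Ax D (.termEq X u u' U')
  | var {X : PreCtx A} {i : ℕ} (hi : i < X.length)
      (h : D (.sort X (X[i]'hi).2)) :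
      Step Ax D (.term X (.var (X[i]'hi).1) (X[i]'hi).2)
  | sA {X : PreCtx A} {U : SortE A} (hax : Judg.sort X U ∈ Ax) (h : D (.ctx X))
      (hv : ∀ i (hi : i < X.length), D (.term X (.var (X[i]'hi).1) (X[i]'hi).2)) :
      Step Ax D (.sort X U)
  | tA {X : PreCtx A} {u : Expr A} {U : SortE A} (hax : Judg.term X u U ∈ Ax)
      (h : D (.sort X U))
      (hv : ∀ i (hi : i < X.length), D (.term X (.var (X[i]'hi).1) (X[i]'hi).2)) :
      Step Ax D (.term X u U)
  | seqA {X : PreCtx A} {U U' : SortE A} (hax : Judg.sortEq X U U' ∈ Ax)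
      (h1 : D (.sort X U)) (h2 : D (.sort X U')) : Step Ax D (.sortEq X U U')
  | teqA {X : PreCtx A} {u u' : Expr A} {U : SortE A} (hax : Judg.termEq X u u' U ∈ Ax)
      (h1 : D (.term X u U)) (h2 : D (.term X u' U)) : Step Ax D (.termEq X u u' U)
  | sSub {X : PreCtx A} {S : A.SortSym} (hax : introSort X S ∈ Ax)
      {Y : PreCtx A} (hY : IsPreCtx Y) {f : List (Expr A)} (hlen : f.length = X.length)
      (hJ : D (introSort X S)) (hYc : D (.ctx Y))
      (hargs : ∀ i (hi : i < X.length) (hif : i < f.length),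
        D (.term Y (f[i]'hif) (subPre X f i hi))) :
      Step Ax D (.sort Y ⟨S, f⟩)
  | tSub {X : PreCtx A} {t : A.TermSym} {U : SortE A} (hax : introTerm X t U ∈ Ax)
      {Y : PreCtx A} (hY : IsPreCtx Y) {f : List (Expr A)} (hlen : f.length = X.length)
      (hJ : D (introTerm X t U))
      (hU : D (.sort Y (U.substL (mkSub X f))))
      (hargs : ∀ i (hi : i < X.length) (hif : i < f.length),
        D (.term Y (f[i]'hif) (subPre X f i hi))) :
      Step Ax D (.term Y (.app t f) (U.substL (mkSub X f)))
  | seqSub1 {X : PreCtx A} {U U' : SortE A} (hax : Judg.sortEq X U U' ∈ Ax)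
      {Y : PreCtx A} (hY : IsPreCtx Y) {f : List (Expr A)} (hlen : f.length = X.length)
      (hJ : D (.sortEq X U U'))
      (h1 : D (.sort Y (U.substL (mkSub X f)))) (h2 : D (.sort Y (U'.substL (mkSub X f))))
      (hargs : ∀ i (hi : i < X.length) (hif : i < f.length),
        D (.term Y (f[i]'hif) (subPre X f i hi))) :
      Step Ax D (.sortEq Y (U.substL (mkSub X f)) (U'.substL (mkSub X f)))
  | seqSub2 {X : PreCtx A} {S : A.SortSym} (hax : introSort X S ∈ Ax)
      {Y : PreCtx A} (hY : IsPreCtx Y) {f g : List (Expr A)}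
      (hlf : f.length = X.length) (hlg : g.length = X.length)
      (hJ : D (introSort X S))
      (h1 : D (.sort Y ⟨S, f⟩)) (h2 : D (.sort Y ⟨S, g⟩))
      (hargs : ∀ i (hi : i < X.length) (hif : i < f.length) (hig : i < g.length),
        D (.termEq Y (f[i]'hif) (g[i]'hig) (subPre X f i hi))) :
      Step Ax D (.sortEq Y ⟨S, f⟩ ⟨S, g⟩)
  | teqSub1 {X : PreCtx A} {u u' : Expr A} {U : SortE A}
      (hax : Judg.termEq X u u' U ∈ Ax)
      {Y : PreCtx A} (hY : IsPreCtx Y) {f : List (Expr A)} (hlen : f.length = X.length)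
      (hJ : D (.termEq X u u' U))
      (h1 : D (.term Y (u.substL (mkSub X f)) (U.substL (mkSub X f))))
      (h2 : D (.term Y (u'.substL (mkSub X f)) (U.substL (mkSub X f))))
      (hargs : ∀ i (hi : i < X.length) (hif : i < f.length),
        D (.term Y (f[i]'hif) (subPre X f i hi))) :
      Step Ax D (.termEq Y (u.substL (mkSub X f)) (u'.substL (mkSub X f))
        (U.substL (mkSub X f)))
  | teqSub2 {X : PreCtx A} {t : A.TermSym} {U : SortE A} (hax : introTerm X t U ∈ Ax)
      {Y : PreCtx A} (hY : IsPreCtx Y) {f g : List (Expr A)}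
      (hlf : f.length = X.length) (hlg : g.length = X.length)
      (hJ : D (introTerm X t U))
      (h1 : D (.term Y (.app t f) (U.substL (mkSub X f))))
      (h2 : D (.term Y (.app t g) (U.substL (mkSub X f))))
      (hargs : ∀ i (hi : i < X.length) (hif : i < f.length) (hig : i < g.length),
        D (.termEq Y (f[i]'hif) (g[i]'hig) (subPre X f i hi))) :
      Step Ax D (.termEq Y (.app t f) (.app t g) (U.substL (mkSub X f)))

/-- `DerAt Ax n J`: `J` is the conclusion of an inference step in the `n`-th stage
`𝒟ₙ` of the recursive construction of the derivable judgments. -/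
def DerAt (Ax : Set (Judg A)) : ℕ → Judg A → Prop
  | 0, _ => False
  | n + 1, J => DerAt Ax n J ∨ Step Ax (DerAt Ax n) J

/-- A judgment is derivable if it is the conclusion of a step of some stage. -/
def Derivable (Ax : Set (Judg A)) (J : Judg A) : Prop := ∃ n, DerAt Ax n J

/-- The height of a (derivable) judgment: the least stage at which it appears. -/
noncomputable def ht (Ax : Set (Judg A)) (J : Judg A) : ℕ := sInf {n | DerAt Ax n J}

/-- The height of a context: `0` for the empty context, and the height of
`∂X ⊢ Xₙ sort` otherwise. -/
noncomputable def htCtx (Ax : Set (Judg A)) (X : PreCtx A) : ℕ :=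
  match X with
  | [] => 0
  | p :: X' =>
      ht Ax (.sort ((p :: X').dropLast) (((p :: X').getLast (List.cons_ne_nil p X')).2))

/-- A generalized algebraic theory: a pretheory all of whose axioms are derivable. -/
def IsGAT (Ax : Set (Judg A)) : Prop := IsPretheory Ax ∧ ∀ J ∈ Ax, Derivable Ax J

/-- The partial term judgment `X ⊢ u term` is derivable. -/
def DerTerm (Ax : Set (Judg A)) (X : PreCtx A) (u : Expr A) : Prop :=
  ∃ U, Derivable Ax (.term X u U)

/-- The partial term equality judgment `X ⊢ u ≡ v term` is derivable. -/
def DerTermEq (Ax : Set (Judg A)) (X : PreCtx A) (u v : Expr A) : Prop :=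
  ∃ U, Derivable Ax (.termEq X u v U)

/-- Height of a derivable partial term judgment: the minimum of the heights of
`X ⊢ u : U` over all `U`. -/
noncomputable def htTerm (Ax : Set (Judg A)) (X : PreCtx A) (u : Expr A) : ℕ :=
  sInf {n | ∃ U, DerAt Ax n (.term X u U)}

/-- `f` is a context morphism from `X` to `Y`. -/
def IsMor (Ax : Set (Judg A)) (X Y : PreCtx A) (f : List (Expr A)) : Prop :=
  Derivable Ax (.ctx X) ∧ Derivable Ax (.ctx Y) ∧ f.length = Y.length ∧
  ∀ i (hi : i < Y.length) (hif : i < f.length),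
    Derivable Ax (.term X (f[i]'hif) (subPre Y f i hi))

/-- The morphism equality `f ≡ g : X → Y` is derivable. -/
def MorEq (Ax : Set (Judg A)) (X Y : PreCtx A) (f g : List (Expr A)) : Prop :=
  IsMor Ax X Y f ∧ IsMor Ax X Y g ∧
  ∀ i (hi : i < Y.length) (hif : i < f.length) (hig : i < g.length),
    Derivable Ax (.termEq X (f[i]'hif) (g[i]'hig) (subPre Y f i hi))

/-- The context equality `X ≡ Y ctx` is derivable. -/
def CtxEq (Ax : Set (Judg A)) (X Y : PreCtx A) : Prop :=
  X.length = Y.length ∧ Derivable Ax (.ctx X) ∧ Derivable Ax (.ctx Y) ∧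
  ∀ i (hX : i < X.length) (hY : i < Y.length),
    Derivable Ax (.sortEq (X.take i) (X[i]'hX).2
      (((Y[i]'hY).2).substL (mkSub (Y.take i) (ctxVars (X.take i)))))

/-- Height of a context morphism. -/
noncomputable def htMor (Ax : Set (Judg A)) (X Y : PreCtx A) (f : List (Expr A)) : ℕ :=
  max (htCtx Ax X) (max (htCtx Ax Y)
    ((Finset.range Y.length).sup fun i =>
      if h : i < Y.length ∧ i < f.length then
        ht Ax (.term X (f[i]'h.2) (subPre Y f i h.1))
      else 0))

/-- Height of a morphism equality. -/
noncomputable def htMorEq (Ax : Set (Judg A)) (X Y : PreCtx A) (f g : List (Expr A)) : ℕ :=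
  max (htMor Ax X Y f) (max (htMor Ax X Y g)
    ((Finset.range Y.length).sup fun i =>
      if h : i < Y.length ∧ i < f.length ∧ i < g.length then
        ht Ax (.termEq X (f[i]'h.2.1) (g[i]'h.2.2) (subPre Y f i h.1))
      else 0))

/-- The composite `g ∘ f` of tuples of term expressions, where `f : X → Y` and
`g : Y → Z`: the `i`-th entry is `gᵢ[f]`. -/
noncomputable def compMor (Y : PreCtx A) (f g : List (Expr A)) : List (Expr A) :=
  g.map fun e => e.substL (mkSub Y f)

/-- The canonical sort `𝒮(u)` of a term in a context (as a relation). -/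
inductive CanonSort (Ax : Set (Judg A)) (X : PreCtx A) : Expr A → SortE A → Prop where
  | var {i : ℕ} (hi : i < X.length) : CanonSort Ax X (.var (X[i]'hi).1) (X[i]'hi).2
  | app {t : A.TermSym} {f : List (Expr A)} {Xa : PreCtx A} {V : SortE A}
      (hax : introTerm Xa t V ∈ Ax) :
      CanonSort Ax X (.app t f) (V.substL (mkSub Xa f))


/-! ## The tensor product of generalized algebraic theories (§2 of the paper) -/

/-- The tensor product of two sort-and-term alphabets. -/
abbrev Alphabet.tensor (A B : Alphabet) : Alphabet :=
  { Var := A.Var × B.Var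
    SortSym := A.SortSym × B.SortSym
    TermSym := (A.SortSym × B.TermSym) ⊕ (A.TermSym × B.SortSym)
    var_infinite := inferInstance
    var_countable := inferInstance }

/-- An input for the tensor term operations `⊗_t`, `●_t`: a derivable term judgment
`X ⊢ u : U` (notation `u^U`), or an augmented derivable sort judgment
`(X ⊢ U sort, x)` (notation `x^U`), represented with `tm = var x`. -/
structure TArg (A : Alphabet) : Type where
  ctx : PreCtx A
  tm : Expr A
  srt : SortE A

/-- `L` is the lexicographically ordered `m × n` grid whose `(i,j)` entry is `M i j`. -/
def IsGrid {γ : Type} (m n : ℕ) (M : ℕ → ℕ → γ) (L : List γ) : Prop :=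
  L.length = m * n ∧
  ∀ i j (hi : i < m) (hj : j < n) (h : i * n + j < L.length), L[i * n + j]'h = M i j

/-- Substitution pairs `[g 1 | x y₁, …, g n | x yₙ]` where the `yⱼ` are the
variables of `Y`. -/
def pairsR (x : A.Var) (Y : PreCtx B) (g : ℕ → Expr (A.tensor B)) :
    List ((A.tensor B).Var × Expr (A.tensor B)) :=
  (List.finRange Y.length).map fun j => ((x, (Y.get j).1), g j.1)

/-- Substitution pairs `[g 1 | x₁ y, …, g m | x_m y]` where the `xᵢ` are the
variables of `X`. -/
def pairsL (X : PreCtx A) (y : B.Var) (g : ℕ → Expr (A.tensor B)) :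
    List ((A.tensor B).Var × Expr (A.tensor B)) :=
  (List.finRange X.length).map fun i => (((X.get i).1, y), g i.1)

variable {A B : Alphabet}

/-- The graph of the tensor term operation on pairs of (augmented sort / term)
judgments: `TTg TA TB false a b e` means `e = a ⊗_t b` and
`TTg TA TB true a b e` means `e = a ⊗*_t b` (the variant of §8 in which the two
defining substitution formulas for non-variable terms are interchanged). -/
inductive TTg (TA : Set (Judg A)) (TB : Set (Judg B)) :
    Bool → TArg A → TArg B → Expr (A.tensor B) → Prop where
  | varvar {b : Bool} {X : PreCtx A} {U : SortE A} {x : A.Var}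
      {Y : PreCtx B} {V : SortE B} {y : B.Var} :
      TTg TA TB b ⟨X, .var x, U⟩ ⟨Y, .var y, V⟩ (.var (x, y))
  | varapp {b : Bool} {X : PreCtx A} {x : A.Var} {S : A.SortSym} {ss : List (Expr A)}
      {Y : PreCtx B} {t : B.TermSym} {ts : List (Expr B)} {V : SortE B}
      (SS : ℕ → SortE A) (TSf : ℕ → SortE B)
      (hSS : ∀ i (hi : i < ss.length), CanonSort TA X (ss[i]'hi) (SS i))
      (hTS : ∀ j (hj : j < ts.length), CanonSort TB Y (ts[j]'hj) (TSf j))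
      (M : ℕ → ℕ → Expr (A.tensor B)) (out : List (Expr (A.tensor B)))
      (hM : ∀ i (hi : i < ss.length), ∀ j (hj : j < ts.length),
          TTg TA TB b ⟨X, ss[i]'hi, SS i⟩ ⟨Y, ts[j]'hj, TSf j⟩ (M i j))
      (hMx : ∀ j (hj : j < ts.length),
          TTg TA TB b ⟨X, .var x, ⟨S, ss⟩⟩ ⟨Y, ts[j]'hj, TSf j⟩ (M ss.length j))
      (hout : IsGrid (ss.length + 1) ts.length M out) :
      TTg TA TB b ⟨X, .var x, ⟨S, ss⟩⟩ ⟨Y, .app t ts, V⟩ (.app (Sum.inl (S, t)) out)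
  | appvar {b : Bool} {X : PreCtx A} {s : A.TermSym} {ss : List (Expr A)} {U : SortE A}
      {Y : PreCtx B} {y : B.Var} {T : B.SortSym} {ts : List (Expr B)}
      (SS : ℕ → SortE A) (TSf : ℕ → SortE B)
      (hSS : ∀ i (hi : i < ss.length), CanonSort TA X (ss[i]'hi) (SS i))
      (hTS : ∀ j (hj : j < ts.length), CanonSort TB Y (ts[j]'hj) (TSf j))
      (M : ℕ → ℕ → Expr (A.tensor B)) (out : List (Expr (A.tensor B)))
      (hM : ∀ i (hi : i < ss.length), ∀ j (hj : j < ts.length),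
          TTg TA TB b ⟨X, ss[i]'hi, SS i⟩ ⟨Y, ts[j]'hj, TSf j⟩ (M i j))
      (hMy : ∀ i (hi : i < ss.length),
          TTg TA TB b ⟨X, ss[i]'hi, SS i⟩ ⟨Y, .var y, ⟨T, ts⟩⟩ (M i ts.length))
      (hout : IsGrid ss.length (ts.length + 1) M out) :
      TTg TA TB b ⟨X, .app s ss, U⟩ ⟨Y, .var y, ⟨T, ts⟩⟩ (.app (Sum.inr (s, T)) out)
  | appapp_base {X : PreCtx A} {s : A.TermSym} {ss : List (Expr A)} {U : SortE A}
      {Y : PreCtx B} {t : B.TermSym} {ts : List (Expr B)} {V : SortE B} {x : A.Var}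
      (hx : ∀ p ∈ X, p.1 ≠ x)
      (e0 : Expr (A.tensor B))
      (h0 : TTg TA TB false ⟨X, .var x, U⟩ ⟨Y, .app t ts, V⟩ e0)
      (g : ℕ → Expr (A.tensor B))
      (hg : ∀ j (hj : j < Y.length),
          TTg TA TB false ⟨X, .app s ss, U⟩
            ⟨Y.take j, .var (Y[j]'hj).1, (Y[j]'hj).2⟩ (g j)) :
      TTg TA TB false ⟨X, .app s ss, U⟩ ⟨Y, .app t ts, V⟩ (e0.substL (pairsR x Y g))
  | appapp_star {X : PreCtx A} {s : A.TermSym} {ss : List (Expr A)} {U : SortE A}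
      {Y : PreCtx B} {t : B.TermSym} {ts : List (Expr B)} {V : SortE B} {y : B.Var}
      (hy : ∀ p ∈ Y, p.1 ≠ y)
      (e0 : Expr (A.tensor B))
      (h0 : TTg TA TB true ⟨X, .app s ss, U⟩ ⟨Y, .var y, V⟩ e0)
      (g : ℕ → Expr (A.tensor B))
      (hg : ∀ i (hi : i < X.length),
          TTg TA TB true ⟨X.take i, .var (X[i]'hi).1, (X[i]'hi).2⟩
            ⟨Y, .app t ts, V⟩ (g i)) :
      TTg TA TB true ⟨X, .app s ss, U⟩ ⟨Y, .app t ts, V⟩ (e0.substL (pairsL X y g))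

/-- The graph of the operation `●_t` (flag `false`), resp. of `●*_t` (flag `true`). -/
inductive TTd (TA : Set (Judg A)) (TB : Set (Judg B)) :
    Bool → TArg A → TArg B → Expr (A.tensor B) → Prop where
  | varL {b : Bool} {X : PreCtx A} {x : A.Var} {U : SortE A} {bArg : TArg B}
      {e : Expr (A.tensor B)}
      (h : TTg TA TB b ⟨X, .var x, U⟩ bArg e) : TTd TA TB b ⟨X, .var x, U⟩ bArg e
  | varR {b : Bool} {aArg : TArg A} {Y : PreCtx B} {y : B.Var} {V : SortE B}
      {e : Expr (A.tensor B)}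
      (h : TTg TA TB b aArg ⟨Y, .var y, V⟩ e) : TTd TA TB b aArg ⟨Y, .var y, V⟩ e
  | appapp_base {X : PreCtx A} {s : A.TermSym} {ss : List (Expr A)} {U : SortE A}
      {Y : PreCtx B} {t : B.TermSym} {ts : List (Expr B)} {V : SortE B} {y : B.Var}
      (hy : ∀ p ∈ Y, p.1 ≠ y)
      (e0 : Expr (A.tensor B))
      (h0 : TTg TA TB false ⟨X, .app s ss, U⟩ ⟨Y, .var y, V⟩ e0)
      (g : ℕ → Expr (A.tensor B))
      (hg : ∀ i (hi : i < X.length),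
          TTg TA TB false ⟨X.take i, .var (X[i]'hi).1, (X[i]'hi).2⟩
            ⟨Y, .app t ts, V⟩ (g i)) :
      TTd TA TB false ⟨X, .app s ss, U⟩ ⟨Y, .app t ts, V⟩ (e0.substL (pairsL X y g))
  | appapp_star {X : PreCtx A} {s : A.TermSym} {ss : List (Expr A)} {U : SortE A}
      {Y : PreCtx B} {t : B.TermSym} {ts : List (Expr B)} {V : SortE B} {x : A.Var}
      (hx : ∀ p ∈ X, p.1 ≠ x)
      (e0 : Expr (A.tensor B))
      (h0 : TTg TA TB true ⟨X, .var x, U⟩ ⟨Y, .app t ts, V⟩ e0)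
      (g : ℕ → Expr (A.tensor B))
      (hg : ∀ j (hj : j < Y.length),
          TTg TA TB true ⟨X, .app s ss, U⟩
            ⟨Y.take j, .var (Y[j]'hj).1, (Y[j]'hj).2⟩ (g j)) :
      TTd TA TB true ⟨X, .app s ss, U⟩ ⟨Y, .app t ts, V⟩ (e0.substL (pairsR x Y g))

/-- The graph of the tensor sort operation `⊗_s` (resp. `⊗*_s` for flag `true`):
`TSo TA TB b X x U Y y V W` means `W = U^x ⊗ V^y`. -/
inductive TSo (TA : Set (Judg A)) (TB : Set (Judg B)) :
    Bool → PreCtx A → A.Var → SortE A → PreCtx B → B.Var → SortE B →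
    SortE (A.tensor B) → Prop where
  | mk {b : Bool} {X : PreCtx A} {x : A.Var} {S : A.SortSym} {ss : List (Expr A)}
      {Y : PreCtx B} {y : B.Var} {T : B.SortSym} {ts : List (Expr B)}
      (hx : ∀ p ∈ X, p.1 ≠ x) (hy : ∀ p ∈ Y, p.1 ≠ y)
      (SS : ℕ → SortE A) (TSf : ℕ → SortE B)
      (hSS : ∀ i (hi : i < ss.length), CanonSort TA X (ss[i]'hi) (SS i))
      (hTS : ∀ j (hj : j < ts.length), CanonSort TB Y (ts[j]'hj) (TSf j))
      (M : ℕ → ℕ → Expr (A.tensor B)) (out : List (Expr (A.tensor B)))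
      (hM : ∀ i (hi : i < ss.length), ∀ j (hj : j < ts.length),
          TTg TA TB b ⟨X, ss[i]'hi, SS i⟩ ⟨Y, ts[j]'hj, TSf j⟩ (M i j))
      (hMx : ∀ j (hj : j < ts.length),
          TTg TA TB b ⟨X, .var x, ⟨S, ss⟩⟩ ⟨Y, ts[j]'hj, TSf j⟩ (M ss.length j))
      (hMy : ∀ i (hi : i < ss.length),
          TTg TA TB b ⟨X, ss[i]'hi, SS i⟩ ⟨Y, .var y, ⟨T, ts⟩⟩ (M i ts.length))
      (hout : IsGrid (ss.length + 1) (ts.length + 1) M out) :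
      TSo TA TB b X x ⟨S, ss⟩ Y y ⟨T, ts⟩ ⟨(S, T), out.dropLast⟩

/-- The tensor precontext `Z = X ⊗ Y`, with entries `xᵢyⱼ : Xᵢ ⊗ Yⱼ` ordered
lexicographically. -/
def TCtx (TA : Set (Judg A)) (TB : Set (Judg B)) (b : Bool)
    (X : PreCtx A) (Y : PreCtx B) (Z : PreCtx (A.tensor B)) : Prop :=
  Z.length = X.length * Y.length ∧
  ∀ i j (hi : i < X.length) (hj : j < Y.length) (h : i * Y.length + j < Z.length),
    (Z[i * Y.length + j]'h).1 = ((X[i]'hi).1, (Y[j]'hj).1) ∧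
    TSo TA TB b (X.take i) (X[i]'hi).1 (X[i]'hi).2
      (Y.take j) (Y[j]'hj).1 (Y[j]'hj).2 (Z[i * Y.length + j]'h).2

/-- The graph of the tensor operation `⊙` on pairs of judgments of the admissible
kinds of Table 1 (flag `false`), resp. of the interchanged operation `⊙*` of §8
(flag `true`).  `chA` and `chB` are the functions choosing, for each context, a
variable not occurring in it. -/
inductive TJudg (TA : Set (Judg A)) (TB : Set (Judg B))
    (chA : PreCtx A → A.Var) (chB : PreCtx B → B.Var) :
    Bool → Judg A → Judg B → Judg (A.tensor B) → Prop where
  /- sort ⊙ sort -/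
  | ss {b : Bool} {X : PreCtx A} {U : SortE A} {Y : PreCtx B} {V : SortE B}
      {Z : PreCtx (A.tensor B)} {W : SortE (A.tensor B)}
      (hZ : TCtx TA TB b (X ++ [(chA X, U)]) (Y ++ [(chB Y, V)]) Z)
      (hW : TSo TA TB b X (chA X) U Y (chB Y) V W) :
      TJudg TA TB chA chB b (.sort X U) (.sort Y V) (.sort Z.dropLast W)
  /- sort ⊙ term -/
  | st {b : Bool} {X : PreCtx A} {U : SortE A} {Y : PreCtx B} {v : Expr B} {V : SortE B}
      {Z : PreCtx (A.tensor B)} {e : Expr (A.tensor B)} {W : SortE (A.tensor B)}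
      {g : ℕ → Expr (A.tensor B)}
      (hZ : TCtx TA TB b (X ++ [(chA X, U)]) Y Z)
      (he : TTg TA TB b ⟨X, .var (chA X), U⟩ ⟨Y, v, V⟩ e)
      (hW : TSo TA TB b X (chA X) U Y (chB Y) V W)
      (hg : ∀ i (hi : i < X.length),
          TTg TA TB b ⟨X.take i, .var (X[i]'hi).1, (X[i]'hi).2⟩ ⟨Y, v, V⟩ (g i)) :
      TJudg TA TB chA chB b (.sort X U) (.term Y v V)
        (.term Z e (W.substL (pairsL X (chB Y) g)))
  /- term ⊙ sort -/
  | ts {b : Bool} {X : PreCtx A} {u : Expr A} {U : SortE A} {Y : PreCtx B} {V : SortE B}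
      {Z : PreCtx (A.tensor B)} {e : Expr (A.tensor B)} {W : SortE (A.tensor B)}
      {g : ℕ → Expr (A.tensor B)}
      (hZ : TCtx TA TB b X (Y ++ [(chB Y, V)]) Z)
      (he : TTg TA TB b ⟨X, u, U⟩ ⟨Y, .var (chB Y), V⟩ e)
      (hW : TSo TA TB b X (chA X) U Y (chB Y) V W)
      (hg : ∀ j (hj : j < Y.length),
          TTg TA TB b ⟨X, u, U⟩ ⟨Y.take j, .var (Y[j]'hj).1, (Y[j]'hj).2⟩ (g j)) :
      TJudg TA TB chA chB b (.term X u U) (.sort Y V)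
        (.term Z e (W.substL (pairsR (chA X) Y g)))
  /- term ⊙ term -/
  | tt {b : Bool} {X : PreCtx A} {u : Expr A} {U : SortE A}
      {Y : PreCtx B} {v : Expr B} {V : SortE B}
      {Z : PreCtx (A.tensor B)} {e1 e2 : Expr (A.tensor B)} {W : SortE (A.tensor B)}
      {gx gy : ℕ → Expr (A.tensor B)}
      (hZ : TCtx TA TB b X Y Z)
      (he1 : TTg TA TB b ⟨X, u, U⟩ ⟨Y, v, V⟩ e1)
      (he2 : TTd TA TB b ⟨X, u, U⟩ ⟨Y, v, V⟩ e2)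
      (hW : TSo TA TB b X (chA X) U Y (chB Y) V W)
      (hgx : ∀ i (hi : i < X.length),
          TTg TA TB b ⟨X.take i, .var (X[i]'hi).1, (X[i]'hi).2⟩ ⟨Y, v, V⟩ (gx i))
      (hgy : ∀ j (hj : j < Y.length),
          TTg TA TB b ⟨X, u, U⟩ ⟨Y.take j, .var (Y[j]'hj).1, (Y[j]'hj).2⟩ (gy j)) :
      TJudg TA TB chA chB b (.term X u U) (.term Y v V)
        (.termEq Z e1 e2 (W.substL (pairsL X (chB Y) gx ++ pairsR (chA X) Y gy)))
  /- sort ⊙ sort equality -/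
  | sseq {b : Bool} {X : PreCtx A} {U : SortE A} {Y : PreCtx B} {V V' : SortE B}
      {Z : PreCtx (A.tensor B)} {W W' : SortE (A.tensor B)}
      (hZ : TCtx TA TB b (X ++ [(chA X, U)]) (Y ++ [(chB Y, V)]) Z)
      (hW : TSo TA TB b X (chA X) U Y (chB Y) V W)
      (hW' : TSo TA TB b X (chA X) U Y (chB Y) V' W') :
      TJudg TA TB chA chB b (.sort X U) (.sortEq Y V V') (.sortEq Z.dropLast W W')
  /- sort equality ⊙ sort -/
  | seqs {b : Bool} {X : PreCtx A} {U U' : SortE A} {Y : PreCtx B} {V : SortE B}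
      {Z : PreCtx (A.tensor B)} {W W' : SortE (A.tensor B)}
      (hZ : TCtx TA TB b (X ++ [(chA X, U)]) (Y ++ [(chB Y, V)]) Z)
      (hW : TSo TA TB b X (chA X) U Y (chB Y) V W)
      (hW' : TSo TA TB b X (chA X) U' Y (chB Y) V W') :
      TJudg TA TB chA chB b (.sortEq X U U') (.sort Y V) (.sortEq Z.dropLast W W')
  /- sort ⊙ term equality -/
  | steq {b : Bool} {X : PreCtx A} {U : SortE A} {Y : PreCtx B} {v v' : Expr B}
      {V : SortE B} {Z : PreCtx (A.tensor B)} {e e' : Expr (A.tensor B)}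
      {W : SortE (A.tensor B)} {g : ℕ → Expr (A.tensor B)}
      (hZ : TCtx TA TB b (X ++ [(chA X, U)]) Y Z)
      (he : TTg TA TB b ⟨X, .var (chA X), U⟩ ⟨Y, v, V⟩ e)
      (he' : TTg TA TB b ⟨X, .var (chA X), U⟩ ⟨Y, v', V⟩ e')
      (hW : TSo TA TB b X (chA X) U Y (chB Y) V W)
      (hg : ∀ i (hi : i < X.length),
          TTg TA TB b ⟨X.take i, .var (X[i]'hi).1, (X[i]'hi).2⟩ ⟨Y, v, V⟩ (g i)) :
      TJudg TA TB chA chB b (.sort X U) (.termEq Y v v' V)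
        (.termEq Z e e' (W.substL (pairsL X (chB Y) g)))
  /- term equality ⊙ sort -/
  | teqs {b : Bool} {X : PreCtx A} {u u' : Expr A} {U : SortE A} {Y : PreCtx B}
      {V : SortE B} {Z : PreCtx (A.tensor B)} {e e' : Expr (A.tensor B)}
      {W : SortE (A.tensor B)} {g : ℕ → Expr (A.tensor B)}
      (hZ : TCtx TA TB b X (Y ++ [(chB Y, V)]) Z)
      (he : TTg TA TB b ⟨X, u, U⟩ ⟨Y, .var (chB Y), V⟩ e)
      (he' : TTg TA TB b ⟨X, u', U⟩ ⟨Y, .var (chB Y), V⟩ e')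
      (hW : TSo TA TB b X (chA X) U Y (chB Y) V W)
      (hg : ∀ j (hj : j < Y.length),
          TTg TA TB b ⟨X, u, U⟩ ⟨Y.take j, .var (Y[j]'hj).1, (Y[j]'hj).2⟩ (g j)) :
      TJudg TA TB chA chB b (.termEq X u u' U) (.sort Y V)
        (.termEq Z e e' (W.substL (pairsR (chA X) Y g)))
  /- sort equality ⊙ term -/
  | seqt {b : Bool} {X : PreCtx A} {U U' : SortE A} {Y : PreCtx B} {v : Expr B}
      {V : SortE B} {Z : PreCtx (A.tensor B)} {e e' : Expr (A.tensor B)}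
      {W : SortE (A.tensor B)} {g : ℕ → Expr (A.tensor B)}
      (hZ : TCtx TA TB b (X ++ [(chA X, U)]) Y Z)
      (he : TTg TA TB b ⟨X, .var (chA X), U⟩ ⟨Y, v, V⟩ e)
      (he' : TTg TA TB b ⟨X, .var (chA X), U'⟩ ⟨Y, v, V⟩ e')
      (hW : TSo TA TB b X (chA X) U Y (chB Y) V W)
      (hg : ∀ i (hi : i < X.length),
          TTg TA TB b ⟨X.take i, .var (X[i]'hi).1, (X[i]'hi).2⟩ ⟨Y, v, V⟩ (g i)) :
      TJudg TA TB chA chB b (.sortEq X U U') (.term Y v V)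
        (.termEq Z e e' (W.substL (pairsL X (chB Y) g)))
  /- term ⊙ sort equality -/
  | tseq {b : Bool} {X : PreCtx A} {u : Expr A} {U : SortE A} {Y : PreCtx B}
      {V V' : SortE B} {Z : PreCtx (A.tensor B)} {e e' : Expr (A.tensor B)}
      {W : SortE (A.tensor B)} {g : ℕ → Expr (A.tensor B)}
      (hZ : TCtx TA TB b X (Y ++ [(chB Y, V)]) Z)
      (he : TTg TA TB b ⟨X, u, U⟩ ⟨Y, .var (chB Y), V⟩ e)
      (he' : TTg TA TB b ⟨X, u, U⟩ ⟨Y, .var (chB Y), V'⟩ e')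
      (hW : TSo TA TB b X (chA X) U Y (chB Y) V W)
      (hg : ∀ j (hj : j < Y.length),
          TTg TA TB b ⟨X, u, U⟩ ⟨Y.take j, .var (Y[j]'hj).1, (Y[j]'hj).2⟩ (g j)) :
      TJudg TA TB chA chB b (.term X u U) (.sortEq Y V V')
        (.termEq Z e e' (W.substL (pairsR (chA X) Y g)))

/-- A choice, for every precontext, of a variable not contained in it. -/
def FreshCh {A : Alphabet} (ch : PreCtx A → A.Var) : Prop :=
  ∀ X : PreCtx A, ∀ p ∈ X, p.1 ≠ ch X

/-- The set of axioms of the pretheory `𝔸 ⊗ 𝔹`: the judgments `J ⊙ J'` for `J` an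
axiom of `𝔸` and `J'` an axiom of `𝔹`. -/
def tensorAx (TA : Set (Judg A)) (TB : Set (Judg B))
    (chA : PreCtx A → A.Var) (chB : PreCtx B → B.Var) : Set (Judg (A.tensor B)) :=
  {K | ∃ J J', J ∈ TA ∧ J' ∈ TB ∧ TJudg TA TB chA chB false J J' K}

/-- The pair `(𝔸, 𝔹)` is `h`-derivable: `J ⊙ J'` is derivable in the pretheory
`𝔸 ⊗ 𝔹` whenever `J`, `J'` are derivable judgments of `𝔸`, `𝔹` (of admissible
kinds) with `ht J * ht J' ≤ h`. -/
def hDerivable (TA : Set (Judg A)) (TB : Set (Judg B))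
    (chA : PreCtx A → A.Var) (chB : PreCtx B → B.Var) (h : ℕ) : Prop :=
  ∀ (J : Judg A) (J' : Judg B) (K : Judg (A.tensor B)),
    Derivable TA J → Derivable TB J' → ht TA J * ht TB J' ≤ h →
    TJudg TA TB chA chB false J J' K → Derivable (tensorAx TA TB chA chB) K

/-- The tensor `out = f ⊗ g` of two tuples of derivable terms, each entry being
the tensor of terms taken at their canonical sorts, ordered lexicographically. -/
def TMor (TA : Set (Judg A)) (TB : Set (Judg B)) (b : Bool)
    (X : PreCtx A) (f : List (Expr A)) (Y : PreCtx B) (g : List (Expr B))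
    (out : List (Expr (A.tensor B))) : Prop :=
  out.length = f.length * g.length ∧
  ∀ i j (hi : i < f.length) (hj : j < g.length) (h : i * g.length + j < out.length),
    ∃ U V, CanonSort TA X (f[i]'hi) U ∧ CanonSort TB Y (g[j]'hj) V ∧
      TTg TA TB b ⟨X, f[i]'hi, U⟩ ⟨Y, g[j]'hj, V⟩ (out[i * g.length + j]'h)

/-- The tensor `out = f ⊗ Y` of a tuple of derivable terms of `𝔸` with a context
of `𝔹`: entries `fᵢ^{𝒮(fᵢ)} ⊗ yⱼ^{Yⱼ}`. -/
def TMorCtx (TA : Set (Judg A)) (TB : Set (Judg B)) (b : Bool)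
    (X : PreCtx A) (f : List (Expr A)) (Y : PreCtx B)
    (out : List (Expr (A.tensor B))) : Prop :=
  out.length = f.length * Y.length ∧
  ∀ i j (hi : i < f.length) (hj : j < Y.length) (h : i * Y.length + j < out.length),
    ∃ U, CanonSort TA X (f[i]'hi) U ∧
      TTg TA TB b ⟨X, f[i]'hi, U⟩ ⟨Y.take j, .var (Y[j]'hj).1, (Y[j]'hj).2⟩
        (out[i * Y.length + j]'h)

/-- The tensor `out = X ⊗ g` of a context of `𝔸` with a tuple of derivable terms
of `𝔹`: entries `xᵢ^{Xᵢ} ⊗ gⱼ^{𝒮(gⱼ)}`. -/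
def TCtxMor (TA : Set (Judg A)) (TB : Set (Judg B)) (b : Bool)
    (X : PreCtx A) (Y : PreCtx B) (g : List (Expr B))
    (out : List (Expr (A.tensor B))) : Prop :=
  out.length = X.length * g.length ∧
  ∀ i j (hi : i < X.length) (hj : j < g.length) (h : i * g.length + j < out.length),
    ∃ V, CanonSort TB Y (g[j]'hj) V ∧
      TTg TA TB b ⟨X.take i, .var (X[i]'hi).1, (X[i]'hi).2⟩ ⟨Y, g[j]'hj, V⟩
        (out[i * g.length + j]'h)

/-- The tensor `out = (x₁,…,x_m,u^U) ⊗ Y` of the section determined by a term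
`X ⊢ u : U` with a context of `𝔹`. -/
def TSecL (TA : Set (Judg A)) (TB : Set (Judg B)) (b : Bool)
    (X : PreCtx A) (u : Expr A) (U : SortE A) (Y : PreCtx B)
    (out : List (Expr (A.tensor B))) : Prop :=
  out.length = (X.length + 1) * Y.length ∧
  (∀ i j (hi : i < X.length) (hj : j < Y.length) (h : i * Y.length + j < out.length),
      TTg TA TB b ⟨X.take i, .var (X[i]'hi).1, (X[i]'hi).2⟩
        ⟨Y.take j, .var (Y[j]'hj).1, (Y[j]'hj).2⟩ (out[i * Y.length + j]'h)) ∧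
  (∀ j (hj : j < Y.length) (h : X.length * Y.length + j < out.length),
      TTg TA TB b ⟨X, u, U⟩ ⟨Y.take j, .var (Y[j]'hj).1, (Y[j]'hj).2⟩
        (out[X.length * Y.length + j]'h))

/-- The tensor `out = X ⊗ (y₁,…,yₙ,v^V)` of a context of `𝔸` with the section
determined by a term `Y ⊢ v : V` of `𝔹`. -/
def TSecR (TA : Set (Judg A)) (TB : Set (Judg B)) (b : Bool)
    (X : PreCtx A) (Y : PreCtx B) (v : Expr B) (V : SortE B)
    (out : List (Expr (A.tensor B))) : Prop :=
  out.length = X.length * (Y.length + 1) ∧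
  (∀ i j (hi : i < X.length) (hj : j < Y.length)
      (h : i * (Y.length + 1) + j < out.length),
      TTg TA TB b ⟨X.take i, .var (X[i]'hi).1, (X[i]'hi).2⟩
        ⟨Y.take j, .var (Y[j]'hj).1, (Y[j]'hj).2⟩ (out[i * (Y.length + 1) + j]'h)) ∧
  (∀ i (hi : i < X.length) (h : i * (Y.length + 1) + Y.length < out.length),
      TTg TA TB b ⟨X.take i, .var (X[i]'hi).1, (X[i]'hi).2⟩ ⟨Y, v, V⟩
        (out[i * (Y.length + 1) + Y.length]'h))

section

variable {A B : Alphabet}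

/-! ## Syntactic substitution -/

theorem Expr.subst_var (σ : A.Var → Expr A) (x : A.Var) : (Expr.var x).subst σ = σ x := by
  rw [Expr.subst]

theorem Expr.subst_app (σ : A.Var → Expr A) (t : A.TermSym) (es : List (Expr A)) :
    (Expr.app t es).subst σ = .app t (es.map (Expr.subst σ)) := by
  rw [Expr.subst]
  simp

theorem Expr.induct {P : Expr A → Prop} (hv : ∀ x, P (.var x))
    (ha : ∀ t es, (∀ e ∈ es, P e) → P (.app t es)) : ∀ e, P e
  | .var x => hv x
  | .app t es => ha t es fun e he => Expr.induct hv ha e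
termination_by e => sizeOf e
decreasing_by
  have := List.sizeOf_lt_of_mem he
  simp only [Expr.app.sizeOf_spec]
  omega

theorem occurs_var_iff {x y : A.Var} : Occurs x (.var y) ↔ x = y := by
  constructor
  · intro h; cases h; rfl
  · rintro rfl; exact .var

theorem occurs_app_iff {x : A.Var} {t : A.TermSym} {es : List (Expr A)} :
    Occurs x (.app t es) ↔ ∃ e ∈ es, Occurs x e := by
  constructor
  · intro h; cases h with | app h1 h2 => exact ⟨_, h1, h2⟩
  · rintro ⟨e, h1, h2⟩; exact .app h1 h2

theorem Expr.subst_congr {σ τ : A.Var → Expr A} (e : Expr A) :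
    (∀ x, Occurs x e → σ x = τ x) → e.subst σ = e.subst τ := by
  induction e using Expr.induct with
  | hv x => intro h; simpa only [Expr.subst_var] using h x .var
  | ha t es ih =>
    intro h
    simp only [Expr.subst_app, Expr.app.injEq, true_and]
    exact List.map_congr_left fun e he => ih e he fun x hx => h x (.app he hx)

theorem SortE.subst_congr {σ τ : A.Var → Expr A} (U : SortE A)
    (h : ∀ x, SOccurs x U → σ x = τ x) : U.subst σ = U.subst τ := by
  simp only [SortE.subst, SortE.mk.injEq, true_and]
  exact List.map_congr_left fun e he => Expr.subst_congr e fun x hx => h x ⟨e, he, hx⟩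

theorem Expr.subst_subst (σ τ : A.Var → Expr A) (e : Expr A) :
    (e.subst σ).subst τ = e.subst fun x => (σ x).subst τ := by
  induction e using Expr.induct with
  | hv x => simp only [Expr.subst_var]
  | ha t es ih =>
    simp only [Expr.subst_app, Expr.app.injEq, true_and, List.map_map]
    exact List.map_congr_left fun e he => ih e he

theorem SortE.subst_subst (σ τ : A.Var → Expr A) (U : SortE A) :
    (U.subst σ).subst τ = U.subst fun x => (σ x).subst τ := by
  simp only [SortE.subst, SortE.mk.injEq, true_and, List.map_map]
  exact List.map_congr_left fun e he => Expr.subst_subst σ τ e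

theorem Expr.subst_id (e : Expr A) : e.subst .var = e := by
  induction e using Expr.induct with
  | hv x => simp only [Expr.subst_var]
  | ha t es ih =>
    simp only [Expr.subst_app, Expr.app.injEq, true_and]
    conv_rhs => rw [← List.map_id es]
    exact List.map_congr_left fun e he => ih e he

theorem SortE.subst_id (U : SortE A) : U.subst .var = U := by
  cases U with | mk S f =>
  simp only [SortE.subst, SortE.mk.injEq, true_and]
  conv_rhs => rw [← List.map_id f]
  exact List.map_congr_left fun e he => Expr.subst_id e

theorem Expr.subst_eq_self {σ : A.Var → Expr A} (e : Expr A)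
    (h : ∀ x, Occurs x e → σ x = .var x) : e.subst σ = e := by
  rw [Expr.subst_congr e h, Expr.subst_id]

theorem SortE.subst_eq_self {σ : A.Var → Expr A} (U : SortE A)
    (h : ∀ x, SOccurs x U → σ x = .var x) : U.subst σ = U := by
  rw [SortE.subst_congr U h, SortE.subst_id]

/-! ## Lookup -/

theorem lookupV_take {ps : List (A.Var × Expr A)} {i : ℕ} {v : A.Var} :
    v ∈ (ps.take i).map Prod.fst → lookupV (ps.take i) v = lookupV ps v := by
  induction ps generalizing i with
  | nil => simp
  | cons p ps ih =>
    cases i with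
    | zero => simp
    | succ i =>
      intro h
      simp only [List.take_succ_cons, lookupV]
      split
      · rfl
      · rename_i hne
        apply ih
        simp only [List.take_succ_cons, List.map_cons, List.mem_cons] at h
        rcases h with h | h
        · exact absurd h.symm hne
        · exact h

theorem lookupV_zip_getElem {vs : List A.Var} {f : List (Expr A)} (hnd : vs.Nodup) {i : ℕ}
    (hi : i < vs.length) (hf : i < f.length) : lookupV (vs.zip f) vs[i] = f[i] := by
  induction vs generalizing f i with
  | nil => simp at hi
  | cons v vs ih =>
    cases f with
    | nil => simp at hf
    | cons e f =>
      rw [List.nodup_cons] at hnd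
      cases i with
      | zero => simp [lookupV]
      | succ i =>
        simp only [List.zip_cons_cons, lookupV, List.getElem_cons_succ]
        have hne : ¬ v = vs[i]'(by simpa using hi) := by
          intro h
          apply hnd.1
          rw [h]
          exact List.getElem_mem _
        rw [if_neg hne, ih hnd.2]

theorem lookupV_mkSub {X : PreCtx A} {f : List (Expr A)} (hnd : (X.map Prod.fst).Nodup) {i : ℕ}
    (hi : i < X.length) (hf : i < f.length) : lookupV (mkSub X f) (X[i]).1 = f[i] := by
  have := lookupV_zip_getElem (f := f) hnd (i := i) (by simpa using hi) hf
  simpa [mkSub] using this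

theorem lookupV_zip_subst {vs : List A.Var} {f : List (Expr A)} (σ : A.Var → Expr A)
    (hlen : f.length = vs.length) {v : A.Var} (hv : v ∈ vs) :
    (lookupV (vs.zip f) v).subst σ = lookupV (vs.zip (f.map (Expr.subst σ))) v := by
  induction vs generalizing f with
  | nil => simp at hv
  | cons w vs ih =>
    cases f with
    | nil => simp at hlen
    | cons e f =>
      simp only [List.zip_cons_cons, List.map_cons, lookupV]
      split
      · rfl
      · rename_i hne
        apply ih (by simpa using hlen)
        rcases List.mem_cons.1 hv with h | h
        · exact absurd h.symm hne
        · exact h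

theorem lookupV_mkSub_ctxVars (vs : List A.Var) (v : A.Var) :
    lookupV (vs.zip (vs.map Expr.var)) v = .var v := by
  induction vs with
  | nil => rfl
  | cons w vs ih =>
    simp only [List.map_cons, List.zip_cons_cons, lookupV]
    split
    · rename_i h; rw [h]
    · exact ih

theorem lookupV_ctxVars (X : PreCtx A) : lookupV (mkSub X (ctxVars X)) = Expr.var := by
  funext v
  have := lookupV_mkSub_ctxVars (X.map Prod.fst) v
  simpa [mkSub, ctxVars, List.map_map, Function.comp_def] using this

/-- All variables of a sort expression belong to the precontext. -/
def ScopedS (X : PreCtx A) (U : SortE A) : Prop := ∀ v, SOccurs v U → v ∈ X.map Prod.fst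

/-- All variables of a term expression belong to the precontext. -/
def ScopedE (X : PreCtx A) (u : Expr A) : Prop := ∀ v, Occurs v u → v ∈ X.map Prod.fst

theorem SortE.substL_subst {X : PreCtx A} {f : List (Expr A)} (hlen : f.length = X.length)
    {V : SortE A} (hV : ScopedS X V) (σ : A.Var → Expr A) :
    (V.substL (mkSub X f)).subst σ = V.substL (mkSub X (f.map (Expr.subst σ))) := by
  unfold SortE.substL
  rw [SortE.subst_subst]
  exact SortE.subst_congr V fun v hv =>
    lookupV_zip_subst σ (by simpa using hlen) (hV v hv)

theorem Expr.substL_subst {X : PreCtx A} {f : List (Expr A)} (hlen : f.length = X.length)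
    {V : Expr A} (hV : ScopedE X V) (σ : A.Var → Expr A) :
    (V.substL (mkSub X f)).subst σ = V.substL (mkSub X (f.map (Expr.subst σ))) := by
  unfold Expr.substL
  rw [Expr.subst_subst]
  exact Expr.subst_congr V fun v hv =>
    lookupV_zip_subst σ (by simpa using hlen) (hV v hv)

theorem subPre_eq {X : PreCtx A} (hX : IsPreCtx X) {f : List (Expr A)} (i : ℕ) (hi : i < X.length) :
    subPre X f i hi = (X[i]).2.subst (lookupV (mkSub X f)) ∨ f.length < i := by
  by_cases hf : f.length < i
  · exact Or.inr hf
  left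
  unfold subPre SortE.substL
  apply SortE.subst_congr
  intro v hv
  have h1 : mkSub (X.take i) (f.take i) = (mkSub X f).take i := by
    simp [mkSub, List.zip, List.take_zipWith, List.map_take]
  rw [h1]
  apply lookupV_take
  have h2 := hX i hi v hv
  rw [← h1]
  unfold mkSub
  rw [List.map_fst_zip]
  · exact h2
  · simp; omega

theorem subPre_eq_subst {X : PreCtx A} (hX : IsPreCtx X) {f : List (Expr A)}
    (hlen : f.length = X.length) (i : ℕ) (hi : i < X.length) :
    subPre X f i hi = (X[i]).2.subst (lookupV (mkSub X f)) := by
  rcases subPre_eq (f := f) hX i hi with h | h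
  · exact h
  · omega

theorem IsPreCtx.scoped {X : PreCtx A} (hX : IsPreCtx X) {p : A.Var × SortE A} (hp : p ∈ X) :
    ScopedS X p.2 := by
  obtain ⟨i, hi, rfl⟩ := List.getElem_of_mem hp
  intro v hv
  have := hX i hi v hv
  rw [List.map_take] at this
  exact List.mem_of_mem_take this

/-! ## Stages of derivability -/

variable {Ax : Set (Judg A)}

theorem DerAt.mono {n m : ℕ} (h : n ≤ m) {J : Judg A} (hJ : DerAt Ax n J) : DerAt Ax m J := by
  induction h with
  | refl => exact hJ
  | step _ ih => exact Or.inl ih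

theorem DerAt.derivable {n : ℕ} {J : Judg A} (hJ : DerAt Ax n J) : Derivable Ax J := ⟨n, hJ⟩

theorem DerAt.exists_step {n : ℕ} {J : Judg A} (hJ : DerAt Ax n J) :
    ∃ m, m < n ∧ Step Ax (DerAt Ax m) J := by
  induction n with
  | zero => exact hJ.elim
  | succ n ih =>
    rcases hJ with h | h
    · obtain ⟨m, hm, hs⟩ := ih h
      exact ⟨m, by omega, hs⟩
    · exact ⟨n, by omega, h⟩

theorem DerAt.of_step {n : ℕ} {J : Judg A} (hJ : Step Ax (DerAt Ax n) J) : DerAt Ax (n + 1) J :=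
  Or.inr hJ

theorem Step.mono {D D' : Judg A → Prop} (hD : ∀ J, D J → D' J) {J : Judg A}
    (h : Step Ax D J) : Step Ax D' J := by
  cases h with
  | ctx_nil => exact .ctx_nil
  | ctx_cons hs hf hp => exact .ctx_cons (hD _ hs) hf hp
  | s1 h => exact .s1 (hD _ h)
  | s2 h => exact .s2 (hD _ h)
  | s3 h1 h2 => exact .s3 (hD _ h1) (hD _ h2)
  | t1 h => exact .t1 (hD _ h)
  | t2 h => exact .t2 (hD _ h)
  | t3 h1 h2 => exact .t3 (hD _ h1) (hD _ h2)
  | seqt h1 h2 => exact .seqt (hD _ h1) (hD _ h2)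
  | seqteq h1 h2 h3 h4 => exact .seqteq (hD _ h1) (hD _ h2) (hD _ h3) (hD _ h4)
  | var hi h => exact .var hi (hD _ h)
  | sA hax h hv => exact .sA hax (hD _ h) fun i hi => hD _ (hv i hi)
  | tA hax h hv => exact .tA hax (hD _ h) fun i hi => hD _ (hv i hi)
  | seqA hax h1 h2 => exact .seqA hax (hD _ h1) (hD _ h2)
  | teqA hax h1 h2 => exact .teqA hax (hD _ h1) (hD _ h2)
  | sSub hax hY hl hJ hc ha =>
    exact .sSub hax hY hl (hD _ hJ) (hD _ hc) fun i hi hf => hD _ (ha i hi hf)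
  | tSub hax hY hl hJ hU ha =>
    exact .tSub hax hY hl (hD _ hJ) (hD _ hU) fun i hi hf => hD _ (ha i hi hf)
  | seqSub1 hax hY hl hJ h1 h2 ha =>
    exact .seqSub1 hax hY hl (hD _ hJ) (hD _ h1) (hD _ h2) fun i hi hf => hD _ (ha i hi hf)
  | seqSub2 hax hY hl hl' hJ h1 h2 ha =>
    exact .seqSub2 hax hY hl hl' (hD _ hJ) (hD _ h1) (hD _ h2)
      fun i hi hf hg => hD _ (ha i hi hf hg)
  | teqSub1 hax hY hl hJ h1 h2 ha =>
    exact .teqSub1 hax hY hl (hD _ hJ) (hD _ h1) (hD _ h2) fun i hi hf => hD _ (ha i hi hf)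
  | teqSub2 hax hY hl hl' hJ h1 h2 ha =>
    exact .teqSub2 hax hY hl hl' (hD _ hJ) (hD _ h1) (hD _ h2)
      fun i hi hf hg => hD _ (ha i hi hf hg)

theorem exists_common_stage {N : ℕ} {J : ∀ i, i < N → Judg A}
    (h : ∀ i (hi : i < N), Derivable Ax (J i hi)) :
    ∃ n, ∀ i (hi : i < N), DerAt Ax n (J i hi) := by
  induction N with
  | zero => exact ⟨0, fun i hi => absurd hi (by omega)⟩
  | succ N ih =>
    obtain ⟨n, hn⟩ := ih (J := fun i hi => J i (by omega)) fun i hi => h i (by omega)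
    obtain ⟨m, hm⟩ := h N (by omega)
    refine ⟨max n m, fun i hi => ?_⟩
    by_cases hiN : i = N
    · subst hiN; exact hm.mono (le_max_right _ _)
    · exact (hn i (by omega)).mono (le_max_left _ _)

theorem Derivable.of_step {J : Judg A} (h : Step Ax (Derivable Ax) J) : Derivable Ax J := by
  have key : ∃ n, Step Ax (DerAt Ax n) J := by
    cases h with
    | ctx_nil => exact ⟨0, .ctx_nil⟩
    | ctx_cons hs hf hp => obtain ⟨n, hn⟩ := hs; exact ⟨n, .ctx_cons hn hf hp⟩
    | s1 h => obtain ⟨n, hn⟩ := h; exact ⟨n, .s1 hn⟩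
    | s2 h => obtain ⟨n, hn⟩ := h; exact ⟨n, .s2 hn⟩
    | s3 h1 h2 =>
      obtain ⟨n, hn⟩ := h1; obtain ⟨m, hm⟩ := h2
      exact ⟨max n m, .s3 (hn.mono (le_max_left _ _)) (hm.mono (le_max_right _ _))⟩
    | t1 h => obtain ⟨n, hn⟩ := h; exact ⟨n, .t1 hn⟩
    | t2 h => obtain ⟨n, hn⟩ := h; exact ⟨n, .t2 hn⟩
    | t3 h1 h2 =>
      obtain ⟨n, hn⟩ := h1; obtain ⟨m, hm⟩ := h2
      exact ⟨max n m, .t3 (hn.mono (le_max_left _ _)) (hm.mono (le_max_right _ _))⟩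
    | seqt h1 h2 =>
      obtain ⟨n, hn⟩ := h1; obtain ⟨m, hm⟩ := h2
      exact ⟨max n m, .seqt (hn.mono (le_max_left _ _)) (hm.mono (le_max_right _ _))⟩
    | seqteq h1 h2 h3 h4 =>
      obtain ⟨n1, h1⟩ := h1; obtain ⟨n2, h2⟩ := h2
      obtain ⟨n3, h3⟩ := h3; obtain ⟨n4, h4⟩ := h4
      exact ⟨n1 + n2 + n3 + n4, .seqteq (h1.mono (by omega)) (h2.mono (by omega))
        (h3.mono (by omega)) (h4.mono (by omega))⟩
    | var hi h => obtain ⟨n, hn⟩ := h; exact ⟨n, .var hi hn⟩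
    | sA hax h hv =>
      obtain ⟨n, hn⟩ := h; obtain ⟨m, hm⟩ := exists_common_stage hv
      exact ⟨n + m, .sA hax (hn.mono (by omega)) fun i hi => (hm i hi).mono (by omega)⟩
    | tA hax h hv =>
      obtain ⟨n, hn⟩ := h; obtain ⟨m, hm⟩ := exists_common_stage hv
      exact ⟨n + m, .tA hax (hn.mono (by omega)) fun i hi => (hm i hi).mono (by omega)⟩
    | seqA hax h1 h2 =>
      obtain ⟨n, hn⟩ := h1; obtain ⟨m, hm⟩ := h2
      exact ⟨max n m, .seqA hax (hn.mono (le_max_left _ _)) (hm.mono (le_max_right _ _))⟩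
    | teqA hax h1 h2 =>
      obtain ⟨n, hn⟩ := h1; obtain ⟨m, hm⟩ := h2
      exact ⟨max n m, .teqA hax (hn.mono (le_max_left _ _)) (hm.mono (le_max_right _ _))⟩
    | sSub hax hY hl hJ hc ha =>
      obtain ⟨n1, h1⟩ := hJ; obtain ⟨n2, h2⟩ := hc
      obtain ⟨m, hm⟩ := exists_common_stage fun i hi => ha i hi (by omega)
      exact ⟨n1 + n2 + m, .sSub hax hY hl (h1.mono (by omega)) (h2.mono (by omega))
        fun i hi hf => (hm i hi).mono (by omega)⟩
    | tSub hax hY hl hJ hU ha =>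
      obtain ⟨n1, h1⟩ := hJ; obtain ⟨n2, h2⟩ := hU
      obtain ⟨m, hm⟩ := exists_common_stage fun i hi => ha i hi (by omega)
      exact ⟨n1 + n2 + m, .tSub hax hY hl (h1.mono (by omega)) (h2.mono (by omega))
        fun i hi hf => (hm i hi).mono (by omega)⟩
    | seqSub1 hax hY hl hJ h1 h2 ha =>
      obtain ⟨n0, h0⟩ := hJ; obtain ⟨n1, h1⟩ := h1; obtain ⟨n2, h2⟩ := h2
      obtain ⟨m, hm⟩ := exists_common_stage fun i hi => ha i hi (by omega)
      exact ⟨n0 + n1 + n2 + m, .seqSub1 hax hY hl (h0.mono (by omega)) (h1.mono (by omega))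
        (h2.mono (by omega)) fun i hi hf => (hm i hi).mono (by omega)⟩
    | seqSub2 hax hY hl hl' hJ h1 h2 ha =>
      obtain ⟨n0, h0⟩ := hJ; obtain ⟨n1, h1⟩ := h1; obtain ⟨n2, h2⟩ := h2
      obtain ⟨m, hm⟩ := exists_common_stage fun i hi => ha i hi (by omega) (by omega)
      exact ⟨n0 + n1 + n2 + m, .seqSub2 hax hY hl hl' (h0.mono (by omega)) (h1.mono (by omega))
        (h2.mono (by omega)) fun i hi hf hg => (hm i hi).mono (by omega)⟩
    | teqSub1 hax hY hl hJ h1 h2 ha =>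
      obtain ⟨n0, h0⟩ := hJ; obtain ⟨n1, h1⟩ := h1; obtain ⟨n2, h2⟩ := h2
      obtain ⟨m, hm⟩ := exists_common_stage fun i hi => ha i hi (by omega)
      exact ⟨n0 + n1 + n2 + m, .teqSub1 hax hY hl (h0.mono (by omega)) (h1.mono (by omega))
        (h2.mono (by omega)) fun i hi hf => (hm i hi).mono (by omega)⟩
    | teqSub2 hax hY hl hl' hJ h1 h2 ha =>
      obtain ⟨n0, h0⟩ := hJ; obtain ⟨n1, h1⟩ := h1; obtain ⟨n2, h2⟩ := h2
      obtain ⟨m, hm⟩ := exists_common_stage fun i hi => ha i hi (by omega) (by omega)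
      exact ⟨n0 + n1 + n2 + m, .teqSub2 hax hY hl hl' (h0.mono (by omega)) (h1.mono (by omega))
        (h2.mono (by omega)) fun i hi hf hg => (hm i hi).mono (by omega)⟩
  obtain ⟨n, hn⟩ := key
  exact ⟨n + 1, .of_step hn⟩

theorem Derivable.induct {P : Judg A → Prop}
    (H : ∀ J, Step Ax (fun J => Derivable Ax J ∧ P J) J → P J) {J : Judg A}
    (hJ : Derivable Ax J) : P J := by
  obtain ⟨n, hn⟩ := hJ
  induction n using Nat.strong_induction_on generalizing J with
  | _ n ih =>
    obtain ⟨m, hm, hs⟩ := hn.exists_step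
    exact H J (hs.mono fun J' hJ' => ⟨⟨m, hJ'⟩, ih m hm hJ'⟩)

/-! ## Presuppositions -/

theorem DerAt.sort_ctx {n : ℕ} {J : Judg A} (h : DerAt Ax n J) :
    (∃ X, J = .ctx X) ∨ ∃ m, m < n ∧ DerAt Ax m (.ctx J.ctxOf) := by
  induction n using Nat.strong_induction_on generalizing J with
  | _ n ih =>
    obtain ⟨m, hm, hs⟩ := h.exists_step
    have up : ∀ {J' : Judg A}, DerAt Ax m J' →
        (∃ X, J' = .ctx X) ∨ ∃ k, k < n ∧ DerAt Ax k (.ctx J'.ctxOf) := by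
      intro J' hJ'
      rcases ih m hm hJ' with h | ⟨k, hk, h⟩
      · exact Or.inl h
      · exact Or.inr ⟨k, by omega, h⟩
    cases hs with
    | ctx_nil => exact Or.inl ⟨_, rfl⟩
    | ctx_cons hs hf hp => exact Or.inl ⟨_, rfl⟩
    | s1 hh => simpa [Judg.ctxOf] using up hh
    | s2 hh => simpa [Judg.ctxOf] using up hh
    | s3 h1 h2 => simpa [Judg.ctxOf] using up h1
    | t1 hh => simpa [Judg.ctxOf] using up hh
    | t2 hh => simpa [Judg.ctxOf] using up hh
    | t3 h1 h2 => simpa [Judg.ctxOf] using up h1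
    | seqt h1 h2 => simpa [Judg.ctxOf] using up h1
    | seqteq h1 h2 h3 h4 => simpa [Judg.ctxOf] using up h1
    | var hi hh => simpa [Judg.ctxOf] using up hh
    | sA hax hh hv => exact Or.inr ⟨m, hm, hh⟩
    | tA hax hh hv => simpa [Judg.ctxOf] using up hh
    | seqA hax h1 h2 => simpa [Judg.ctxOf] using up h1
    | teqA hax h1 h2 => simpa [Judg.ctxOf] using up h1
    | sSub hax hY hl hJ hc ha => exact Or.inr ⟨m, hm, hc⟩
    | tSub hax hY hl hJ hU ha => simpa [Judg.ctxOf] using up hU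
    | seqSub1 hax hY hl hJ h1 h2 ha => simpa [Judg.ctxOf] using up h1
    | seqSub2 hax hY hl hl' hJ h1 h2 ha => simpa [Judg.ctxOf] using up h1
    | teqSub1 hax hY hl hJ h1 h2 ha => simpa [Judg.ctxOf] using up h1
    | teqSub2 hax hY hl hl' hJ h1 h2 ha => simpa [Judg.ctxOf] using up h1

theorem DerAt.ctx_of_sort {n : ℕ} {X : PreCtx A} {U : SortE A} (h : DerAt Ax n (.sort X U)) :
    ∃ m, m < n ∧ DerAt Ax m (.ctx X) := by
  simpa [Judg.ctxOf] using h.sort_ctx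

theorem Derivable.ctx {J : Judg A} (h : Derivable Ax J) : Derivable Ax (.ctx J.ctxOf) := by
  obtain ⟨n, hn⟩ := h
  rcases hn.sort_ctx with ⟨X, rfl⟩ | ⟨m, -, h⟩
  · exact ⟨n, hn⟩
  · exact ⟨m, h⟩

theorem DerAt.sort_of_ctx_append {n : ℕ} {X : PreCtx A} {p : A.Var × SortE A}
    (h : DerAt Ax n (.ctx (X ++ [p]))) :
    (∃ m, m < n ∧ DerAt Ax m (.sort X p.2)) ∧ (∀ q ∈ X, q.1 ≠ p.1) ∧ IsPreCtx (X ++ [p]) := by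
  obtain ⟨m, hm, hs⟩ := h.exists_step
  generalize hZ : X ++ [p] = Z at hs
  cases hs with
  | ctx_nil => simp at hZ
  | ctx_cons hs hf hp =>
    have := List.append_inj' hZ rfl
    obtain ⟨rfl, h2⟩ := this
    simp only [List.cons.injEq, and_true] at h2
    subst h2
    exact ⟨⟨m, hm, hs⟩, hf, hp⟩

/-- All sorts of the precontext are derivable at stage `n`. -/
def CtxAt (Ax : Set (Judg A)) (n : ℕ) (X : PreCtx A) : Prop :=
  ∀ i (hi : i < X.length), DerAt Ax n (.sort (X.take i) (X[i]).2)

theorem CtxAt.mono {n m : ℕ} (h : n ≤ m) {X : PreCtx A} (hX : CtxAt Ax n X) : CtxAt Ax m X :=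
  fun i hi => (hX i hi).mono h

theorem CtxAt.append {n : ℕ} {X : PreCtx A} (hX : CtxAt Ax n X) {p : A.Var × SortE A}
    (hp : DerAt Ax n (.sort X p.2)) : CtxAt Ax n (X ++ [p]) := by
  intro i hi
  by_cases h : i < X.length
  · rw [List.take_append_of_le_length (by omega)]
    simpa [List.getElem_append, h] using hX i h
  · have : i = X.length := by simp at hi; omega
    subst this
    simpa using hp

theorem DerAt.ctxAt {n : ℕ} {X : PreCtx A} (h : DerAt Ax n (.ctx X)) : CtxAt Ax n X := by
  induction X using List.reverseRecOn generalizing n with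
  | nil => intro i hi; simp at hi
  | append_singleton X p ih =>
    obtain ⟨⟨m, hm, hs⟩, -, -⟩ := h.sort_of_ctx_append
    obtain ⟨k, hk, hc⟩ := hs.ctx_of_sort
    exact ((ih hc).mono (by omega)).append (hs.mono (by omega))

theorem DerAt.ctxAt_of_sort {n : ℕ} {X : PreCtx A} {U : SortE A} (h : DerAt Ax n (.sort X U)) :
    ∃ m, m < n ∧ CtxAt Ax m X := by
  obtain ⟨m, hm, hc⟩ := h.ctx_of_sort
  exact ⟨m, hm, hc.ctxAt⟩

theorem Derivable.nodup {X : PreCtx A} (h : Derivable Ax (.ctx X)) : (X.map Prod.fst).Nodup := by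
  induction X using List.reverseRecOn with
  | nil => simp
  | append_singleton X p ih =>
    obtain ⟨n, hn⟩ := h
    obtain ⟨⟨m, hm, hs⟩, hf, -⟩ := hn.sort_of_ctx_append
    rw [List.map_append, List.nodup_append]
    refine ⟨ih (hs.derivable.ctx), by simp, ?_⟩
    intro a ha b hb
    simp only [List.map_cons, List.map_nil, List.mem_singleton] at hb
    obtain ⟨q, hq, rfl⟩ := List.mem_map.1 ha
    rw [hb]
    exact hf q hq

theorem Derivable.isPreCtx {X : PreCtx A} (h : Derivable Ax (.ctx X)) : IsPreCtx X := by
  induction X using List.reverseRecOn with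
  | nil => intro i hi; simp at hi
  | append_singleton X p ih =>
    obtain ⟨n, hn⟩ := h
    exact hn.sort_of_ctx_append.2.2

theorem Derivable.sort_of_ctx {X : PreCtx A} (h : Derivable Ax (.ctx X)) (i : ℕ)
    (hi : i < X.length) : Derivable Ax (.sort (X.take i) (X[i]).2) := by
  obtain ⟨n, hn⟩ := h
  exact (hn.ctxAt i hi).derivable

theorem DerAt.sort_of_sortEq {n : ℕ} {X : PreCtx A} {U V : SortE A}
    (h : DerAt Ax n (.sortEq X U V)) :
    ∃ m, m < n ∧ DerAt Ax m (.sort X U) ∧ DerAt Ax m (.sort X V) := by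
  induction n using Nat.strong_induction_on generalizing U V with
  | _ n ih =>
    obtain ⟨m, hm, hs⟩ := h.exists_step
    cases hs with
    | s1 hh => exact ⟨m, hm, hh, hh⟩
    | s2 hh => obtain ⟨k, hk, h1, h2⟩ := ih m hm hh; exact ⟨k, by omega, h2, h1⟩
    | s3 h1 h2 =>
      obtain ⟨k, hk, h1, -⟩ := ih m hm h1
      obtain ⟨l, hl, -, h2⟩ := ih m hm h2
      exact ⟨m, hm, h1.mono (by omega), h2.mono (by omega)⟩
    | seqA hax h1 h2 => exact ⟨m, hm, h1, h2⟩
    | seqSub1 hax hY hl hJ h1 h2 ha => exact ⟨m, hm, h1, h2⟩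
    | seqSub2 hax hY hl hl' hJ h1 h2 ha => exact ⟨m, hm, h1, h2⟩

theorem DerAt.sort_of_term {n : ℕ} {X : PreCtx A} {u : Expr A} {U : SortE A}
    (h : DerAt Ax n (.term X u U)) : ∃ m, m < n ∧ DerAt Ax m (.sort X U) := by
  obtain ⟨m, hm, hs⟩ := h.exists_step
  cases hs with
  | seqt h1 h2 => obtain ⟨k, hk, -, h⟩ := h1.sort_of_sortEq; exact ⟨k, by omega, h⟩
  | var hi hh => exact ⟨m, hm, hh⟩
  | tA hax hh hv => exact ⟨m, hm, hh⟩
  | tSub hax hY hl hJ hU ha => exact ⟨m, hm, hU⟩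

theorem DerAt.term_of_termEq {n : ℕ} {X : PreCtx A} {u v : Expr A} {U : SortE A}
    (h : DerAt Ax n (.termEq X u v U)) :
    ∃ m, m < n ∧ DerAt Ax m (.term X u U) ∧ DerAt Ax m (.term X v U) := by
  induction n using Nat.strong_induction_on generalizing u v with
  | _ n ih =>
    obtain ⟨m, hm, hs⟩ := h.exists_step
    cases hs with
    | t1 hh => exact ⟨m, hm, hh, hh⟩
    | t2 hh => obtain ⟨k, hk, h1, h2⟩ := ih m hm hh; exact ⟨k, by omega, h2, h1⟩
    | t3 h1 h2 =>
      obtain ⟨k, hk, h1, -⟩ := ih m hm h1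
      obtain ⟨l, hl, -, h2⟩ := ih m hm h2
      exact ⟨m, hm, h1.mono (by omega), h2.mono (by omega)⟩
    | seqteq h1 h2 h3 h4 => exact ⟨m, hm, h3, h4⟩
    | teqA hax h1 h2 => exact ⟨m, hm, h1, h2⟩
    | teqSub1 hax hY hl hJ h1 h2 ha => exact ⟨m, hm, h1, h2⟩
    | teqSub2 hax hY hl hl' hJ h1 h2 ha => exact ⟨m, hm, h1, h2⟩

theorem Derivable.sort_of_term {X : PreCtx A} {u : Expr A} {U : SortE A}
    (h : Derivable Ax (.term X u U)) : Derivable Ax (.sort X U) := by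
  obtain ⟨n, hn⟩ := h; obtain ⟨m, -, h⟩ := hn.sort_of_term; exact ⟨m, h⟩

theorem Derivable.sort_of_sortEq {X : PreCtx A} {U V : SortE A}
    (h : Derivable Ax (.sortEq X U V)) : Derivable Ax (.sort X U) ∧ Derivable Ax (.sort X V) := by
  obtain ⟨n, hn⟩ := h; obtain ⟨m, -, h1, h2⟩ := hn.sort_of_sortEq; exact ⟨⟨m, h1⟩, ⟨m, h2⟩⟩

theorem Derivable.term_of_termEq {X : PreCtx A} {u v : Expr A} {U : SortE A}
    (h : Derivable Ax (.termEq X u v U)) :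
    Derivable Ax (.term X u U) ∧ Derivable Ax (.term X v U) := by
  obtain ⟨n, hn⟩ := h; obtain ⟨m, -, h1, h2⟩ := hn.term_of_termEq; exact ⟨⟨m, h1⟩, ⟨m, h2⟩⟩

end

section

variable {A B : Alphabet}
variable {Ax : Set (Judg A)}

/-! ## Pretheories with shaped axioms -/

/-- The properties of a set of axioms used for inversion of derivations. -/
structure Nice (Ax : Set (Judg A)) : Prop where
  sort_shape : ∀ X U, Judg.sort X U ∈ Ax → U.args = ctxVars X
  term_shape : ∀ X u U, Judg.term X u U ∈ Ax → ∃ t : A.TermSym, u = .app t (ctxVars X)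
  term_uniq : ∀ X X' t U U', introTerm X t U ∈ Ax → introTerm X' t U' ∈ Ax → X = X' ∧ U = U'

theorem IsPretheory.nice (h : IsPretheory Ax) : Nice Ax where
  sort_shape := h.sort_shape
  term_shape := h.term_shape
  term_uniq X X' t U U' h1 h2 := by
    obtain ⟨p, -, hp⟩ := h.term_intro t
    have h3 := hp (X, U) h1
    have h4 := hp (X', U') h2
    rw [← h4] at h3
    exact ⟨congrArg Prod.fst h3, congrArg Prod.snd h3⟩

theorem ctxVars_length (X : PreCtx A) : (ctxVars X).length = X.length := by simp [ctxVars]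

theorem DerAt.sort_inv (hN : Nice Ax) {n : ℕ} {Y : PreCtx A} {S : A.SortSym} {f : List (Expr A)}
    (h : DerAt Ax n (.sort Y ⟨S, f⟩)) :
    ∃ X, introSort X S ∈ Ax ∧ Derivable Ax (introSort X S) ∧ f.length = X.length ∧
      ∃ m, m < n ∧ ∀ i (hi : i < X.length) (hf : i < f.length),
        DerAt Ax m (.term Y f[i] ((X[i]).2.subst (lookupV (mkSub X f)))) := by
  obtain ⟨m, hm, hs⟩ := h.exists_step
  cases hs with
  | sA hax hc hv =>
    have hf := hN.sort_shape _ _ hax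
    simp only at hf
    subst hf
    refine ⟨Y, hax, h.derivable, ctxVars_length _, m, hm, fun i hi hf => ?_⟩
    rw [lookupV_ctxVars, SortE.subst_id]
    simpa [ctxVars] using hv i hi
  | sSub hax hY hl hJ hc ha =>
    rename_i X
    refine ⟨X, hax, hJ.derivable, hl, m, hm, fun i hi hf => ?_⟩
    have hX : IsPreCtx X := (Derivable.ctx hJ.derivable).isPreCtx
    rw [← subPre_eq_subst hX hl]
    exact ha i hi hf

/-- `V[f]` is the sort of `t(f)` over `Y`, with the arguments derived at stage `m`. -/
def AppAt (Ax : Set (Judg A)) (m : ℕ) (Y : PreCtx A) (t : A.TermSym) (f : List (Expr A))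
    (C : SortE A) : Prop :=
  ∃ X V, introTerm X t V ∈ Ax ∧ Derivable Ax (introTerm X t V) ∧ f.length = X.length ∧
    C = V.substL (mkSub X f) ∧ ∀ i (hi : i < X.length) (hf : i < f.length),
        DerAt Ax m (.term Y f[i] ((X[i]).2.subst (lookupV (mkSub X f))))

theorem DerAt.term_inv (hN : Nice Ax) {n : ℕ} {Y : PreCtx A} {u : Expr A} {U : SortE A}
    (h : DerAt Ax n (.term Y u U)) :
    ∃ C, CanonSort Ax Y u C ∧ DerAt Ax n (.term Y u C) ∧ DerAt Ax n (.sortEq Y C U) ∧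
      ∀ t f, u = .app t f → ∃ m, m < n ∧ AppAt Ax m Y t f C := by
  induction n using Nat.strong_induction_on generalizing U with
  | _ n ih =>
    obtain ⟨m, hm, hs⟩ := h.exists_step
    have hrefl : DerAt Ax n (.sortEq Y U U) := by
      obtain ⟨k, hk, h'⟩ := h.sort_of_term
      exact (DerAt.of_step (.s1 h')).mono (by omega)
    cases hs with
    | seqt h1 h2 =>
      obtain ⟨C, hC, h3, h4, h5⟩ := ih m hm h2
      refine ⟨C, hC, h3.mono hm.le, (DerAt.of_step (.s3 h4 h1)).mono (by omega),
        fun t f hu => ?_⟩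
      obtain ⟨k, hk, h6⟩ := h5 t f hu
      exact ⟨k, by omega, h6⟩
    | var hi hh => exact ⟨_, .var hi, h, hrefl, fun t f hu => by cases hu⟩
    | tA hax hh hv =>
      obtain ⟨t, rfl⟩ := hN.term_shape _ _ _ hax
      have e : U = U.substL (mkSub Y (ctxVars Y)) := by
        rw [SortE.substL, lookupV_ctxVars, SortE.subst_id]
      have hc : CanonSort Ax Y (.app t (ctxVars Y)) (U.substL (mkSub Y (ctxVars Y))) := .app hax
      rw [← e] at hc
      refine ⟨U, hc, h, hrefl, fun t' f hu => ?_⟩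
      cases hu
      refine ⟨m, hm, Y, U, hax, h.derivable, ctxVars_length _, e, fun i hi hf => ?_⟩
      rw [lookupV_ctxVars, SortE.subst_id]
      simpa [ctxVars] using hv i hi
    | tSub hax hY hl hJ hU ha =>
      refine ⟨_, .app hax, h, hrefl, fun t' f hu => ?_⟩
      cases hu
      rename_i X _ V _
      have hX : IsPreCtx X := (Derivable.ctx hJ.derivable).isPreCtx
      refine ⟨m, hm, X, V, hax, hJ.derivable, hl, rfl, fun i hi hf => ?_⟩
      rw [← subPre_eq_subst hX hl]
      exact ha i hi hf

theorem CanonSort.var_mem {X : PreCtx A} {x : A.Var} {C : SortE A}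
    (h : CanonSort Ax X (.var x) C) : (x, C) ∈ X := by
  generalize hu : Expr.var x = u at h
  cases h with
  | var hi => cases hu; exact List.getElem_mem _
  | app hax => cases hu

theorem CanonSort.of_mem {X : PreCtx A} {p : A.Var × SortE A} (h : p ∈ X) :
    CanonSort Ax X (.var p.1) p.2 := by
  obtain ⟨i, hi, rfl⟩ := List.getElem_of_mem h
  exact .var hi

theorem CanonSort.app_inv {X : PreCtx A} {t : A.TermSym} {f : List (Expr A)} {C : SortE A}
    (h : CanonSort Ax X (.app t f) C) :
    ∃ Xa V, introTerm Xa t V ∈ Ax ∧ C = V.substL (mkSub Xa f) := by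
  generalize hu : Expr.app t f = u at h
  cases h with
  | var hi => cases hu
  | app hax => cases hu; exact ⟨_, _, hax, rfl⟩

theorem CanonSort.mono {X Y : PreCtx A} (hXY : X ⊆ Y) {u : Expr A} {C : SortE A}
    (h : CanonSort Ax X u C) : CanonSort Ax Y u C := by
  cases h with
  | var hi => exact .of_mem (hXY (List.getElem_mem _))
  | app hax => exact .app hax

theorem mem_unique {X : PreCtx A} (hnd : (X.map Prod.fst).Nodup) {p q : A.Var × SortE A}
    (hp : p ∈ X) (hq : q ∈ X) (h : p.1 = q.1) : p = q :=
  List.inj_on_of_nodup_map hnd hp hq h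

theorem CanonSort.unique (hN : Nice Ax) {X : PreCtx A} (hnd : (X.map Prod.fst).Nodup)
    {u : Expr A} {C D : SortE A} (h1 : CanonSort Ax X u C) (h2 : CanonSort Ax X u D) : C = D := by
  cases u with
  | var x => exact congrArg Prod.snd (mem_unique hnd h1.var_mem h2.var_mem rfl)
  | app t f =>
    obtain ⟨Xa, V, ha, rfl⟩ := h1.app_inv
    obtain ⟨Xb, W, hb, rfl⟩ := h2.app_inv
    obtain ⟨rfl, rfl⟩ := hN.term_uniq _ _ _ _ _ ha hb
    rfl

/-! ## Scoping -/

theorem scopedE_app {X : PreCtx A} {t : A.TermSym} {f : List (Expr A)} :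
    ScopedE X (.app t f) ↔ ∀ e ∈ f, ScopedE X e := by
  simp only [ScopedE, occurs_app_iff]
  exact ⟨fun h e he v hv => h v ⟨e, he, hv⟩, fun h v ⟨e, he, hv⟩ => h e he v hv⟩

theorem scopedS_iff {X : PreCtx A} {U : SortE A} : ScopedS X U ↔ ∀ e ∈ U.args, ScopedE X e :=
  ⟨fun h e he v hv => h v ⟨e, he, hv⟩, fun h v ⟨e, he, hv⟩ => h e he v hv⟩

theorem scopedE_ctxVars {X : PreCtx A} {e : Expr A} (he : e ∈ ctxVars X) : ScopedE X e := by
  obtain ⟨p, hp, rfl⟩ := List.mem_map.1 he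
  intro v hv
  rw [occurs_var_iff.1 hv]
  exact List.mem_map_of_mem hp

/-- The expressions of the judgment only use variables of its context. -/
def Judg.Scoped : Judg A → Prop
  | .ctx _ => True
  | .sort X U => ScopedS X U
  | .term X u U => ScopedE X u ∧ ScopedS X U
  | .sortEq X U V => ScopedS X U ∧ ScopedS X V
  | .termEq X u v U => ScopedE X u ∧ ScopedE X v ∧ ScopedS X U

theorem Derivable.scoped (hN : Nice Ax) {J : Judg A} (hJ : Derivable Ax J) : J.Scoped := by
  refine Derivable.induct (P := Judg.Scoped) ?_ hJ
  intro J hs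
  have args : ∀ {Y : PreCtx A} {f : List (Expr A)} {n : ℕ} {T : ∀ i, i < n → SortE A},
      f.length = n → (∀ i (hi : i < n) (hf : i < f.length), (Judg.term Y f[i] (T i hi)).Scoped) →
      ∀ e ∈ f, ScopedE Y e := by
    intro Y f n T hl h e he
    obtain ⟨i, hi, rfl⟩ := List.getElem_of_mem he
    exact (h i (by omega) hi).1
  cases hs with
  | ctx_nil => trivial
  | ctx_cons hs hf hp => trivial
  | s1 h => exact ⟨h.2, h.2⟩
  | s2 h => exact ⟨h.2.2, h.2.1⟩
  | s3 h1 h2 => exact ⟨h1.2.1, h2.2.2⟩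
  | t1 h => exact ⟨h.2.1, h.2.1, h.2.2⟩
  | t2 h => exact ⟨h.2.2.1, h.2.1, h.2.2.2⟩
  | t3 h1 h2 => exact ⟨h1.2.1, h2.2.2.1, h1.2.2.2⟩
  | seqt h1 h2 => exact ⟨h2.2.1, h1.2.2⟩
  | seqteq h1 h2 h3 h4 => exact ⟨h3.2.1, h4.2.1, h3.2.2⟩
  | var hi h =>
    refine ⟨fun v hv => ?_, h.2⟩
    rw [occurs_var_iff.1 hv]
    exact List.mem_map_of_mem (List.getElem_mem _)
  | sA hax h hv =>
    refine scopedS_iff.2 fun e he => scopedE_ctxVars ?_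
    rwa [← hN.sort_shape _ _ hax]
  | tA hax h hv =>
    obtain ⟨t, rfl⟩ := hN.term_shape _ _ _ hax
    exact ⟨scopedE_app.2 fun e he => scopedE_ctxVars he, h.2⟩
  | seqA hax h1 h2 => exact ⟨h1.2, h2.2⟩
  | teqA hax h1 h2 => exact ⟨h1.2.1, h2.2.1, h1.2.2⟩
  | sSub hax hY hl hJ hc ha =>
    exact scopedS_iff.2 (args hl fun i hi hf => (ha i hi hf).2)
  | tSub hax hY hl hJ hU ha =>
    exact ⟨scopedE_app.2 (args hl fun i hi hf => (ha i hi hf).2), hU.2⟩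
  | seqSub1 hax hY hl hJ h1 h2 ha => exact ⟨h1.2, h2.2⟩
  | seqSub2 hax hY hl hl' hJ h1 h2 ha => exact ⟨h1.2, h2.2⟩
  | teqSub1 hax hY hl hJ h1 h2 ha => exact ⟨h1.2.1, h2.2.1, h1.2.2⟩
  | teqSub2 hax hY hl hl' hJ h1 h2 ha => exact ⟨h1.2.1, h2.2.1, h1.2.2⟩

/-! ## Substitution -/

/-- `σ` is a derivable substitution from the context `Γ` to the context `Δ`. -/
def SubOK (Ax : Set (Judg A)) (Δ : PreCtx A) (σ : A.Var → Expr A) (Γ : PreCtx A) : Prop :=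
  Derivable Ax (.ctx Δ) ∧ ∀ p ∈ Γ, Derivable Ax (.term Δ (σ p.1) (p.2.subst σ))

def Judg.substTo (Δ : PreCtx A) (σ : A.Var → Expr A) : Judg A → Judg A
  | .ctx _ => .ctx Δ
  | .sort _ U => .sort Δ (U.subst σ)
  | .term _ u U => .term Δ (u.subst σ) (U.subst σ)
  | .sortEq _ U V => .sortEq Δ (U.subst σ) (V.subst σ)
  | .termEq _ u v U => .termEq Δ (u.subst σ) (v.subst σ) (U.subst σ)

theorem lookupV_ctxVars_map {X : PreCtx A} (σ : A.Var → Expr A) {x : A.Var}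
    (hx : x ∈ X.map Prod.fst) : lookupV (mkSub X ((ctxVars X).map (Expr.subst σ))) x = σ x := by
  have := lookupV_zip_subst (f := ctxVars X) σ (by simp [ctxVars]) hx
  rw [mkSub, ← this]
  have h2 := congrFun (lookupV_ctxVars X) x
  rw [mkSub] at h2
  rw [h2, Expr.subst_var]

theorem SortE.substL_ctxVars_map {X : PreCtx A} (σ : A.Var → Expr A) {U : SortE A}
    (hU : ScopedS X U) : U.substL (mkSub X ((ctxVars X).map (Expr.subst σ))) = U.subst σ :=
  SortE.subst_congr U fun v hv => lookupV_ctxVars_map σ (hU v hv)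

theorem Expr.substL_ctxVars_map {X : PreCtx A} (σ : A.Var → Expr A) {U : Expr A}
    (hU : ScopedE X U) : U.substL (mkSub X ((ctxVars X).map (Expr.subst σ))) = U.subst σ :=
  Expr.subst_congr U fun v hv => lookupV_ctxVars_map σ (hU v hv)

theorem subPre_subst {X : PreCtx A} (hX : IsPreCtx X) {f : List (Expr A)}
    (hlen : f.length = X.length) (σ : A.Var → Expr A) (i : ℕ) (hi : i < X.length) :
    (subPre X f i hi).subst σ = subPre X (f.map (Expr.subst σ)) i hi := by
  rw [subPre_eq_subst hX hlen, subPre_eq_subst hX (by simpa using hlen)]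
  exact SortE.substL_subst hlen (hX.scoped (List.getElem_mem _)) σ

theorem subPre_ctxVars_map {X : PreCtx A} (hX : IsPreCtx X) (σ : A.Var → Expr A) (i : ℕ)
    (hi : i < X.length) :
    subPre X ((ctxVars X).map (Expr.subst σ)) i hi = (X[i]).2.subst σ := by
  rw [subPre_eq_subst hX (by simp [ctxVars])]
  exact SortE.substL_ctxVars_map σ (hX.scoped (List.getElem_mem _))

theorem getElem_ctxVars_map {X : PreCtx A} (σ : A.Var → Expr A) (i : ℕ)
    (hi : i < ((ctxVars X).map (Expr.subst σ)).length) :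
    ((ctxVars X).map (Expr.subst σ))[i] = σ (X[i]'(by simpa [ctxVars] using hi)).1 := by
  simp [ctxVars, Expr.subst_var]

theorem introSort_isPreCtx {X : PreCtx A} {S : A.SortSym} (h : Derivable Ax (introSort X S)) :
    IsPreCtx X := (Derivable.ctx h).isPreCtx

theorem introTerm_isPreCtx {X : PreCtx A} {t : A.TermSym} {U : SortE A}
    (h : Derivable Ax (introTerm X t U)) : IsPreCtx X := (Derivable.ctx h).isPreCtx

theorem Derivable.subst (hN : Nice Ax) {J : Judg A} (hJ : Derivable Ax J) :
    ∀ {Δ : PreCtx A} {σ : A.Var → Expr A}, SubOK Ax Δ σ J.ctxOf →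
      Derivable Ax (J.substTo Δ σ) := by
  refine Derivable.induct (P := fun J => ∀ {Δ : PreCtx A} {σ : A.Var → Expr A},
    SubOK Ax Δ σ J.ctxOf → Derivable Ax (J.substTo Δ σ)) ?_ hJ
  clear hJ J
  intro J hs Δ σ hσ
  have hΔ := hσ.1.isPreCtx
  have vars : ∀ {X : PreCtx A}, IsPreCtx X → SubOK Ax Δ σ X →
      ∀ i (hi : i < X.length) (hf : i < ((ctxVars X).map (Expr.subst σ)).length),
        Derivable Ax (.term Δ ((ctxVars X).map (Expr.subst σ))[i]
          (subPre X ((ctxVars X).map (Expr.subst σ)) i hi)) := by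
    intro X hX hσ i hi hf
    rw [subPre_ctxVars_map hX, getElem_ctxVars_map]
    exact hσ.2 _ (List.getElem_mem _)
  have args : ∀ {Γ X : PreCtx A} {f : List (Expr A)}, IsPreCtx X → f.length = X.length →
      SubOK Ax Δ σ Γ → (∀ i (hi : i < X.length) (hf : i < f.length),
        (Derivable Ax (.term Γ f[i] (subPre X f i hi)) ∧
        ∀ {Δ : PreCtx A} {σ : A.Var → Expr A}, SubOK Ax Δ σ Γ →
          Derivable Ax (Judg.substTo Δ σ (.term Γ f[i] (subPre X f i hi))))) →
      ∀ i (hi : i < X.length) (hf : i < (f.map (Expr.subst σ)).length),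
        Derivable Ax (.term Δ (f.map (Expr.subst σ))[i] (subPre X (f.map (Expr.subst σ)) i hi)) := by
    intro Γ X f hX hl hσ h i hi hf
    have := (h i hi (by simpa using hf)).2 hσ
    rw [← subPre_subst hX hl, List.getElem_map]
    exact this
  cases hs with
  | ctx_nil => exact hσ.1
  | ctx_cons hs hf hp => exact hσ.1
  | s1 h => exact .of_step (.s1 (h.2 hσ))
  | s2 h => exact .of_step (.s2 (h.2 hσ))
  | s3 h1 h2 => exact .of_step (.s3 (h1.2 hσ) (h2.2 hσ))
  | t1 h => exact .of_step (.t1 (h.2 hσ))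
  | t2 h => exact .of_step (.t2 (h.2 hσ))
  | t3 h1 h2 => exact .of_step (.t3 (h1.2 hσ) (h2.2 hσ))
  | seqt h1 h2 => exact .of_step (.seqt (h1.2 hσ) (h2.2 hσ))
  | seqteq h1 h2 h3 h4 => exact .of_step (.seqteq (h1.2 hσ) (h2.2 hσ) (h3.2 hσ) (h4.2 hσ))
  | var hi h =>
    simp only [Judg.substTo, Expr.subst_var]
    exact hσ.2 _ (List.getElem_mem _)
  | sA hax h hv =>
    rename_i X U
    obtain ⟨S, f⟩ := U
    have hf := hN.sort_shape _ _ hax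
    simp only at hf
    subst hf
    exact .of_step (.sSub hax hΔ (by simp [ctxVars])
      (.of_step (.sA hax h.1 fun i hi => (hv i hi).1)) hσ.1 (vars h.1.isPreCtx hσ))
  | tA hax h hv =>
    rename_i X u U
    obtain ⟨t, rfl⟩ := hN.term_shape _ _ _ hax
    have hU : ScopedS X U := h.1.scoped hN
    have hX := (Derivable.ctx h.1).isPreCtx
    have h2 := h.2 hσ
    simp only [Judg.substTo, Expr.subst_app] at h2 ⊢
    rw [← SortE.substL_ctxVars_map σ hU] at h2 ⊢
    exact .of_step (.tSub hax hΔ (by simp [ctxVars])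
      (.of_step (.tA hax h.1 fun i hi => (hv i hi).1)) h2 (vars hX hσ))
  | seqA hax h1 h2 =>
    rename_i X U U'
    have hX := (Derivable.ctx h1.1).isPreCtx
    have e1 : ScopedS X U := h1.1.scoped hN
    have e2 : ScopedS X U' := h2.1.scoped hN
    have h3 := h1.2 hσ
    have h4 := h2.2 hσ
    simp only [Judg.substTo] at h3 h4 ⊢
    rw [← SortE.substL_ctxVars_map σ e1] at h3 ⊢
    rw [← SortE.substL_ctxVars_map σ e2] at h4 ⊢
    exact .of_step (.seqSub1 hax hΔ (by simp [ctxVars])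
      (.of_step (.seqA hax h1.1 h2.1)) h3 h4 (vars hX hσ))
  | teqA hax h1 h2 =>
    rename_i X u u' U
    have hX := (Derivable.ctx h1.1).isPreCtx
    obtain ⟨e1, e3⟩ : ScopedE X u ∧ ScopedS X U := h1.1.scoped hN
    obtain ⟨e2, -⟩ : ScopedE X u' ∧ ScopedS X U := h2.1.scoped hN
    have h3 := h1.2 hσ
    have h4 := h2.2 hσ
    simp only [Judg.substTo] at h3 h4 ⊢
    rw [← Expr.substL_ctxVars_map σ e1, ← SortE.substL_ctxVars_map σ e3] at h3 ⊢
    rw [← Expr.substL_ctxVars_map σ e2] at h4 ⊢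
    rw [← SortE.substL_ctxVars_map σ e3] at h4
    exact .of_step (.teqSub1 hax hΔ (by simp [ctxVars])
      (.of_step (.teqA hax h1.1 h2.1)) h3 h4 (vars hX hσ))
  | sSub hax hY hl hJ hc ha =>
    exact .of_step (.sSub hax hΔ (by simpa using hl) hJ.1 hσ.1
      (args (Derivable.ctx hJ.1).isPreCtx hl hσ ha))
  | tSub hax hY hl hJ hU ha =>
    have hV := (Derivable.sort_of_term hJ.1).scoped hN
    have h2 := hU.2 hσ
    simp only [Judg.substTo, Expr.subst_app] at h2 ⊢
    rw [SortE.substL_subst hl hV] at h2 ⊢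
    exact .of_step (.tSub hax hΔ (by simpa using hl) hJ.1 h2
      (args (Derivable.ctx hJ.1).isPreCtx hl hσ ha))
  | seqSub1 hax hY hl hJ h1 h2 ha =>
    have hV := Derivable.scoped hN hJ.1
    have h3 := h1.2 hσ
    have h4 := h2.2 hσ
    simp only [Judg.substTo] at h3 h4 ⊢
    rw [SortE.substL_subst hl hV.1] at h3 ⊢
    rw [SortE.substL_subst hl hV.2] at h4 ⊢
    exact .of_step (.seqSub1 hax hΔ (by simpa using hl) hJ.1 h3 h4
      (args (Derivable.ctx hJ.1).isPreCtx hl hσ ha))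
  | seqSub2 hax hY hl hl' hJ h1 h2 ha =>
    have hX := introSort_isPreCtx hJ.1
    refine .of_step (.seqSub2 hax hΔ (by simpa using hl) (by simpa using hl') hJ.1
      (h1.2 hσ) (h2.2 hσ) fun i hi hf hg => ?_)
    have := (ha i hi (by simpa using hf) (by simpa using hg)).2 hσ
    rw [← subPre_subst hX hl, List.getElem_map, List.getElem_map]
    exact this
  | teqSub1 hax hY hl hJ h1 h2 ha =>
    have hV := Derivable.scoped hN hJ.1
    have h3 := h1.2 hσ
    have h4 := h2.2 hσ
    simp only [Judg.substTo] at h3 h4 ⊢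
    rw [SortE.substL_subst hl hV.2.2, Expr.substL_subst hl hV.1] at h3 ⊢
    rw [SortE.substL_subst hl hV.2.2] at h4
    rw [Expr.substL_subst hl hV.2.1] at h4 ⊢
    exact .of_step (.teqSub1 hax hΔ (by simpa using hl) hJ.1 h3 h4
      (args (Derivable.ctx hJ.1).isPreCtx hl hσ ha))
  | teqSub2 hax hY hl hl' hJ h1 h2 ha =>
    have hX := introTerm_isPreCtx hJ.1
    have hV := (Derivable.sort_of_term hJ.1).scoped hN
    have h3 := h1.2 hσ
    have h4 := h2.2 hσ
    simp only [Judg.substTo, Expr.subst_app] at h3 h4 ⊢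
    rw [SortE.substL_subst hl hV] at h3 h4 ⊢
    refine .of_step (.teqSub2 hax hΔ (by simpa using hl) (by simpa using hl') hJ.1
      h3 h4 fun i hi hf hg => ?_)
    have := (ha i hi (by simpa using hf) (by simpa using hg)).2 hσ
    rw [← subPre_subst hX hl, List.getElem_map, List.getElem_map]
    exact this

theorem Derivable.var (hN : Nice Ax) {Δ : PreCtx A} (hΔ : Derivable Ax (.ctx Δ))
    {p : A.Var × SortE A} (hp : p ∈ Δ) : Derivable Ax (.term Δ (.var p.1) p.2) := by
  obtain ⟨i, hi, rfl⟩ := List.getElem_of_mem hp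
  clear hp
  induction i using Nat.strong_induction_on with
  | _ i ih =>
    have hσ : SubOK Ax Δ .var (Δ.take i) := by
      refine ⟨hΔ, fun p hp => ?_⟩
      obtain ⟨j, hj, rfl⟩ := List.getElem_of_mem hp
      rw [List.length_take] at hj
      rw [SortE.subst_id, List.getElem_take]
      exact ih j (by omega) (by omega)
    have := (hΔ.sort_of_ctx i hi).subst hN hσ
    simp only [Judg.substTo, SortE.subst_id] at this
    exact .of_step (.var hi this)

theorem SubOK.of_subset (hN : Nice Ax) {Γ Δ : PreCtx A} (hΔ : Derivable Ax (.ctx Δ))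
    (h : Γ ⊆ Δ) : SubOK Ax Δ .var Γ := by
  refine ⟨hΔ, fun p hp => ?_⟩
  rw [SortE.subst_id]
  exact Derivable.var hN hΔ (h hp)

theorem Derivable.substSort (hN : Nice Ax) {Γ Δ : PreCtx A} {U : SortE A} {σ : A.Var → Expr A}
    (h : Derivable Ax (.sort Γ U)) (hσ : SubOK Ax Δ σ Γ) :
    Derivable Ax (.sort Δ (U.subst σ)) := Derivable.subst hN h hσ

theorem Derivable.substTerm (hN : Nice Ax) {Γ Δ : PreCtx A} {u : Expr A} {U : SortE A}
    {σ : A.Var → Expr A} (h : Derivable Ax (.term Γ u U)) (hσ : SubOK Ax Δ σ Γ) :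
    Derivable Ax (.term Δ (u.subst σ) (U.subst σ)) := Derivable.subst hN h hσ

theorem Derivable.substSortEq (hN : Nice Ax) {Γ Δ : PreCtx A} {U V : SortE A}
    {σ : A.Var → Expr A} (h : Derivable Ax (.sortEq Γ U V)) (hσ : SubOK Ax Δ σ Γ) :
    Derivable Ax (.sortEq Δ (U.subst σ) (V.subst σ)) := Derivable.subst hN h hσ

theorem Derivable.substTermEq (hN : Nice Ax) {Γ Δ : PreCtx A} {u v : Expr A} {U : SortE A}
    {σ : A.Var → Expr A} (h : Derivable Ax (.termEq Γ u v U)) (hσ : SubOK Ax Δ σ Γ) :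
    Derivable Ax (.termEq Δ (u.subst σ) (v.subst σ) (U.subst σ)) := Derivable.subst hN h hσ

theorem DerTerm.subst (hN : Nice Ax) {Γ Δ : PreCtx A} {u : Expr A} {σ : A.Var → Expr A}
    (h : DerTerm Ax Γ u) (hσ : SubOK Ax Δ σ Γ) : DerTerm Ax Δ (u.subst σ) :=
  let ⟨_, hU⟩ := h; ⟨_, hU.substTerm hN hσ⟩

theorem DerTermEq.subst (hN : Nice Ax) {Γ Δ : PreCtx A} {u v : Expr A} {σ : A.Var → Expr A}
    (h : DerTermEq Ax Γ u v) (hσ : SubOK Ax Δ σ Γ) :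
    DerTermEq Ax Δ (u.subst σ) (v.subst σ) :=
  let ⟨_, hU⟩ := h; ⟨_, hU.substTermEq hN hσ⟩

theorem DerTerm.weaken (hN : Nice Ax) {Γ Δ : PreCtx A} {u : Expr A} (h : DerTerm Ax Γ u)
    (hΔ : Derivable Ax (.ctx Δ)) (hs : Γ ⊆ Δ) : DerTerm Ax Δ u := by
  have := h.subst hN (SubOK.of_subset hN hΔ hs)
  rwa [Expr.subst_id] at this

/-- Two substitutions that are derivably equal. -/
def SubEq (Ax : Set (Judg A)) (Δ : PreCtx A) (σ τ : A.Var → Expr A) (Γ : PreCtx A) : Prop :=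
  SubOK Ax Δ σ Γ ∧ SubOK Ax Δ τ Γ ∧
    ∀ p ∈ Γ, Derivable Ax (.termEq Δ (σ p.1) (τ p.1) (p.2.subst σ))

def Judg.CongrTo (Ax : Set (Judg A)) (Δ : PreCtx A) (σ τ : A.Var → Expr A) : Judg A → Prop
  | .sort _ U => Derivable Ax (.sortEq Δ (U.subst σ) (U.subst τ))
  | .term _ u U => Derivable Ax (.termEq Δ (u.subst σ) (u.subst τ) (U.subst σ))
  | _ => True

theorem Derivable.congrTo (hN : Nice Ax) {J : Judg A} (hJ : Derivable Ax J) :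
    ∀ {Δ : PreCtx A} {σ τ : A.Var → Expr A}, SubEq Ax Δ σ τ J.ctxOf → J.CongrTo Ax Δ σ τ := by
  refine Derivable.induct (P := fun J => ∀ {Δ : PreCtx A} {σ τ : A.Var → Expr A},
    SubEq Ax Δ σ τ J.ctxOf → J.CongrTo Ax Δ σ τ) ?_ hJ
  clear hJ J
  intro J hs Δ σ τ hσ
  have hΔ := hσ.1.1.isPreCtx
  cases hs with
  | seqt h1 h2 =>
    have e1 := h1.1.substSortEq hN hσ.1
    have e2 := h2.2 hσ
    exact .of_step (.seqteq e1 e2 (.of_step (.seqt e1 e2.term_of_termEq.1))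
      (.of_step (.seqt e1 e2.term_of_termEq.2)))
  | var hi h =>
    simp only [Judg.CongrTo, Expr.subst_var]
    exact hσ.2.2 _ (List.getElem_mem _)
  | sA hax h hv =>
    rename_i X U
    obtain ⟨S, f⟩ := U
    have hf := hN.sort_shape _ _ hax
    simp only at hf
    subst hf
    have hU : Derivable Ax (.sort X ⟨S, ctxVars X⟩) :=
      .of_step (.sA hax h.1 fun i hi => (hv i hi).1)
    refine .of_step (.seqSub2 hax hΔ (by simp [ctxVars]) (by simp [ctxVars]) hU
      (hU.substSort hN hσ.1) (hU.substSort hN hσ.2.1) fun i hi hf hg => ?_)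
    rw [subPre_ctxVars_map h.1.isPreCtx, getElem_ctxVars_map, getElem_ctxVars_map]
    exact hσ.2.2 _ (List.getElem_mem _)
  | tA hax h hv =>
    rename_i X u U
    obtain ⟨t, rfl⟩ := hN.term_shape _ _ _ hax
    have hu : Derivable Ax (.term X (.app t (ctxVars X)) U) :=
      .of_step (.tA hax h.1 fun i hi => (hv i hi).1)
    have hU : ScopedS X U := h.1.scoped hN
    have hX : IsPreCtx X := (Derivable.ctx h.1).isPreCtx
    have e1 := hu.substTerm hN hσ.1
    have e2 := hu.substTerm hN hσ.2.1
    have e3 : Derivable Ax (.sortEq Δ _ _) := h.2 hσ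
    have e4 := Derivable.of_step (.seqt (.of_step (.s2 e3)) e2)
    simp only [Judg.CongrTo, Expr.subst_app] at e1 e4 ⊢
    rw [← SortE.substL_ctxVars_map σ hU] at e1 e4 ⊢
    refine .of_step (.teqSub2 hax hΔ (by simp [ctxVars]) (by simp [ctxVars]) hu e1 e4
      fun i hi hf hg => ?_)
    rw [subPre_ctxVars_map hX, getElem_ctxVars_map, getElem_ctxVars_map]
    exact hσ.2.2 _ (List.getElem_mem _)
  | sSub hax hY hl hJ hc ha =>
    have hX := introSort_isPreCtx hJ.1
    have hU := Derivable.of_step (.sSub hax hY hl hJ.1 hc.1 fun i hi hf => (ha i hi hf).1)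
    refine .of_step (.seqSub2 hax hΔ (by simpa using hl) (by simpa using hl) hJ.1
      (hU.substSort hN hσ.1) (hU.substSort hN hσ.2.1) fun i hi hf hg => ?_)
    rw [← subPre_subst hX hl, List.getElem_map, List.getElem_map]
    exact (ha i hi (by simpa using hf)).2 hσ
  | tSub hax hY hl hJ hU ha =>
    have hX := introTerm_isPreCtx hJ.1
    have hV := (Derivable.sort_of_term hJ.1).scoped hN
    have hu := Derivable.of_step (.tSub hax hY hl hJ.1 hU.1 fun i hi hf => (ha i hi hf).1)
    have e1 := hu.substTerm hN hσ.1
    have e2 := hu.substTerm hN hσ.2.1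
    have e3 : Derivable Ax (.sortEq Δ _ _) := hU.2 hσ
    have e4 := Derivable.of_step (.seqt (.of_step (.s2 e3)) e2)
    simp only [Judg.CongrTo, Expr.subst_app] at e1 e4 ⊢
    rw [SortE.substL_subst hl hV] at e1 e4 ⊢
    refine .of_step (.teqSub2 hax hΔ (by simpa using hl) (by simpa using hl) hJ.1 e1 e4
      fun i hi hf hg => ?_)
    rw [← subPre_subst hX hl, List.getElem_map, List.getElem_map]
    exact (ha i hi (by simpa using hf)).2 hσ
  | _ => trivial

theorem Derivable.congrSort (hN : Nice Ax) {Γ Δ : PreCtx A} {U : SortE A} {σ τ : A.Var → Expr A}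
    (h : Derivable Ax (.sort Γ U)) (hσ : SubEq Ax Δ σ τ Γ) :
    Derivable Ax (.sortEq Δ (U.subst σ) (U.subst τ)) := Derivable.congrTo hN h hσ

/-! ## Unique typing and partial equality judgments -/

theorem Derivable.canon (hN : Nice Ax) {X : PreCtx A} {u : Expr A} {U C : SortE A}
    (h : Derivable Ax (.term X u U)) (hC : CanonSort Ax X u C) :
    Derivable Ax (.term X u C) ∧ Derivable Ax (.sortEq X C U) := by
  obtain ⟨n, hn⟩ := h
  obtain ⟨D, hD, h1, h2, -⟩ := hn.term_inv hN
  rw [CanonSort.unique hN (Derivable.ctx hn.derivable).nodup hC hD]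
  exact ⟨⟨n, h1⟩, ⟨n, h2⟩⟩

theorem DerAt.canon (hN : Nice Ax) {n : ℕ} {X : PreCtx A} {u : Expr A} {U C : SortE A}
    (h : DerAt Ax n (.term X u U)) (hC : CanonSort Ax X u C) :
    DerAt Ax n (.term X u C) ∧ DerAt Ax n (.sortEq X C U) := by
  obtain ⟨D, hD, h1, h2, -⟩ := h.term_inv hN
  rw [CanonSort.unique hN (Derivable.ctx h.derivable).nodup hC hD]
  exact ⟨h1, h2⟩

theorem DerTerm.exists_canon (hN : Nice Ax) {X : PreCtx A} {u : Expr A} (h : DerTerm Ax X u) :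
    ∃ C, CanonSort Ax X u C := by
  obtain ⟨U, n, hn⟩ := h
  obtain ⟨D, hD, -⟩ := hn.term_inv hN
  exact ⟨D, hD⟩

theorem DerTerm.canon (hN : Nice Ax) {X : PreCtx A} {u : Expr A} {C : SortE A}
    (h : DerTerm Ax X u) (hC : CanonSort Ax X u C) : Derivable Ax (.term X u C) := by
  obtain ⟨U, hU⟩ := h
  exact (hU.canon hN hC).1

theorem Derivable.uniq_sort (hN : Nice Ax) {X : PreCtx A} {u : Expr A} {U V : SortE A}
    (h1 : Derivable Ax (.term X u U)) (h2 : Derivable Ax (.term X u V)) :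
    Derivable Ax (.sortEq X U V) := by
  obtain ⟨C, hC⟩ := DerTerm.exists_canon hN ⟨U, h1⟩
  exact .of_step (.s3 (.of_step (.s2 (h1.canon hN hC).2)) (h2.canon hN hC).2)

theorem DerTermEq.conv (hN : Nice Ax) {X : PreCtx A} {u v : Expr A} {U : SortE A}
    (h : DerTermEq Ax X u v) (hu : Derivable Ax (.term X u U)) :
    Derivable Ax (.termEq X u v U) := by
  obtain ⟨W, hW⟩ := h
  have e := hW.term_of_termEq.1.uniq_sort hN hu
  exact .of_step (.seqteq e hW hu (.of_step (.seqt e hW.term_of_termEq.2)))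

theorem DerTermEq.left {X : PreCtx A} {u v : Expr A} (h : DerTermEq Ax X u v) :
    DerTerm Ax X u := let ⟨_, hW⟩ := h; ⟨_, hW.term_of_termEq.1⟩

theorem DerTermEq.right {X : PreCtx A} {u v : Expr A} (h : DerTermEq Ax X u v) :
    DerTerm Ax X v := let ⟨_, hW⟩ := h; ⟨_, hW.term_of_termEq.2⟩

theorem DerTerm.refl {X : PreCtx A} {u : Expr A} (h : DerTerm Ax X u) : DerTermEq Ax X u u :=
  let ⟨_, hW⟩ := h; ⟨_, .of_step (.t1 hW)⟩

theorem DerTermEq.symm {X : PreCtx A} {u v : Expr A} (h : DerTermEq Ax X u v) :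
    DerTermEq Ax X v u := let ⟨_, hW⟩ := h; ⟨_, .of_step (.t2 hW)⟩

theorem DerTermEq.trans (hN : Nice Ax) {X : PreCtx A} {u v w : Expr A}
    (h1 : DerTermEq Ax X u v) (h2 : DerTermEq Ax X v w) : DerTermEq Ax X u w :=
  let ⟨_, hW⟩ := h1
  ⟨_, .of_step (.t3 hW (h2.conv hN hW.term_of_termEq.2))⟩

theorem forall₂_getElem {α β : Type*} {R : α → β → Prop} {l : List α} {l' : List β}
    (h : List.Forall₂ R l l') (i : ℕ) (hi : i < l.length) (hi' : i < l'.length) :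
    R l[i] l'[i] := by
  simpa using (List.forall₂_iff_get.1 h).2 i hi hi'

theorem DerTerm.app_inv (hN : Nice Ax) {Y : PreCtx A} {t : A.TermSym} {f : List (Expr A)}
    (h : DerTerm Ax Y (.app t f)) : ∃ m C, AppAt Ax m Y t f C ∧ CanonSort Ax Y (.app t f) C := by
  obtain ⟨U, n, hn⟩ := h
  obtain ⟨C, hC, -, -, h⟩ := hn.term_inv hN
  obtain ⟨m, -, h⟩ := h t f rfl
  exact ⟨m, C, h, hC⟩

theorem DerTerm.arg (hN : Nice Ax) {Y : PreCtx A} {t : A.TermSym} {f : List (Expr A)}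
    (h : DerTerm Ax Y (.app t f)) {e : Expr A} (he : e ∈ f) : DerTerm Ax Y e := by
  obtain ⟨m, C, ⟨X, V, -, -, hl, -, ha⟩, -⟩ := h.app_inv hN
  obtain ⟨i, hi, rfl⟩ := List.getElem_of_mem he
  exact ⟨_, m, ha i (by omega) hi⟩

theorem DerAt.sort_arg (hN : Nice Ax) {n : ℕ} {Y : PreCtx A} {U : SortE A}
    (h : DerAt Ax n (.sort Y U)) {e : Expr A} (he : e ∈ U.args) :
    ∃ W m, m < n ∧ DerAt Ax m (.term Y e W) := by
  obtain ⟨X, -, -, hl, m, hm, ha⟩ := DerAt.sort_inv (S := U.head) (f := U.args) hN h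
  obtain ⟨i, hi, rfl⟩ := List.getElem_of_mem he
  exact ⟨_, m, hm, ha i (by omega) hi⟩

theorem DerAt.term_arg (hN : Nice Ax) {n : ℕ} {Y : PreCtx A} {t : A.TermSym} {f : List (Expr A)}
    {U : SortE A} (h : DerAt Ax n (.term Y (.app t f) U)) {e : Expr A} (he : e ∈ f) :
    ∃ W m, m < n ∧ DerAt Ax m (.term Y e W) := by
  obtain ⟨C, hC, -, -, h⟩ := h.term_inv hN
  obtain ⟨m, hm, ⟨X, V, -, -, hl, -, ha⟩⟩ := h t f rfl
  obtain ⟨i, hi, rfl⟩ := List.getElem_of_mem he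
  exact ⟨_, m, hm, ha i (by omega) hi⟩

theorem Derivable.sort_arg (hN : Nice Ax) {Y : PreCtx A} {U : SortE A}
    (h : Derivable Ax (.sort Y U)) {e : Expr A} (he : e ∈ U.args) : DerTerm Ax Y e := by
  obtain ⟨n, hn⟩ := h
  obtain ⟨W, m, -, h⟩ := hn.sort_arg hN he
  exact ⟨W, m, h⟩

theorem Derivable.sort_congr (hN : Nice Ax) {Y : PreCtx A} {S : A.SortSym} {f g : List (Expr A)}
    (h1 : Derivable Ax (.sort Y ⟨S, f⟩)) (h2 : Derivable Ax (.sort Y ⟨S, g⟩))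
    (h : List.Forall₂ (DerTermEq Ax Y) f g) : Derivable Ax (.sortEq Y ⟨S, f⟩ ⟨S, g⟩) := by
  obtain ⟨n, hn⟩ := h1
  obtain ⟨X, hax, hJ, hl, m, -, ha⟩ := hn.sort_inv hN
  have hY : IsPreCtx Y := (Derivable.ctx h2).isPreCtx
  refine .of_step (.seqSub2 hax hY hl (h.length_eq ▸ hl) hJ ⟨n, hn⟩ h2
    fun i hi hf hg => ?_)
  rw [subPre_eq_subst (introSort_isPreCtx hJ) hl]
  exact (forall₂_getElem h i hf hg).conv hN ⟨m, ha i hi hf⟩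

theorem subOK_mkSub {X Y : PreCtx A} (hX : Derivable Ax (.ctx X)) (hY : Derivable Ax (.ctx Y))
    {f : List (Expr A)} (hl : f.length = X.length)
    (ha : ∀ i (hi : i < X.length) (hf : i < f.length),
      Derivable Ax (.term Y f[i] ((X[i]).2.subst (lookupV (mkSub X f))))) :
    SubOK Ax Y (lookupV (mkSub X f)) X := by
  refine ⟨hY, fun p hp => ?_⟩
  obtain ⟨i, hi, rfl⟩ := List.getElem_of_mem hp
  rw [lookupV_mkSub hX.nodup hi (by omega)]
  exact ha i hi (by omega)

theorem DerTerm.app_congr (hN : Nice Ax) {Y : PreCtx A} {t : A.TermSym} {f g : List (Expr A)}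
    (h1 : DerTerm Ax Y (.app t f)) (h2 : DerTerm Ax Y (.app t g))
    (h : List.Forall₂ (DerTermEq Ax Y) f g) : DerTermEq Ax Y (.app t f) (.app t g) := by
  obtain ⟨m, C, ⟨X, V, hax, hJ, hl, rfl, ha⟩, hC⟩ := h1.app_inv hN
  obtain ⟨m', C', ⟨X', V', hax', hJ', hl', rfl, ha'⟩, hC'⟩ := h2.app_inv hN
  obtain ⟨rfl, rfl⟩ := hN.term_uniq _ _ _ _ _ hax hax'
  have hX : Derivable Ax (.ctx X) := Derivable.ctx hJ
  obtain ⟨W, hW⟩ := id h1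
  have hY : Derivable Ax (.ctx Y) := Derivable.ctx hW
  have heq : ∀ i (hi : i < X.length) (hf : i < f.length) (hg : i < g.length),
      Derivable Ax (.termEq Y f[i] g[i] ((X[i]).2.subst (lookupV (mkSub X f)))) :=
    fun i hi hf hg => (forall₂_getElem h i hf hg).conv hN ⟨m, ha i hi hf⟩
  have hS : SubEq Ax Y (lookupV (mkSub X f)) (lookupV (mkSub X g)) X := by
    refine ⟨subOK_mkSub hX hY hl fun i hi hf => ⟨m, ha i hi hf⟩,
      subOK_mkSub hX hY hl' fun i hi hf => ⟨m', ha' i hi hf⟩, fun p hp => ?_⟩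
    obtain ⟨i, hi, rfl⟩ := List.getElem_of_mem hp
    rw [lookupV_mkSub hX.nodup hi (by omega), lookupV_mkSub hX.nodup hi (by omega)]
    exact heq i hi (by omega) (by omega)
  have e := hJ.sort_of_term.congrSort hN hS
  refine ⟨_, .of_step (.teqSub2 hax hY.isPreCtx hl hl' hJ (h1.canon hN hC)
    (.of_step (.seqt (.of_step (.s2 e)) (h2.canon hN hC'))) fun i hi hf hg => ?_)⟩
  rw [subPre_eq_subst hX.isPreCtx hl]
  exact heq i hi hf hg

theorem CanonSort.subst (hN : Nice Ax) {X Y : PreCtx A} {t : A.TermSym} {f : List (Expr A)}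
    {C : SortE A} (h : DerTerm Ax X (.app t f)) (hC : CanonSort Ax X (.app t f) C)
    (σ : A.Var → Expr A) : CanonSort Ax Y (.app t (f.map (Expr.subst σ))) (C.subst σ) := by
  obtain ⟨m, C', ⟨Xa, V, hax, hJ, hl, rfl, ha⟩, hC'⟩ := h.app_inv hN
  obtain ⟨W, hW⟩ := id h
  rw [CanonSort.unique hN (Derivable.ctx hW).nodup hC hC',
    SortE.substL_subst hl (hJ.sort_of_term.scoped hN)]
  exact .app hax

end

section

variable {A B : Alphabet}

/-! ## Lexicographic products of lists -/

/-- The lexicographically ordered list of the values `F a b`. -/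
def prodMap {α β γ : Type} (F : α → β → γ) (as : List α) (bs : List β) : List γ :=
  as.flatMap fun a => bs.map (F a)

section prodMap
variable {α β γ δ : Type} {F G : α → β → γ} {as : List α} {bs : List β}

theorem prodMap_cons {a : α} : prodMap F (a :: as) bs = bs.map (F a) ++ prodMap F as bs := by
  simp [prodMap]

theorem prodMap_append {as' : List α} :
    prodMap F (as ++ as') bs = prodMap F as bs ++ prodMap F as' bs := by
  simp [prodMap]

theorem prodMap_singleton {a : α} : prodMap F [a] bs = bs.map (F a) := by
  simp [prodMap]

theorem mem_prodMap {c : γ} : c ∈ prodMap F as bs ↔ ∃ a ∈ as, ∃ b ∈ bs, F a b = c := by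
  simp [prodMap]

theorem length_prodMap : (prodMap F as bs).length = as.length * bs.length := by
  simp [prodMap, List.length_flatMap]

theorem prodMap_congr (h : ∀ a ∈ as, ∀ b ∈ bs, F a b = G a b) :
    prodMap F as bs = prodMap G as bs := by
  unfold prodMap
  refine List.flatMap_congr fun a ha => List.map_congr_left fun b hb => h a ha b hb

theorem map_prodMap (g : γ → δ) :
    (prodMap F as bs).map g = prodMap (fun a b => g (F a b)) as bs := by
  simp [prodMap, List.map_flatMap, Function.comp_def]

theorem prodMap_map {α' β' : Type} {F : α' → β' → γ} (f : α → α') (g : β → β') :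
    prodMap F (as.map f) (bs.map g) = prodMap (fun a b => F (f a) (g b)) as bs := by
  simp [prodMap, List.flatMap_map, Function.comp_def]

theorem getElem_prodMap (i j : ℕ) (hi : i < as.length) (hj : j < bs.length)
    (h : i * bs.length + j < (prodMap F as bs).length) :
    (prodMap F as bs)[i * bs.length + j] = F as[i] bs[j] := by
  induction as generalizing i with
  | nil => simp at hi
  | cons a as ih =>
    cases i with
    | zero =>
      simp only [Nat.zero_mul, Nat.zero_add, prodMap_cons, List.getElem_cons_zero]
      rw [List.getElem_append_left (by simpa using hj), List.getElem_map]
    | succ i =>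
      have e : (i + 1) * bs.length + j = bs.length + (i * bs.length + j) := by ring
      simp only [prodMap_cons, List.getElem_cons_succ, e]
      rw [List.getElem_append_right (by simp)]
      simp only [List.length_map, Nat.add_sub_cancel_left]
      exact ih i (by simpa using hi) _

theorem lex_lt {m n i j : ℕ} (hi : i < m) (hj : j < n) : i * n + j < m * n := by
  calc i * n + j < i * n + n := by omega
    _ = (i + 1) * n := by ring
    _ ≤ m * n := Nat.mul_le_mul_right n hi

theorem lex_cases {m n k : ℕ} (hk : k < m * n) : ∃ i j, i < m ∧ j < n ∧ k = i * n + j := by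
  have hn : 0 < n := by
    rcases Nat.eq_zero_or_pos n with rfl | h
    · simp at hk
    · exact h
  exact ⟨k / n, k % n, Nat.div_lt_of_lt_mul (by rwa [Nat.mul_comm]), Nat.mod_lt _ hn,
    (Nat.div_add_mod' k n).symm⟩

theorem eq_prodMap {L : List γ} (hl : L.length = as.length * bs.length)
    (h : ∀ i j (hi : i < as.length) (hj : j < bs.length) (hk : i * bs.length + j < L.length),
      L[i * bs.length + j] = F as[i] bs[j]) : L = prodMap F as bs := by
  refine List.ext_getElem (by rw [hl, length_prodMap]) fun k h1 h2 => ?_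
  obtain ⟨i, j, hi, hj, rfl⟩ := lex_cases (hl ▸ h1)
  rw [h i j hi hj, getElem_prodMap i j hi hj]

theorem isGrid_prodMap {M : ℕ → ℕ → γ}
    (h : ∀ i j (hi : i < as.length) (hj : j < bs.length), M i j = F as[i] bs[j]) :
    IsGrid as.length bs.length M (prodMap F as bs) :=
  ⟨length_prodMap, fun i j hi hj hk => by rw [getElem_prodMap i j hi hj, h]⟩

theorem IsGrid.eq_prodMap {m n : ℕ} {M : ℕ → ℕ → γ} {L : List γ} (hL : IsGrid m n M L)
    (hm : m = as.length) (hn : n = bs.length)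
    (h : ∀ i j (hi : i < as.length) (hj : j < bs.length), M i j = F as[i] bs[j]) :
    L = prodMap F as bs := by
  subst hm hn
  exact GATPaper.eq_prodMap hL.1 fun i j hi hj hk => by rw [hL.2 i j hi hj hk, h]

theorem dropLast_prodMap {a : α} {b : β} :
    (prodMap F (as ++ [a]) (bs ++ [b])).dropLast = prodMap F as (bs ++ [b]) ++ bs.map (F a) := by
  rw [prodMap_append, prodMap_singleton, List.map_append, ← List.append_assoc]
  simp

theorem IsGrid.dropLast_eq {M : ℕ → ℕ → γ} {L : List γ} {a : α} {b : β}
    (hL : IsGrid (as.length + 1) (bs.length + 1) M L)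
    (h : ∀ i j (hi : i < as.length) (hj : j < bs.length), M i j = F as[i] bs[j])
    (ha : ∀ j (hj : j < bs.length), M as.length j = F a bs[j])
    (hb : ∀ i (hi : i < as.length), M i bs.length = F as[i] b) :
    L.dropLast = prodMap F as (bs ++ [b]) ++ bs.map (F a) := by
  rw [← dropLast_prodMap]
  have hl : L.length = (prodMap F (as ++ [a]) (bs ++ [b])).length := by
    rw [hL.1, length_prodMap]; simp
  refine List.ext_getElem (by simp [hl]) fun k h1 h2 => ?_
  rw [List.getElem_dropLast, List.getElem_dropLast]
  have h3 : k < (as.length + 1) * (bs.length + 1) - 1 := by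
    rw [List.length_dropLast, hL.1] at h1; exact h1
  obtain ⟨i, j, hi, hj, rfl⟩ := lex_cases (m := as.length + 1) (n := bs.length + 1) (k := k)
    (by omega)
  have e := getElem_prodMap (F := F) (as := as ++ [a]) (bs := bs ++ [b]) i j (by simpa using hi)
    (by simpa using hj) (by rw [length_prodMap]; simpa using lex_lt hi hj)
  simp only [List.length_append, List.length_cons, List.length_nil, Nat.zero_add] at e
  rw [hL.2 i j hi hj, e]
  rcases Nat.lt_or_ge i as.length with hi' | hi'
  · rcases Nat.lt_or_ge j bs.length with hj' | hj'
    · rw [h i j hi' hj', List.getElem_append_left hi', List.getElem_append_left hj']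
    · obtain rfl : j = bs.length := by omega
      rw [hb i hi', List.getElem_append_left hi']
      simp
  · obtain rfl : i = as.length := by omega
    rcases Nat.lt_or_ge j bs.length with hj' | hj'
    · rw [ha j hj', List.getElem_append_left hj']
      simp
    · obtain rfl : j = bs.length := by omega
      exfalso
      have : (as.length + 1) * (bs.length + 1) = as.length * (bs.length + 1) + bs.length + 1 := by
        ring
      omega

theorem forall₂_map_map {α β γ : Type} {R : β → γ → Prop} {l : List α} {f : α → β} {g : α → γ}
    (h : ∀ a ∈ l, R (f a) (g a)) : List.Forall₂ R (l.map f) (l.map g) := by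
  induction l with
  | nil => exact .nil
  | cons a l ih =>
    exact .cons (h a (by simp)) (ih fun b hb => h b (by simp [hb]))

theorem forall₂_append {α β : Type} {R : α → β → Prop} {l₁ l₂ : List α} {k₁ k₂ : List β}
    (h1 : List.Forall₂ R l₁ k₁) (h2 : List.Forall₂ R l₂ k₂) :
    List.Forall₂ R (l₁ ++ l₂) (k₁ ++ k₂) := by
  induction h1 with
  | nil => exact h2
  | cons h _ ih => exact .cons h ih

theorem forall₂_flatMap {α β γ : Type} {R : β → γ → Prop} {l : List α} {f : α → List β}
    {g : α → List γ} (h : ∀ a ∈ l, List.Forall₂ R (f a) (g a)) :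
    List.Forall₂ R (l.flatMap f) (l.flatMap g) := by
  induction l with
  | nil => exact .nil
  | cons a l ih =>
    simp only [List.flatMap_cons]
    exact forall₂_append (h a (by simp)) (ih fun b hb => h b (by simp [hb]))

theorem forall₂_prodMap {R : γ → δ → Prop} {H : α → β → δ}
    (h : ∀ a ∈ as, ∀ b ∈ bs, R (F a b) (H a b)) :
    List.Forall₂ R (prodMap F as bs) (prodMap H as bs) :=
  forall₂_flatMap fun a ha => forall₂_map_map fun b hb => h a ha b hb

end prodMap

/-! ## Canonical tensors of terms -/

variable {TA : Set (Judg A)} {TB : Set (Judg B)}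

/-- The graph of the tensor of terms of the contexts `X` and `Y`, taken at their canonical
sorts. -/
inductive CT (TA : Set (Judg A)) (TB : Set (Judg B)) (X : PreCtx A) (Y : PreCtx B) :
    Expr A → Expr B → Expr (A.tensor B) → Prop where
  | vv {x : A.Var} {y : B.Var} (hx : x ∈ X.map Prod.fst) (hy : y ∈ Y.map Prod.fst) :
      CT TA TB X Y (.var x) (.var y) (.var (x, y))
  | va {u : Expr A} {S : A.SortSym} {ss : List (Expr A)} {t : B.TermSym} {ts : List (Expr B)}
      (M : Expr A → Expr B → Expr (A.tensor B)) (hu : CanonSort TA X u ⟨S, ss⟩)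
      (hM : ∀ a ∈ ss, ∀ b ∈ ts, CT TA TB X Y a b (M a b))
      (hMu : ∀ b ∈ ts, CT TA TB X Y u b (M u b)) :
      CT TA TB X Y u (.app t ts) (.app (Sum.inl (S, t)) (prodMap M ss ts ++ ts.map (M u)))
  | av {s : A.TermSym} {us : List (Expr A)} {y : B.Var} {T : B.SortSym} {ts : List (Expr B)}
      (M : Expr A → Expr B → Expr (A.tensor B)) (hy : CanonSort TB Y (.var y) ⟨T, ts⟩)
      (hM : ∀ a ∈ us, ∀ b ∈ ts, CT TA TB X Y a b (M a b))
      (hMy : ∀ a ∈ us, CT TA TB X Y a (.var y) (M a (.var y))) :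
      CT TA TB X Y (.app s us) (.var y)
        (.app (Sum.inr (s, T)) (prodMap M us (ts ++ [.var y])))

theorem CT.vv_inv {X : PreCtx A} {Y : PreCtx B} {x : A.Var} {y : B.Var} {e : Expr (A.tensor B)}
    (h : CT TA TB X Y (.var x) (.var y) e) :
    e = .var (x, y) ∧ x ∈ X.map Prod.fst ∧ y ∈ Y.map Prod.fst := by
  cases h with
  | vv hx hy => exact ⟨rfl, hx, hy⟩

theorem CT.va_inv {X : PreCtx A} {Y : PreCtx B} {u : Expr A} {t : B.TermSym}
    {ts : List (Expr B)} {e : Expr (A.tensor B)} (h : CT TA TB X Y u (.app t ts) e) :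
    ∃ S ss M, CanonSort TA X u ⟨S, ss⟩ ∧ (∀ a ∈ ss, ∀ b ∈ ts, CT TA TB X Y a b (M a b)) ∧
      (∀ b ∈ ts, CT TA TB X Y u b (M u b)) ∧
      e = .app (Sum.inl (S, t)) (prodMap M ss ts ++ ts.map (M u)) := by
  cases h with
  | va M hu hM hMu => exact ⟨_, _, M, hu, hM, hMu, rfl⟩

theorem CT.av_inv {X : PreCtx A} {Y : PreCtx B} {s : A.TermSym} {us : List (Expr A)} {y : B.Var}
    {e : Expr (A.tensor B)} (h : CT TA TB X Y (.app s us) (.var y) e) :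
    ∃ T ts M, CanonSort TB Y (.var y) ⟨T, ts⟩ ∧
      (∀ a ∈ us, ∀ b ∈ ts, CT TA TB X Y a b (M a b)) ∧
      (∀ a ∈ us, CT TA TB X Y a (.var y) (M a (.var y))) ∧
      e = .app (Sum.inr (s, T)) (prodMap M us (ts ++ [.var y])) := by
  cases h with
  | av M hy hM hMy => exact ⟨_, _, M, hy, hM, hMy, rfl⟩

theorem CT.mono {X X' : PreCtx A} {Y Y' : PreCtx B} (hX : X ⊆ X') (hY : Y ⊆ Y')
    {u : Expr A} {v : Expr B} {e : Expr (A.tensor B)} (h : CT TA TB X Y u v e) :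
    CT TA TB X' Y' u v e := by
  induction h with
  | vv hx hy => exact .vv (List.map_subset _ hX hx) (List.map_subset _ hY hy)
  | va M hu hM hMu ih1 ih2 => exact .va M (hu.mono hX) ih1 ih2
  | av M hy hM hMy ih1 ih2 => exact .av M (hy.mono hY) ih1 ih2

theorem CT.unique (NA : Nice TA) (NB : Nice TB) {X : PreCtx A} {Y : PreCtx B}
    (hX : (X.map Prod.fst).Nodup) (hY : (Y.map Prod.fst).Nodup)
    {u : Expr A} {v : Expr B} {e : Expr (A.tensor B)} (h : CT TA TB X Y u v e) :
    ∀ {e' : Expr (A.tensor B)}, CT TA TB X Y u v e' → e = e' := by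
  induction h with
  | vv hx hy => intro e' h'; exact h'.vv_inv.1.symm
  | va M hu hM hMu ih1 ih2 =>
    intro e' h'
    obtain ⟨S, ss, M', hu', h1, h2, rfl⟩ := h'.va_inv
    cases CanonSort.unique NA hX hu hu'
    rw [prodMap_congr fun a ha b hb => ih1 a ha b hb (h1 a ha b hb),
      List.map_congr_left fun b hb => ih2 b hb (h2 b hb)]
  | av M hy hM hMy ih1 ih2 =>
    intro e' h'
    obtain ⟨T, ts, M', hy', h1, h2, rfl⟩ := h'.av_inv
    cases CanonSort.unique NB hY hy hy'
    congr 1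
    refine prodMap_congr fun a ha b hb => ?_
    rcases List.mem_append.1 hb with hb | hb
    · exact ih1 a ha b hb (h1 a ha b hb)
    · rw [List.mem_singleton.1 hb]
      exact ih2 a ha (h2 a ha)

noncomputable instance : Inhabited (Expr A) := ⟨.var (Classical.choice A.var_infinite.nonempty)⟩

open Classical in
/-- The canonical tensor of two terms. -/
noncomputable def ct (TA : Set (Judg A)) (TB : Set (Judg B)) (X : PreCtx A) (Y : PreCtx B)
    (u : Expr A) (v : Expr B) : Expr (A.tensor B) :=
  Classical.epsilon fun e => CT TA TB X Y u v e

theorem CT.ct_spec {X : PreCtx A} {Y : PreCtx B} {u : Expr A} {v : Expr B}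
    {e : Expr (A.tensor B)} (h : CT TA TB X Y u v e) : CT TA TB X Y u v (ct TA TB X Y u v) :=
  Classical.epsilon_spec (p := fun e => CT TA TB X Y u v e) ⟨e, h⟩

theorem CT.eq_ct (NA : Nice TA) (NB : Nice TB) {X : PreCtx A} {Y : PreCtx B}
    (hX : (X.map Prod.fst).Nodup) (hY : (Y.map Prod.fst).Nodup)
    {u : Expr A} {v : Expr B} {e : Expr (A.tensor B)} (h : CT TA TB X Y u v e) :
    e = ct TA TB X Y u v := h.unique NA NB hX hY h.ct_spec

theorem CT.exists_of_der (NA : Nice TA) (NB : Nice TB) {X : PreCtx A} {Y : PreCtx B}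
    {u : Expr A} {v : Expr B} {n m : ℕ} {U : SortE A} {V : SortE B}
    (hu : DerAt TA n (.term X u U)) (hv : DerAt TB m (.term Y v V)) :
    CT TA TB X Y u v (ct TA TB X Y u v) := by
  generalize hN : n + m = N
  induction N using Nat.strong_induction_on generalizing n m u v U V with
  | _ N ih =>
    subst hN
    cases v with
    | app t ts =>
      obtain ⟨⟨S, ss⟩, hC, h1, -, -⟩ := hu.term_inv NA
      obtain ⟨n', hn', hs⟩ := h1.sort_of_term
      refine CT.ct_spec (.va (ct TA TB X Y) hC (fun a ha b hb => ?_) fun b hb => ?_)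
      · obtain ⟨_, n'', hn'', ha⟩ := hs.sort_arg NA ha
        obtain ⟨_, m', hm', hb⟩ := hv.term_arg NB hb
        exact ih (n'' + m') (by omega) ha hb rfl
      · obtain ⟨_, m', hm', hb⟩ := hv.term_arg NB hb
        exact ih (n + m') (by omega) hu hb rfl
    | var y =>
      cases u with
      | var x =>
        have h1 : ScopedE X (.var x) := (hu.derivable.scoped NA).1
        have h2 : ScopedE Y (.var y) := (hv.derivable.scoped NB).1
        exact CT.ct_spec (.vv (h1 x .var) (h2 y .var))
      | app s us =>
        obtain ⟨⟨T, ts⟩, hC, h1, -, -⟩ := hv.term_inv NB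
        obtain ⟨m', hm', hs⟩ := h1.sort_of_term
        refine CT.ct_spec (.av (ct TA TB X Y) hC (fun a ha b hb => ?_) fun a ha => ?_)
        · obtain ⟨_, m'', hm'', hb⟩ := hs.sort_arg NB hb
          obtain ⟨_, n', hn', ha⟩ := hu.term_arg NA ha
          exact ih (n' + m'') (by omega) ha hb rfl
        · obtain ⟨_, n', hn', ha⟩ := hu.term_arg NA ha
          exact ih (n' + m) (by omega) ha hv rfl

theorem CT.of_der (NA : Nice TA) (NB : Nice TB) {X : PreCtx A} {Y : PreCtx B}
    {u : Expr A} {v : Expr B} (hu : DerTerm TA X u) (hv : DerTerm TB Y v) :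
    CT TA TB X Y u v (ct TA TB X Y u v) := by
  obtain ⟨U, n, hu⟩ := hu
  obtain ⟨V, m, hv⟩ := hv
  exact CT.exists_of_der NA NB hu hv

theorem DerTerm.ctx {X : PreCtx A} {u : Expr A} (hu : DerTerm TA X u) :
    Derivable TA (.ctx X) := let ⟨_, h⟩ := hu; Derivable.ctx h

theorem ct_mono (NA : Nice TA) (NB : Nice TB) {X X' : PreCtx A} {Y Y' : PreCtx B}
    (hX' : Derivable TA (.ctx X')) (hY' : Derivable TB (.ctx Y'))
    (hX : X ⊆ X') (hY : Y ⊆ Y') {u : Expr A} {v : Expr B}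
    (hu : DerTerm TA X u) (hv : DerTerm TB Y v) :
    ct TA TB X Y u v = ct TA TB X' Y' u v :=
  ((CT.of_der NA NB hu hv).mono hX hY).eq_ct NA NB hX'.nodup hY'.nodup

theorem ct_vv (NA : Nice TA) (NB : Nice TB) {X : PreCtx A} {Y : PreCtx B} {x : A.Var} {y : B.Var}
    (hx : x ∈ X.map Prod.fst) (hy : y ∈ Y.map Prod.fst) :
    ct TA TB X Y (.var x) (.var y) = .var (x, y) :=
  (CT.vv (TA := TA) (TB := TB) hx hy).ct_spec.vv_inv.1

theorem ct_va (NA : Nice TA) (NB : Nice TB) {X : PreCtx A} {Y : PreCtx B} {u : Expr A}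
    {S : A.SortSym} {ss : List (Expr A)} {t : B.TermSym} {ts : List (Expr B)}
    (hu : DerTerm TA X u) (hv : DerTerm TB Y (.app t ts)) (hC : CanonSort TA X u ⟨S, ss⟩) :
    ct TA TB X Y u (.app t ts) =
      .app (Sum.inl (S, t)) (prodMap (ct TA TB X Y) ss ts ++ ts.map (ct TA TB X Y u)) := by
  have hs := (hu.canon NA hC).sort_of_term
  exact ((CT.va (ct TA TB X Y) hC
    (fun a ha b hb => CT.of_der NA NB (hs.sort_arg NA ha) (hv.arg NB hb))
    fun b hb => CT.of_der NA NB hu (hv.arg NB hb)).eq_ct NA NB hu.ctx.nodup hv.ctx.nodup).symm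

theorem ct_av (NA : Nice TA) (NB : Nice TB) {X : PreCtx A} {Y : PreCtx B} {s : A.TermSym}
    {us : List (Expr A)} {y : B.Var} {T : B.SortSym} {ts : List (Expr B)}
    (hu : DerTerm TA X (.app s us)) (hY : Derivable TB (.ctx Y))
    (hC : (y, (⟨T, ts⟩ : SortE B)) ∈ Y) :
    ct TA TB X Y (.app s us) (.var y) =
      .app (Sum.inr (s, T)) (prodMap (ct TA TB X Y) us (ts ++ [.var y])) := by
  have hv : DerTerm TB Y (.var y) := ⟨_, Derivable.var NB hY hC⟩
  have hC : CanonSort TB Y (.var y) ⟨T, ts⟩ := .of_mem hC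
  have hs := (hv.canon NB hC).sort_of_term
  exact ((CT.av (ct TA TB X Y) hC
    (fun a ha b hb => CT.of_der NA NB (hu.arg NA ha) (hs.sort_arg NB hb))
    fun a ha => CT.of_der NA NB (hu.arg NA ha) hv).eq_ct NA NB hu.ctx.nodup hv.ctx.nodup).symm

theorem CT.scoped {X : PreCtx A} {Y : PreCtx B} {u : Expr A} {v : Expr B}
    {e : Expr (A.tensor B)} (h : CT TA TB X Y u v e) {p : (A.tensor B).Var} :
    Occurs p e → p.1 ∈ X.map Prod.fst ∧ p.2 ∈ Y.map Prod.fst := by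
  induction h with
  | vv hx hy => intro ho; rw [occurs_var_iff.1 ho]; exact ⟨hx, hy⟩
  | va M hu hM hMu ih1 ih2 =>
    intro ho
    obtain ⟨e, he, ho⟩ := occurs_app_iff.1 ho
    rcases List.mem_append.1 he with he | he
    · obtain ⟨a, ha, b, hb, rfl⟩ := mem_prodMap.1 he
      exact ih1 a ha b hb ho
    · obtain ⟨b, hb, rfl⟩ := List.mem_map.1 he
      exact ih2 b hb ho
  | av M hy hM hMy ih1 ih2 =>
    intro ho
    obtain ⟨e, he, ho⟩ := occurs_app_iff.1 ho
    obtain ⟨a, ha, b, hb, rfl⟩ := mem_prodMap.1 he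
    rcases List.mem_append.1 hb with hb | hb
    · exact ih1 a ha b hb ho
    · rw [List.mem_singleton.1 hb] at ho
      exact ih2 a ha ho

/-- Canonical tensors commute with substitutions preserving canonical sorts on the nose. -/
theorem CT.subst_strict (NA : Nice TA) (NB : Nice TB) {X X₀ : PreCtx A} {Y Y₀ : PreCtx B}
    (hX : Derivable TA (.ctx X)) (hY : Derivable TB (.ctx Y))
    {f : A.Var → Expr A} {g : B.Var → B.Var} {ρ : (A.tensor B).Var → Expr (A.tensor B)}
    (hf : ∀ p ∈ X₀, CanonSort TA X (f p.1) (p.2.subst f))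
    (hg : ∀ q ∈ Y₀, (g q.1, q.2.subst fun y => .var (g y)) ∈ Y)
    (hρ : ∀ p ∈ X₀, ∀ q ∈ Y₀, CT TA TB X Y (f p.1) (.var (g q.1)) (ρ (p.1, q.1)))
    {u : Expr A} {v : Expr B} {e : Expr (A.tensor B)} (h : CT TA TB X₀ Y₀ u v e) :
    DerTerm TA X₀ u → DerTerm TB Y₀ v →
    CT TA TB X Y (u.subst f) (v.subst fun y => .var (g y)) (e.subst ρ) := by
  induction h with
  | vv hx hy =>
    intro _ _
    obtain ⟨p, hp, rfl⟩ := List.mem_map.1 hx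
    obtain ⟨q, hq, rfl⟩ := List.mem_map.1 hy
    simp only [Expr.subst_var]
    exact hρ p hp q hq
  | @va u S ss t ts M hu hM hMu ih1 ih2 =>
    intro hdu hdv
    have hs := (hdu.canon NA hu).sort_of_term
    have hu' : CanonSort TA X (u.subst f) ⟨S, ss.map (Expr.subst f)⟩ := by
      cases u with
      | var x => rw [Expr.subst_var]; exact hf _ hu.var_mem
      | app s us => rw [Expr.subst_app]; exact CanonSort.subst NA hdu hu f
    have k1 : ∀ a ∈ ss, ∀ b ∈ ts, CT TA TB X Y (a.subst f) (b.subst fun y => .var (g y))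
        ((M a b).subst ρ) :=
      fun a ha b hb => ih1 a ha b hb (hs.sort_arg NA ha) (hdv.arg NB hb)
    have k2 : ∀ b ∈ ts, CT TA TB X Y (u.subst f) (b.subst fun y => .var (g y))
        ((M u b).subst ρ) := fun b hb => ih2 b hb hdu (hdv.arg NB hb)
    simp only [Expr.subst_app, List.map_append, map_prodMap, List.map_map, Function.comp_def]
    rw [prodMap_congr fun a ha b hb => (k1 a ha b hb).eq_ct NA NB hX.nodup hY.nodup,
      List.map_congr_left fun b hb => (k2 b hb).eq_ct NA NB hX.nodup hY.nodup,
      ← prodMap_map (F := ct TA TB X Y) (Expr.subst f)]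
    have e2 : ts.map (fun b => ct TA TB X Y (u.subst f) (b.subst fun y => .var (g y))) =
        (ts.map (Expr.subst fun y => .var (g y))).map (ct TA TB X Y (u.subst f)) := by
      simp [List.map_map, Function.comp_def]
    rw [e2]
    refine .va _ hu' ?_ ?_
    · intro a' ha' b' hb'
      obtain ⟨a, ha, rfl⟩ := List.mem_map.1 ha'
      obtain ⟨b, hb, rfl⟩ := List.mem_map.1 hb'
      exact (k1 a ha b hb).ct_spec
    · intro b' hb'
      obtain ⟨b, hb, rfl⟩ := List.mem_map.1 hb'
      exact (k2 b hb).ct_spec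
  | @av s us y T ts M hy hM hMy ih1 ih2 =>
    intro hdu hdv
    have hs := (hdv.canon NB hy).sort_of_term
    have hy' : CanonSort TB Y (.var (g y)) ⟨T, ts.map (Expr.subst fun y => .var (g y))⟩ :=
      .of_mem (hg _ hy.var_mem)
    have k1 : ∀ a ∈ us, ∀ b ∈ ts, CT TA TB X Y (a.subst f) (b.subst fun y => .var (g y))
        ((M a b).subst ρ) :=
      fun a ha b hb => ih1 a ha b hb (hdu.arg NA ha) (hs.sort_arg NB hb)
    have k2 : ∀ a ∈ us, CT TA TB X Y (a.subst f) (.var (g y))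
        ((M a (.var y)).subst ρ) := fun a ha => by
      simpa only [Expr.subst_var] using ih2 a ha (hdu.arg NA ha) hdv
    simp only [Expr.subst_app, map_prodMap, Expr.subst_var]
    have k3 : ∀ a ∈ us, ∀ b ∈ ts ++ [.var y], (M a b).subst ρ =
        ct TA TB X Y (a.subst f) (b.subst fun y => .var (g y)) := by
      intro a ha b hb
      rcases List.mem_append.1 hb with hb | hb
      · exact (k1 a ha b hb).eq_ct NA NB hX.nodup hY.nodup
      · rw [List.mem_singleton.1 hb, Expr.subst_var]
        exact (k2 a ha).eq_ct NA NB hX.nodup hY.nodup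
    rw [prodMap_congr k3, ← prodMap_map (F := ct TA TB X Y) (Expr.subst f), List.map_append,
      List.map_singleton, Expr.subst_var]
    refine .av _ hy' ?_ ?_
    · intro a' ha' b' hb'
      obtain ⟨a, ha, rfl⟩ := List.mem_map.1 ha'
      obtain ⟨b, hb, rfl⟩ := List.mem_map.1 hb'
      exact (k1 a ha b hb).ct_spec
    · intro a' ha'
      obtain ⟨a, ha, rfl⟩ := List.mem_map.1 ha'
      exact (k2 a ha).ct_spec

end

section

variable {A B : Alphabet}

theorem lookupV_of_not_mem {ps : List (A.Var × Expr A)} {v : A.Var}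
    (h : v ∉ ps.map Prod.fst) : lookupV ps v = .var v := by
  induction ps with
  | nil => rfl
  | cons p ps ih =>
    simp only [List.map_cons, List.mem_cons, not_or] at h
    rw [lookupV, if_neg (Ne.symm h.1), ih h.2]

theorem lookupV_of_mem {ps : List (A.Var × Expr A)} (hnd : (ps.map Prod.fst).Nodup)
    {p : A.Var × Expr A} (hp : p ∈ ps) : lookupV ps p.1 = p.2 := by
  induction ps with
  | nil => simp at hp
  | cons q ps ih =>
    rw [List.map_cons, List.nodup_cons] at hnd
    rw [lookupV]
    rcases List.mem_cons.1 hp with rfl | hp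
    · simp
    · rw [if_neg, ih hnd.2 hp]
      intro he
      exact hnd.1 (he ▸ List.mem_map_of_mem hp)

section pairs
variable {X : PreCtx A} {Y : PreCtx B} {g : ℕ → Expr (A.tensor B)}

theorem nodup_getElem_inj {γ : Type} {l : List γ} (h : l.Nodup) {i j : ℕ} (hi : i < l.length)
    (hj : j < l.length) (he : l[i] = l[j]) : i = j := (List.Nodup.getElem_inj_iff h).1 he

theorem pairsR_nodup (hY : (Y.map Prod.fst).Nodup) (x : A.Var) :
    ((pairsR x Y g).map Prod.fst).Nodup := by
  rw [pairsR, List.map_map]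
  refine List.Nodup.map (fun i j he => ?_) (List.nodup_finRange _)
  have := congrArg Prod.snd he
  simp only [Function.comp_apply, List.get_eq_getElem] at this
  refine Fin.ext (nodup_getElem_inj hY (by simp) (by simp) ?_)
  simpa using this

theorem pairsL_nodup (hX : (X.map Prod.fst).Nodup) (y : B.Var) :
    ((pairsL X y g).map Prod.fst).Nodup := by
  rw [pairsL, List.map_map]
  refine List.Nodup.map (fun i j he => ?_) (List.nodup_finRange _)
  have := congrArg Prod.fst he
  simp only [Function.comp_apply, List.get_eq_getElem] at this
  refine Fin.ext (nodup_getElem_inj hX (by simp) (by simp) ?_)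
  simpa using this

theorem lookupV_pairsR (hY : (Y.map Prod.fst).Nodup) (x : A.Var) (j : ℕ) (hj : j < Y.length) :
    lookupV (pairsR x Y g) (x, (Y[j]).1) = g j :=
  lookupV_of_mem (pairsR_nodup hY x) (p := ((x, (Y[j]).1), g j))
    (List.mem_map.2 ⟨⟨j, hj⟩, List.mem_finRange _, rfl⟩)

theorem lookupV_pairsL (hX : (X.map Prod.fst).Nodup) (y : B.Var) (i : ℕ) (hi : i < X.length) :
    lookupV (pairsL X y g) ((X[i]).1, y) = g i :=
  lookupV_of_mem (pairsL_nodup hX y) (p := (((X[i]).1, y), g i))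
    (List.mem_map.2 ⟨⟨i, hi⟩, List.mem_finRange _, rfl⟩)

theorem mem_pairsR_fst {x : A.Var} {z : A.Var × B.Var} :
    z ∈ (pairsR x Y g).map Prod.fst ↔ z.1 = x ∧ z.2 ∈ Y.map Prod.fst := by
  simp only [pairsR, List.map_map, List.mem_map, List.mem_finRange, true_and,
    Function.comp_apply]
  constructor
  · rintro ⟨i, rfl⟩
    exact ⟨rfl, _, List.get_mem _ _, rfl⟩
  · rintro ⟨rfl, q, hq, h2⟩
    obtain ⟨i, rfl⟩ := List.get_of_mem hq
    exact ⟨i, Prod.ext rfl h2⟩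

theorem mem_pairsL_fst {y : B.Var} {z : A.Var × B.Var} :
    z ∈ (pairsL X y g).map Prod.fst ↔ z.1 ∈ X.map Prod.fst ∧ z.2 = y := by
  simp only [pairsL, List.map_map, List.mem_map, List.mem_finRange, true_and,
    Function.comp_apply]
  constructor
  · rintro ⟨i, rfl⟩
    exact ⟨⟨_, List.get_mem _ _, rfl⟩, rfl⟩
  · rintro ⟨⟨q, hq, h2⟩, rfl⟩
    obtain ⟨i, rfl⟩ := List.get_of_mem hq
    exact ⟨i, Prod.ext h2 rfl⟩

end pairs

variable {TA : Set (Judg A)} {TB : Set (Judg B)}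

/-- The arguments allowed in tensors of terms. -/
def GoodArg (TA : Set (Judg A)) (X : PreCtx A) (u : Expr A) (U : SortE A) : Prop :=
  Derivable TA (.sort X U) ∧
    (Derivable TA (.term X u U) ∨ ∃ x, u = .var x ∧ ∀ p ∈ X, p.1 ≠ x)

theorem Derivable.snoc (NA : Nice TA) {X : PreCtx A} {U : SortE A} {x : A.Var}
    (h : Derivable TA (.sort X U)) (hx : ∀ p ∈ X, p.1 ≠ x) :
    Derivable TA (.ctx (X ++ [(x, U)])) := by
  have hX : IsPreCtx X := (Derivable.ctx h).isPreCtx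
  refine .of_step (.ctx_cons h hx fun i hi v hv => ?_)
  simp only [List.length_append, List.length_cons, List.length_nil] at hi
  rcases lt_or_eq_of_le (Nat.le_of_lt_succ hi) with hi' | rfl
  · rw [List.getElem_append_left hi'] at hv
    rw [List.take_append_of_le_length hi'.le]
    exact hX i hi' v hv
  · simp only [List.getElem_concat_length] at hv
    simpa using h.scoped NA v hv

theorem GoodArg.canon (NA : Nice TA) {X : PreCtx A} {u : Expr A} (hu : DerTerm TA X u)
    {U : SortE A} (hU : CanonSort TA X u U) : GoodArg TA X u U :=
  ⟨(hu.canon NA hU).sort_of_term, .inl (hu.canon NA hU)⟩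

theorem GoodArg.fresh {X : PreCtx A} {x : A.Var} {U : SortE A}
    (h : Derivable TA (.sort X U)) (hx : ∀ p ∈ X, p.1 ≠ x) : GoodArg TA X (.var x) U :=
  ⟨h, .inr ⟨x, rfl, hx⟩⟩

theorem Derivable.take_fresh {X : PreCtx A} (hX : Derivable TA (.ctx X)) {j : ℕ}
    (hj : j < X.length) : ∀ p ∈ X.take j, p.1 ≠ (X[j]).1 := by
  intro p hp he
  obtain ⟨i, hi, rfl⟩ := List.getElem_of_mem hp
  have hi' : i < j := by simp at hi; omega
  rw [List.getElem_take] at he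
  have := nodup_getElem_inj (i := i) (j := j) hX.nodup (by simp; omega) (by simpa using hj)
    (by simpa using he)
  omega

theorem GoodArg.take {X : PreCtx A} (hX : Derivable TA (.ctx X)) {j : ℕ}
    (hj : j < X.length) : GoodArg TA (X.take j) (.var (X[j]).1) (X[j]).2 :=
  .fresh (hX.sort_of_ctx j hj) (hX.take_fresh hj)

theorem GoodArg.sort_args (NA : Nice TA) {X : PreCtx A} {u : Expr A} {U : SortE A}
    (h : GoodArg TA X u U) {a : Expr A} (ha : a ∈ U.args) : DerTerm TA X a :=
  h.1.sort_arg NA ha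

theorem GoodArg.app (NA : Nice TA) {X : PreCtx A} {s : A.TermSym} {ss : List (Expr A)}
    {U : SortE A} (h : GoodArg TA X (.app s ss) U) : Derivable TA (.term X (.app s ss) U) := by
  rcases h.2 with h | ⟨x, hx, -⟩
  · exact h
  · cases hx

theorem TTg.toCT (NA : Nice TA) (NB : Nice TB) {fl : Bool} {a : TArg A} {b : TArg B}
    {e : Expr (A.tensor B)} (h : TTg TA TB fl a b e) : fl = false →
    GoodArg TA a.ctx a.tm a.srt → GoodArg TB b.ctx b.tm b.srt →
    ∀ (X : PreCtx A) (Y : PreCtx B), Derivable TA (.ctx X) → Derivable TB (.ctx Y) →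
    a.ctx ⊆ X → b.ctx ⊆ Y →
    (∃ U, CanonSort TA X a.tm U) → (∃ V, CanonSort TB Y b.tm V) →
    ((∃ y, b.tm = .var y) ∨ CanonSort TA X a.tm a.srt) →
    ((∃ x, a.tm = .var x) ∨ CanonSort TB Y b.tm b.srt) → CT TA TB X Y a.tm b.tm e := by
  induction h with
  | @varvar _ X U x Y V y =>
    intro _ _ _ X' Y' hX' hY' hX hY hU hV _ _
    obtain ⟨U, hU⟩ := hU
    obtain ⟨V, hV⟩ := hV
    exact .vv (List.mem_map_of_mem hU.var_mem) (List.mem_map_of_mem hV.var_mem)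
  | @varapp _ X₀ x S ss Y₀ t ts V SS TSf hSS hTS M out hM hMx hout ih1 ih2 =>
    intro hfl ga gb X Y hX hY hXs hYs hU hV hcU hcV
    rcases hcU with ⟨y, hy⟩ | hcU
    · cases hy
    dsimp only at *
    have k1 : ∀ i (hi : i < ss.length), ∀ j (hj : j < ts.length),
        CT TA TB X Y ss[i] ts[j] (M i j) := fun i hi j hj =>
      ih1 i hi j hj hfl (.canon NA (ga.sort_args NA (List.getElem_mem hi)) (hSS i hi))
        (.canon NB (DerTerm.arg NB ⟨_, gb.app NB⟩ (List.getElem_mem hj)) (hTS j hj))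
        X Y hX hY hXs hYs ⟨_, (hSS i hi).mono hXs⟩ ⟨_, (hTS j hj).mono hYs⟩
        (.inr ((hSS i hi).mono hXs)) (.inr ((hTS j hj).mono hYs))
    have k2 : ∀ j (hj : j < ts.length),
        CT TA TB X Y (.var x) ts[j] (M ss.length j) := fun j hj =>
      ih2 j hj hfl ga
        (.canon NB (DerTerm.arg NB ⟨_, gb.app NB⟩ (List.getElem_mem hj)) (hTS j hj))
        X Y hX hY hXs hYs ⟨_, hcU⟩ ⟨_, (hTS j hj).mono hYs⟩ (.inr hcU) (.inl ⟨_, rfl⟩)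
    have hgrid : out = prodMap (ct TA TB X Y) (ss ++ [.var x]) ts := by
      refine IsGrid.eq_prodMap hout (by simp) (by simp) fun i j hi hj => ?_
      rcases lt_or_eq_of_le (Nat.le_of_lt_succ (by simpa using hi)) with hi' | rfl
      · rw [List.getElem_append_left hi']
        exact (k1 i hi' j hj).eq_ct NA NB hX.nodup hY.nodup
      · simp only [List.getElem_concat_length]
        exact (k2 j hj).eq_ct NA NB hX.nodup hY.nodup
    rw [hgrid, prodMap_append, prodMap_singleton]
    refine .va _ hcU (fun a ha b hb => ?_) fun b hb => ?_
    · obtain ⟨i, hi, rfl⟩ := List.getElem_of_mem ha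
      obtain ⟨j, hj, rfl⟩ := List.getElem_of_mem hb
      exact (k1 i hi j hj).ct_spec
    · obtain ⟨j, hj, rfl⟩ := List.getElem_of_mem hb
      exact (k2 j hj).ct_spec
  | @appvar _ X₀ s us U Y₀ y T ts SS TSf hSS hTS M out hM hMy hout ih1 ih2 =>
    intro hfl ga gb X Y hX hY hXs hYs hU hV hcU hcV
    rcases hcV with ⟨y, hy⟩ | hcV
    · cases hy
    dsimp only at *
    have k1 : ∀ i (hi : i < us.length), ∀ j (hj : j < ts.length),
        CT TA TB X Y us[i] ts[j] (M i j) := fun i hi j hj =>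
      ih1 i hi j hj hfl
        (.canon NA (DerTerm.arg NA ⟨_, ga.app NA⟩ (List.getElem_mem hi)) (hSS i hi))
        (.canon NB (gb.sort_args NB (List.getElem_mem hj)) (hTS j hj))
        X Y hX hY hXs hYs ⟨_, (hSS i hi).mono hXs⟩ ⟨_, (hTS j hj).mono hYs⟩
        (.inr ((hSS i hi).mono hXs)) (.inr ((hTS j hj).mono hYs))
    have k2 : ∀ i (hi : i < us.length),
        CT TA TB X Y us[i] (.var y) (M i ts.length) := fun i hi =>
      ih2 i hi hfl
        (.canon NA (DerTerm.arg NA ⟨_, ga.app NA⟩ (List.getElem_mem hi)) (hSS i hi)) gb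
        X Y hX hY hXs hYs ⟨_, (hSS i hi).mono hXs⟩ ⟨_, hcV⟩ (.inl ⟨_, rfl⟩) (.inr hcV)
    have hgrid : out = prodMap (ct TA TB X Y) us (ts ++ [.var y]) := by
      refine IsGrid.eq_prodMap hout (by simp) (by simp) fun i j hi hj => ?_
      rcases lt_or_eq_of_le (Nat.le_of_lt_succ (by simpa using hj)) with hj' | rfl
      · rw [List.getElem_append_left hj']
        exact (k1 i hi j hj').eq_ct NA NB hX.nodup hY.nodup
      · simp only [List.getElem_concat_length]
        exact (k2 i hi).eq_ct NA NB hX.nodup hY.nodup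
    rw [hgrid]
    refine .av _ hcV (fun a ha b hb => ?_) fun a ha => ?_
    · obtain ⟨i, hi, rfl⟩ := List.getElem_of_mem ha
      obtain ⟨j, hj, rfl⟩ := List.getElem_of_mem hb
      exact (k1 i hi j hj).ct_spec
    · obtain ⟨i, hi, rfl⟩ := List.getElem_of_mem ha
      exact (k2 i hi).ct_spec
  | @appapp_base X₀ s ss U Y₀ t ts V x hx e0 h0 g hg ih1 ih2 =>
    intro hfl ga gb X Y hX hY hXs hYs hU hV hcU hcV
    rcases hcU with ⟨y, hy⟩ | hcU
    · cases hy
    dsimp only at *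
    have hX1 := ga.1.snoc NA hx
    have hY0 : Derivable TB (.ctx Y₀) := Derivable.ctx gb.1
    have hX0 : Derivable TA (.ctx X₀) := Derivable.ctx ga.1
    have hxU : CanonSort TA (X₀ ++ [(x, U)]) (.var x) U :=
      .of_mem (p := (x, U)) (by simp)
    have c0 : CT TA TB (X₀ ++ [(x, U)]) Y₀ (.var x) (.app t ts) e0 :=
      ih1 hfl (.fresh ga.1 hx) gb _ _ hX1 hY0 (List.subset_append_left _ _)
        (List.Subset.refl _) ⟨_, hxU⟩ (DerTerm.exists_canon NB ⟨_, gb.app NB⟩) (.inr hxU)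
        (.inl ⟨_, rfl⟩)
    have cg : ∀ j (hj : j < Y₀.length),
        CT TA TB X Y (.app s ss) (.var (Y₀[j]).1) (g j) := fun j hj => by
      have hc : CanonSort TB Y (.var (Y₀[j]).1) (Y₀[j]).2 := .of_mem (hYs (List.getElem_mem hj))
      exact ih2 j hj hfl ga (.take hY0 hj) X Y hX hY hXs
        (List.Subset.trans (List.take_subset _ _) hYs) hU ⟨_, hc⟩ (.inl ⟨_, rfl⟩) (.inr hc)
    classical
    let f : A.Var → Expr A := fun z => if z = x then .app s ss else .var z
    have hfX : ∀ p ∈ X₀, f p.1 = .var p.1 := fun p hp => if_neg (hx p hp)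
    have hfs : ∀ W : SortE A, ScopedS X₀ W → W.subst f = W := fun W hW => by
      refine W.subst_eq_self fun z hz => ?_
      obtain ⟨p, hp, rfl⟩ := List.mem_map.1 (hW z hz)
      exact hfX p hp
    have key := CT.subst_strict NA NB hX hY (f := f) (g := id)
      (ρ := lookupV (pairsR x Y₀ g)) ?_ ?_ ?_ c0 ?_ ⟨_, gb.app NB⟩
    · rw [Expr.subst_var, show (fun y : B.Var => (Expr.var (id y) : Expr B)) = .var from rfl,
        Expr.subst_id, show f x = .app s ss from if_pos rfl] at key
      exact key
    · intro p hp
      rcases List.mem_append.1 hp with hp | hp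
      · rw [hfX p hp, hfs _ (hX0.isPreCtx.scoped hp)]
        exact .of_mem (hXs hp)
      · rw [List.mem_singleton.1 hp]
        rw [hfs _ (ga.1.scoped NA), show f x = .app s ss from if_pos rfl]
        exact hcU
    · intro q hq
      simpa [SortE.subst_id] using hYs hq
    · intro p hp q hq
      obtain ⟨j, hj, rfl⟩ := List.getElem_of_mem hq
      rcases List.mem_append.1 hp with hp | hp
      · rw [hfX p hp, lookupV_of_not_mem fun hm => hx p hp (mem_pairsR_fst.1 hm).1]
        exact .vv (List.mem_map_of_mem (hXs hp)) (List.mem_map_of_mem (hYs hq))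
      · rw [List.mem_singleton.1 hp, lookupV_pairsR hY0.nodup x j hj,
          show f x = .app s ss from if_pos rfl]
        exact cg j hj
    · exact ⟨_, Derivable.var NA hX1 (p := (x, U)) (by simp)⟩
  | appapp_star => intro hfl; cases hfl

end

section

variable {A B : Alphabet}
variable {TA : Set (Judg A)} {TB : Set (Judg B)}

theorem exists_grid {γ : Type} (m n : ℕ) (M : ℕ → ℕ → γ) : ∃ L, IsGrid m n M L := by
  have h := isGrid_prodMap (F := M) (as := List.range m) (bs := List.range n) (M := M)
    fun i j hi hj => by simp
  rw [List.length_range, List.length_range] at h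
  exact ⟨_, h⟩

theorem exists_fun_of_lt {γ : Type} [Inhabited γ] {n : ℕ} {P : ∀ i, i < n → γ → Prop}
    (h : ∀ i (hi : i < n), ∃ c, P i hi c) : ∃ f : ℕ → γ, ∀ i (hi : i < n), P i hi (f i) := by
  choose f hf using h
  exact ⟨fun i => if hi : i < n then f i hi else default, fun i hi => by
    simp only [dif_pos hi]; exact hf i hi⟩

theorem exists_fun₂_of_lt {γ : Type} [Inhabited γ] {m n : ℕ}
    {P : ∀ i, i < m → ∀ j, j < n → γ → Prop}
    (h : ∀ i (hi : i < m) j (hj : j < n), ∃ c, P i hi j hj c) :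
    ∃ f : ℕ → ℕ → γ, ∀ i (hi : i < m) j (hj : j < n), P i hi j hj (f i j) :=
  exists_fun_of_lt (P := fun i hi (f : ℕ → γ) => ∀ j (hj : j < n), P i hi j hj (f j))
    fun i hi => exists_fun_of_lt (h i hi)

theorem exists_fresh (X : PreCtx A) : ∃ x : A.Var, ∀ p ∈ X, p.1 ≠ x := by
  classical
  obtain ⟨x, hx⟩ := Infinite.exists_notMem_finset (X.map Prod.fst).toFinset
  exact ⟨x, fun p hp he => hx (by simpa using ⟨p.2, he ▸ hp⟩)⟩

/-- A quantitative version of `GoodArg`. -/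
def GoodAt (TA : Set (Judg A)) (n : ℕ) (X : PreCtx A) (u : Expr A) (U : SortE A) : Prop :=
  DerAt TA n (.sort X U) ∧
    (DerAt TA (n + 1) (.term X u U) ∨ ∃ x, u = .var x ∧ ∀ p ∈ X, p.1 ≠ x)

theorem DerAt.goodAt (NA : Nice TA) {n : ℕ} {X : PreCtx A} {u : Expr A} {U C : SortE A}
    (h : DerAt TA n (.term X u U)) (hC : CanonSort TA X u C) :
    ∃ k, k < n ∧ GoodAt TA k X u C := by
  have h1 := (h.canon NA hC).1
  obtain ⟨m, hm, h2⟩ := h1.sort_of_term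
  refine ⟨n - 1, by omega, h2.mono (by omega), .inl (h1.mono (by omega))⟩

theorem GoodAt.sort_arg (NA : Nice TA) {n : ℕ} {X : PreCtx A} {u : Expr A} {U : SortE A}
    (h : GoodAt TA n X u U) {a : Expr A} (ha : a ∈ U.args) {C : SortE A}
    (hC : CanonSort TA X a C) : ∃ k, k < n ∧ GoodAt TA k X a C := by
  obtain ⟨W, m, hm, h1⟩ := h.1.sort_arg NA ha
  obtain ⟨k, hk, h2⟩ := h1.goodAt NA hC
  exact ⟨k, by omega, h2⟩

theorem GoodAt.app (NA : Nice TA) {n : ℕ} {X : PreCtx A} {s : A.TermSym} {ss : List (Expr A)}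
    {U : SortE A} (h : GoodAt TA n X (.app s ss) U) :
    DerAt TA (n + 1) (.term X (.app s ss) U) := by
  rcases h.2 with h | ⟨x, hx, -⟩
  · exact h
  · cases hx

theorem GoodAt.term_arg (NA : Nice TA) {n : ℕ} {X : PreCtx A} {s : A.TermSym}
    {ss : List (Expr A)} {U : SortE A}
    (h : GoodAt TA n X (.app s ss) U) {a : Expr A} (ha : a ∈ ss) {C : SortE A}
    (hC : CanonSort TA X a C) : ∃ k, k < n ∧ GoodAt TA k X a C := by
  obtain ⟨W, m, hm, h1⟩ := (h.app NA).term_arg NA ha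
  obtain ⟨k, hk, h2⟩ := h1.goodAt NA hC
  exact ⟨k, by omega, h2⟩

theorem GoodAt.good {n : ℕ} {X : PreCtx A} {u : Expr A} {U : SortE A}
    (h : GoodAt TA n X u U) : GoodArg TA X u U :=
  ⟨h.1.derivable, h.2.imp DerAt.derivable id⟩

theorem TTg.exists_args {X : PreCtx A} {Y : PreCtx B} {ss : List (Expr A)} {ts : List (Expr B)}
    (NA : Nice TA) (NB : Nice TB)
    (hss : ∀ a ∈ ss, DerTerm TA X a) (hts : ∀ b ∈ ts, DerTerm TB Y b)
    (U : SortE A) (V : SortE B)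
    (h : ∀ a ∈ ss, ∀ C, CanonSort TA X a C → ∀ b ∈ ts, ∀ D, CanonSort TB Y b D →
      ∃ e, TTg TA TB false ⟨X, a, C⟩ ⟨Y, b, D⟩ e) :
    ∃ (SS : ℕ → SortE A) (TS : ℕ → SortE B) (M : ℕ → ℕ → Expr (A.tensor B)),
      (∀ i (hi : i < ss.length), CanonSort TA X (ss[i]'hi) (SS i)) ∧
      (∀ j (hj : j < ts.length), CanonSort TB Y (ts[j]'hj) (TS j)) ∧
      (∀ i (hi : i < ss.length), ∀ j (hj : j < ts.length),
          TTg TA TB false ⟨X, ss[i]'hi, SS i⟩ ⟨Y, ts[j]'hj, TS j⟩ (M i j)) := by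
  have iU : Inhabited (SortE A) := ⟨U⟩
  have iV : Inhabited (SortE B) := ⟨V⟩
  obtain ⟨SS, hSS⟩ := exists_fun_of_lt (P := fun i (hi : i < ss.length) C =>
    CanonSort TA X (ss[i]'hi) C) fun i hi => (hss _ (List.getElem_mem hi)).exists_canon NA
  obtain ⟨TS, hTS⟩ := exists_fun_of_lt (P := fun i (hi : i < ts.length) C =>
    CanonSort TB Y (ts[i]'hi) C) fun i hi => (hts _ (List.getElem_mem hi)).exists_canon NB
  obtain ⟨M, hM⟩ := exists_fun₂_of_lt (P := fun i (hi : i < ss.length) j (hj : j < ts.length) e =>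
    TTg TA TB false ⟨X, ss[i]'hi, SS i⟩ ⟨Y, ts[j]'hj, TS j⟩ e) fun i hi j hj =>
    h _ (List.getElem_mem hi) _ (hSS i hi) _ (List.getElem_mem hj) _ (hTS j hj)
  exact ⟨SS, TS, M, hSS, hTS, hM⟩

theorem GoodAt.exists_ttg (NA : Nice TA) (NB : Nice TB) {n m : ℕ} {X : PreCtx A} {u : Expr A}
    {U : SortE A} {Y : PreCtx B} {v : Expr B} {V : SortE B}
    (hu : GoodAt TA n X u U) (hv : GoodAt TB m Y v V) :
    ∃ e, TTg TA TB false ⟨X, u, U⟩ ⟨Y, v, V⟩ e := by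
  generalize hN : n + m = N
  induction N using Nat.strong_induction_on generalizing n m X u U Y v V with
  | _ N ih =>
    subst hN
    have varapp : ∀ x t ts, v = .app t ts → GoodAt TA n X (.var x) U →
        ∃ e, TTg TA TB false ⟨X, .var x, U⟩ ⟨Y, v, V⟩ e := by
      rintro x t ts rfl hx
      obtain ⟨S, ss⟩ := U
      obtain ⟨SS, TS, M, hSS, hTS, hM⟩ := TTg.exists_args NA NB
        (fun a ha => hx.good.sort_args NA ha)
        (fun b hb => DerTerm.arg NB ⟨_, hv.good.app NB⟩ hb) ⟨S, ss⟩ V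
        fun a ha C hC b hb D hD => by
          obtain ⟨k, hk, h1⟩ := hx.sort_arg NA ha hC
          obtain ⟨l, hl, h2⟩ := hv.term_arg NB hb hD
          exact ih (k + l) (by omega) h1 h2 rfl
      obtain ⟨R, hR⟩ := exists_fun_of_lt (P := fun j (hj : j < ts.length) e =>
        TTg TA TB false ⟨X, .var x, ⟨S, ss⟩⟩ ⟨Y, ts[j]'hj, TS j⟩ e) fun j hj => by
          obtain ⟨l, hl, h2⟩ := hv.term_arg NB (List.getElem_mem hj) (hTS j hj)
          exact ih (n + l) (by omega) hx h2 rfl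
      obtain ⟨out, hout⟩ := exists_grid (ss.length + 1) ts.length
        fun i j => if i < ss.length then M i j else R j
      exact ⟨_, .varapp SS TS hSS hTS (fun i j => if i < ss.length then M i j else R j) out
        (fun i hi j hj => by simpa [hi] using hM i hi j hj)
        (fun j hj => by simpa using hR j hj) hout⟩
    cases u with
    | var x =>
      cases v with
      | var y => exact ⟨_, .varvar⟩
      | app t ts => exact varapp x t ts rfl hu
    | app s us =>
      cases v with
      | var y =>
        obtain ⟨T, ts⟩ := V
        obtain ⟨SS, TS, M, hSS, hTS, hM⟩ := TTg.exists_args NA NB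
          (fun a ha => DerTerm.arg NA ⟨_, hu.good.app NA⟩ ha)
          (fun b hb => hv.good.sort_args NB hb) U ⟨T, ts⟩
          fun a ha C hC b hb D hD => by
            obtain ⟨k, hk, h1⟩ := hu.term_arg NA ha hC
            obtain ⟨l, hl, h2⟩ := hv.sort_arg NB hb hD
            exact ih (k + l) (by omega) h1 h2 rfl
        obtain ⟨R, hR⟩ := exists_fun_of_lt (P := fun i (hi : i < us.length) e =>
          TTg TA TB false ⟨X, us[i]'hi, SS i⟩ ⟨Y, .var y, ⟨T, ts⟩⟩ e) fun i hi => by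
            obtain ⟨k, hk, h1⟩ := hu.term_arg NA (List.getElem_mem hi) (hSS i hi)
            exact ih (k + m) (by omega) h1 hv rfl
        obtain ⟨out, hout⟩ := exists_grid us.length (ts.length + 1)
          fun i j => if j < ts.length then M i j else R i
        exact ⟨_, .appvar SS TS hSS hTS (fun i j => if j < ts.length then M i j else R i) out
          (fun i hi j hj => by simpa [hj] using hM i hi j hj)
          (fun i hi => by simpa using hR i hi) hout⟩
      | app t ts =>
        obtain ⟨x, hx⟩ := exists_fresh X
        obtain ⟨e0, h0⟩ := varapp x t ts rfl ⟨hu.1, .inr ⟨x, rfl, hx⟩⟩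
        have hY : Derivable TB (.ctx Y) := Derivable.ctx hv.1.derivable
        obtain ⟨m', hm', hYm⟩ := hv.1.ctxAt_of_sort
        obtain ⟨g, hg⟩ := exists_fun_of_lt (P := fun j (hj : j < Y.length) e =>
          TTg TA TB false ⟨X, .app s us, U⟩
            ⟨Y.take j, .var (Y[j]'hj).1, (Y[j]'hj).2⟩ e) fun j hj =>
          ih (n + m') (by omega) hu ⟨hYm j hj, .inr ⟨_, rfl, hY.take_fresh hj⟩⟩ rfl
        exact ⟨_, .appapp_base hx e0 h0 g hg⟩

theorem GoodArg.exists_goodAt {X : PreCtx A} {u : Expr A} {U : SortE A}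
    (h : GoodArg TA X u U) : ∃ n, GoodAt TA n X u U := by
  obtain ⟨⟨n, h1⟩, h2⟩ := h
  rcases h2 with ⟨m, h2⟩ | h2
  · exact ⟨max n m, h1.mono (le_max_left _ _), .inl (h2.mono (by omega))⟩
  · exact ⟨n, h1, .inr h2⟩

theorem GoodArg.exists_ttg (NA : Nice TA) (NB : Nice TB) {X : PreCtx A} {u : Expr A}
    {U : SortE A} {Y : PreCtx B} {v : Expr B} {V : SortE B}
    (hu : GoodArg TA X u U) (hv : GoodArg TB Y v V) :
    ∃ e, TTg TA TB false ⟨X, u, U⟩ ⟨Y, v, V⟩ e := by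
  obtain ⟨n, hu⟩ := hu.exists_goodAt
  obtain ⟨m, hv⟩ := hv.exists_goodAt
  exact hu.exists_ttg NA NB hv

theorem ttg_iff (NA : Nice TA) (NB : Nice TB) {X X' : PreCtx A} {u : Expr A}
    {U : SortE A} {Y Y' : PreCtx B} {v : Expr B} {V : SortE B} {e : Expr (A.tensor B)}
    (gu : GoodArg TA X u U) (gv : GoodArg TB Y v V)
    (hX : Derivable TA (.ctx X')) (hY : Derivable TB (.ctx Y')) (sX : X ⊆ X') (sY : Y ⊆ Y')
    (eu : ∃ C, CanonSort TA X' u C) (ev : ∃ C, CanonSort TB Y' v C)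
    (cu : (∃ y, v = .var y) ∨ CanonSort TA X' u U)
    (cv : (∃ x, u = .var x) ∨ CanonSort TB Y' v V) :
    TTg TA TB false ⟨X, u, U⟩ ⟨Y, v, V⟩ e ↔ e = ct TA TB X' Y' u v := by
  have h1 : ∀ e, TTg TA TB false ⟨X, u, U⟩ ⟨Y, v, V⟩ e → e = ct TA TB X' Y' u v := fun e h =>
    (h.toCT NA NB rfl gu gv X' Y' hX hY sX sY eu ev cu cv).eq_ct NA NB hX.nodup hY.nodup
  refine ⟨h1 e, ?_⟩
  rintro rfl
  obtain ⟨e, he⟩ := gu.exists_ttg NA NB gv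
  rwa [← h1 e he]

end

section

variable {A B : Alphabet}
variable {TA : Set (Judg A)} {TB : Set (Judg B)}

/-- The tensor of two sorts, computed in contexts containing the variables `x` and `y`. -/
noncomputable def tso (TA : Set (Judg A)) (TB : Set (Judg B)) (X : PreCtx A) (Y : PreCtx B)
    (p : A.Var × SortE A) (q : B.Var × SortE B) : SortE (A.tensor B) :=
  ⟨(p.2.head, q.2.head), prodMap (ct TA TB X Y) p.2.args (q.2.args ++ [.var q.1]) ++
    q.2.args.map (ct TA TB X Y (.var p.1))⟩

/-- The tensor of two contexts. -/
noncomputable def tctx (TA : Set (Judg A)) (TB : Set (Judg B)) (X : PreCtx A) (Y : PreCtx B) :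
    PreCtx (A.tensor B) :=
  prodMap (fun p q => ((p.1, q.1), tso TA TB X Y p q)) X Y

theorem tso_iff (NA : Nice TA) (NB : Nice TB) {X X' : PreCtx A} {x : A.Var}
    {U : SortE A} {Y Y' : PreCtx B} {y : B.Var} {V : SortE B} {W : SortE (A.tensor B)}
    (gu : Derivable TA (.sort X U)) (gv : Derivable TB (.sort Y V))
    (hx : ∀ p ∈ X, p.1 ≠ x) (hy : ∀ p ∈ Y, p.1 ≠ y)
    (hX : Derivable TA (.ctx X')) (hY : Derivable TB (.ctx Y')) (sX : X ⊆ X') (sY : Y ⊆ Y')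
    (cx : (x, U) ∈ X') (cy : (y, V) ∈ Y') :
    TSo TA TB false X x U Y y V W ↔ W = tso TA TB X' Y' (x, U) (y, V) := by
  obtain ⟨S, ss⟩ := U
  obtain ⟨T, ts⟩ := V
  have cx' : CanonSort TA X' (.var x) ⟨S, ss⟩ := .of_mem cx
  have cy' : CanonSort TB Y' (.var y) ⟨T, ts⟩ := .of_mem cy
  have ds : ∀ {a}, a ∈ ss → DerTerm TA X a := fun ha => gu.sort_arg NA ha
  have dt : ∀ {b}, b ∈ ts → DerTerm TB Y b := fun hb => gv.sort_arg NB hb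
  have kst : ∀ {a C b D e}, a ∈ ss → CanonSort TA X a C → b ∈ ts → CanonSort TB Y b D →
      (TTg TA TB false ⟨X, a, C⟩ ⟨Y, b, D⟩ e ↔ e = ct TA TB X' Y' a b) :=
    fun ha hC hb hD => ttg_iff NA NB (.canon NA (ds ha) hC) (.canon NB (dt hb) hD) hX hY sX sY
      ⟨_, hC.mono sX⟩ ⟨_, hD.mono sY⟩ (.inr (hC.mono sX)) (.inr (hD.mono sY))
  have kxt : ∀ {b D e}, b ∈ ts → CanonSort TB Y b D →
      (TTg TA TB false ⟨X, .var x, ⟨S, ss⟩⟩ ⟨Y, b, D⟩ e ↔ e = ct TA TB X' Y' (.var x) b) :=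
    fun hb hD => ttg_iff NA NB (.fresh gu hx) (.canon NB (dt hb) hD) hX hY sX sY
      ⟨_, cx'⟩ ⟨_, hD.mono sY⟩ (.inr cx') (.inl ⟨_, rfl⟩)
  have ksy : ∀ {a C e}, a ∈ ss → CanonSort TA X a C →
      (TTg TA TB false ⟨X, a, C⟩ ⟨Y, .var y, ⟨T, ts⟩⟩ e ↔ e = ct TA TB X' Y' a (.var y)) :=
    fun ha hC => ttg_iff NA NB (.canon NA (ds ha) hC) (.fresh gv hy) hX hY sX sY
      ⟨_, hC.mono sX⟩ ⟨_, cy'⟩ (.inl ⟨_, rfl⟩) (.inr cy')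
  constructor
  · intro h
    cases h with
    | mk hx hy SS TSf hSS hTS M out hM hMx hMy hout =>
      rw [tso, ← IsGrid.dropLast_eq hout (a := .var x) (b := .var y) (F := ct TA TB X' Y')]
      · exact fun i j hi hj => (kst (List.getElem_mem hi) (hSS i hi) (List.getElem_mem hj)
          (hTS j hj)).1 (hM i hi j hj)
      · exact fun j hj => (kxt (List.getElem_mem hj) (hTS j hj)).1 (hMx j hj)
      · exact fun i hi => (ksy (List.getElem_mem hi) (hSS i hi)).1 (hMy i hi)
  · rintro rfl
    have iU : Inhabited (SortE A) := ⟨⟨S, ss⟩⟩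
    have iV : Inhabited (SortE B) := ⟨⟨T, ts⟩⟩
    obtain ⟨SS, hSS⟩ := exists_fun_of_lt (P := fun i (hi : i < ss.length) C =>
      CanonSort TA X (ss[i]'hi) C) fun i hi => (ds (List.getElem_mem hi)).exists_canon NA
    obtain ⟨TS, hTS⟩ := exists_fun_of_lt (P := fun i (hi : i < ts.length) C =>
      CanonSort TB Y (ts[i]'hi) C) fun i hi => (dt (List.getElem_mem hi)).exists_canon NB
    have hg := isGrid_prodMap (F := ct TA TB X' Y') (as := ss ++ [Expr.var x])
      (bs := ts ++ [Expr.var y]) (M := fun i j => ct TA TB X' Y'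
        ((ss ++ [Expr.var x]).getD i (.var x)) ((ts ++ [Expr.var y]).getD j (.var y))) fun i j hi hj => by
          rw [List.getD_eq_getElem _ _ hi, List.getD_eq_getElem _ _ hj]
    rw [tso, ← dropLast_prodMap]
    simp only [List.length_append, List.length_cons, List.length_nil, Nat.zero_add] at hg
    refine .mk hx hy SS TS hSS hTS _ _ (fun i hi j hj => ?_) (fun j hj => ?_) (fun i hi => ?_) hg
    · refine (kst (List.getElem_mem hi) (hSS i hi) (List.getElem_mem hj) (hTS j hj)).2 ?_
      simp [List.getElem?_append_left, hi, hj]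
    · refine (kxt (List.getElem_mem hj) (hTS j hj)).2 ?_
      simp [List.getElem?_append_left, hj]
    · refine (ksy (List.getElem_mem hi) (hSS i hi)).2 ?_
      simp [List.getElem?_append_left, hi]

theorem tctx_iff (NA : Nice TA) (NB : Nice TB) {X : PreCtx A} {Y : PreCtx B}
    {Z : PreCtx (A.tensor B)} (hX : Derivable TA (.ctx X)) (hY : Derivable TB (.ctx Y)) :
    TCtx TA TB false X Y Z ↔ Z = tctx TA TB X Y := by
  have key : ∀ i j (hi : i < X.length) (hj : j < Y.length) W,
      TSo TA TB false (X.take i) (X[i]'hi).1 (X[i]'hi).2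
      (Y.take j) (Y[j]'hj).1 (Y[j]'hj).2 W ↔ W = tso TA TB X Y X[i] Y[j] := fun i j hi hj W =>
    tso_iff NA NB (hX.sort_of_ctx i hi) (hY.sort_of_ctx j hj) (hX.take_fresh hi)
      (hY.take_fresh hj) hX hY (List.take_subset _ _) (List.take_subset _ _)
      (List.getElem_mem hi) (List.getElem_mem hj)
  constructor
  · rintro ⟨hl, h⟩
    refine eq_prodMap hl fun i j hi hj hk => ?_
    exact Prod.ext (h i j hi hj hk).1 ((key i j hi hj _).1 (h i j hi hj hk).2)
  · rintro rfl
    refine ⟨length_prodMap, fun i j hi hj hk => ?_⟩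
    simp only [tctx, getElem_prodMap i j hi hj]
    exact ⟨trivial, (key i j hi hj _).2 rfl⟩

theorem Derivable.sort_mem (NA : Nice TA) {X : PreCtx A} (hX : Derivable TA (.ctx X))
    {p : A.Var × SortE A} (hp : p ∈ X) : Derivable TA (.sort X p.2) :=
  (Derivable.var NA hX hp).sort_of_term

theorem tso_mono (NA : Nice TA) (NB : Nice TB) {X X' : PreCtx A} {Y Y' : PreCtx B}
    (hX : Derivable TA (.ctx X)) (hY : Derivable TB (.ctx Y))
    (hX' : Derivable TA (.ctx X')) (hY' : Derivable TB (.ctx Y'))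
    (sX : X ⊆ X') (sY : Y ⊆ Y') {p : A.Var × SortE A} {q : B.Var × SortE B}
    (hp : p ∈ X) (hq : q ∈ Y) : tso TA TB X Y p q = tso TA TB X' Y' p q := by
  have hpv : DerTerm TA X (.var p.1) := ⟨_, Derivable.var NA hX hp⟩
  have hqv : DerTerm TB Y (.var q.1) := ⟨_, Derivable.var NB hY hq⟩
  rw [tso, tso, prodMap_congr fun a ha b hb => ct_mono NA NB hX' hY' sX sY
    ((hX.sort_mem NA hp).sort_arg NA ha) ?_, List.map_congr_left fun b hb =>
    ct_mono NA NB hX' hY' sX sY hpv ((hY.sort_mem NB hq).sort_arg NB hb)]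
  rcases List.mem_append.1 hb with hb | hb
  · exact (hY.sort_mem NB hq).sort_arg NB hb
  · rwa [List.mem_singleton.1 hb]

theorem mem_tctx {X : PreCtx A} {Y : PreCtx B} {r : (A.Var × B.Var) × SortE (A.tensor B)} :
    r ∈ tctx TA TB X Y ↔ ∃ p ∈ X, ∃ q ∈ Y, ((p.1, q.1), tso TA TB X Y p q) = r := mem_prodMap

theorem tctx_fst {X : PreCtx A} {Y : PreCtx B} :
    (tctx TA TB X Y).map Prod.fst = prodMap Prod.mk (X.map Prod.fst) (Y.map Prod.fst) := by
  rw [tctx, map_prodMap, prodMap_map]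

end

section

variable {A B : Alphabet}
variable {TA : Set (Judg A)} {TB : Set (Judg B)}

open Classical in
/-- The substitution `[u ⊗ y₁ | x y₁, …, u ⊗ yₙ | x yₙ]`. -/
noncomputable def rhoL (TA : Set (Judg A)) (TB : Set (Judg B)) (X : PreCtx A) (Y : PreCtx B)
    (u : Expr A) (x : A.Var) (z : (A.tensor B).Var) : Expr (A.tensor B) :=
  if z.1 = x ∧ z.2 ∈ Y.map Prod.fst then ct TA TB X Y u (.var z.2) else .var z

open Classical in
/-- The substitution `[x₁ ⊗ v | x₁ y, …, x_m ⊗ v | x_m y]`. -/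
noncomputable def rhoR (TA : Set (Judg A)) (TB : Set (Judg B)) (X : PreCtx A) (Y : PreCtx B)
    (v : Expr B) (y : B.Var) (z : (A.tensor B).Var) : Expr (A.tensor B) :=
  if z.1 ∈ X.map Prod.fst ∧ z.2 = y then ct TA TB X Y (.var z.1) v else .var z

section
variable {X X₁ : PreCtx A} {Y Y₁ : PreCtx B} {u : Expr A} {v : Expr B} {U U' : SortE A}
  {V V' : SortE B} {x : A.Var} {y : B.Var} {e : Expr (A.tensor B)}

theorem lookupV_pairsR_eq (hY : (Y.map Prod.fst).Nodup) {g : ℕ → Expr (A.tensor B)}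
    (hg : ∀ j (hj : j < Y.length), g j = ct TA TB X Y u (.var (Y[j]).1)) :
    lookupV (pairsR x Y g) = rhoL TA TB X Y u x := by
  funext z
  unfold rhoL
  split_ifs with hz
  · obtain ⟨p, hp, hpz⟩ := List.mem_map.1 hz.2
    obtain ⟨j, hj, rfl⟩ := List.getElem_of_mem hp
    obtain ⟨z1, z2⟩ := z
    obtain ⟨h1, h2⟩ := hz
    simp only at h1 h2 hpz
    subst h1 hpz
    rw [lookupV_pairsR hY _ j hj, hg j hj]
  · exact lookupV_of_not_mem fun h => hz (mem_pairsR_fst.1 h)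

theorem lookupV_pairsL_eq (hX : (X.map Prod.fst).Nodup) {g : ℕ → Expr (A.tensor B)}
    (hg : ∀ i (hi : i < X.length), g i = ct TA TB X Y (.var (X[i]).1) v) :
    lookupV (pairsL X y g) = rhoR TA TB X Y v y := by
  funext z
  unfold rhoR
  split_ifs with hz
  · obtain ⟨p, hp, hpz⟩ := List.mem_map.1 hz.1
    obtain ⟨j, hj, rfl⟩ := List.getElem_of_mem hp
    obtain ⟨z1, z2⟩ := z
    obtain ⟨h1, h2⟩ := hz
    simp only at h1 h2 hpz
    subst h2 hpz
    rw [lookupV_pairsL hX _ j hj, hg j hj]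
  · exact lookupV_of_not_mem fun h => hz (mem_pairsL_fst.1 h)

theorem ttg_fresh_left (NA : Nice TA) (NB : Nice TB) (hU : Derivable TA (.sort X U))
    (hx : ∀ p ∈ X, p.1 ≠ x) (hv : Derivable TB (.term Y v V)) :
    TTg TA TB false ⟨X, .var x, U⟩ ⟨Y, v, V⟩ e ↔ e = ct TA TB (X ++ [(x, U)]) Y (.var x) v :=
  ttg_iff NA NB (.fresh hU hx) ⟨hv.sort_of_term, .inl hv⟩ (.snoc NA hU hx) (Derivable.ctx hv)
    (List.subset_append_left _ _) (List.Subset.refl _)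
    ⟨_, .of_mem (p := (x, U)) (by simp)⟩ (DerTerm.exists_canon NB ⟨_, hv⟩)
    (.inr (.of_mem (p := (x, U)) (by simp))) (.inl ⟨_, rfl⟩)

theorem ttg_fresh_right (NA : Nice TA) (NB : Nice TB) (hV : Derivable TB (.sort Y V))
    (hy : ∀ p ∈ Y, p.1 ≠ y) (hu : Derivable TA (.term X u U)) :
    TTg TA TB false ⟨X, u, U⟩ ⟨Y, .var y, V⟩ e ↔ e = ct TA TB X (Y ++ [(y, V)]) u (.var y) :=
  ttg_iff NA NB ⟨hu.sort_of_term, .inl hu⟩ (.fresh hV hy) (Derivable.ctx hu) (.snoc NB hV hy)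
    (List.Subset.refl _) (List.subset_append_left _ _) (DerTerm.exists_canon NA ⟨_, hu⟩)
    ⟨_, .of_mem (p := (y, V)) (by simp)⟩
    (.inl ⟨_, rfl⟩) (.inr (.of_mem (p := (y, V)) (by simp)))

theorem ttg_var_left (NA : Nice TA) (NB : Nice TB) (hX : Derivable TA (.ctx X)) {i : ℕ}
    (hi : i < X.length) (hv : Derivable TB (.term Y v V)) :
    TTg TA TB false ⟨X.take i, .var (X[i]).1, (X[i]).2⟩ ⟨Y, v, V⟩ e ↔
      e = ct TA TB X Y (.var (X[i]).1) v :=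
  ttg_iff NA NB (.take hX hi) ⟨hv.sort_of_term, .inl hv⟩ hX (Derivable.ctx hv)
    (List.take_subset _ _) (List.Subset.refl _) ⟨_, .of_mem (List.getElem_mem hi)⟩
    (DerTerm.exists_canon NB ⟨_, hv⟩) (.inr (.of_mem (List.getElem_mem hi))) (.inl ⟨_, rfl⟩)

theorem ttg_var_right (NA : Nice TA) (NB : Nice TB) (hY : Derivable TB (.ctx Y)) {j : ℕ}
    (hj : j < Y.length) (hu : Derivable TA (.term X u U)) :
    TTg TA TB false ⟨X, u, U⟩ ⟨Y.take j, .var (Y[j]).1, (Y[j]).2⟩ e ↔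
      e = ct TA TB X Y u (.var (Y[j]).1) :=
  ttg_iff NA NB ⟨hu.sort_of_term, .inl hu⟩ (.take hY hj) (Derivable.ctx hu) hY
    (List.Subset.refl _) (List.take_subset _ _) (DerTerm.exists_canon NA ⟨_, hu⟩)
    ⟨_, .of_mem (List.getElem_mem hj)⟩ (.inl ⟨_, rfl⟩) (.inr (.of_mem (List.getElem_mem hj)))

theorem tso_fresh (NA : Nice TA) (NB : Nice TB) (hU : Derivable TA (.sort X U))
    (hV : Derivable TB (.sort Y V)) (hx : ∀ p ∈ X, p.1 ≠ x) (hy : ∀ p ∈ Y, p.1 ≠ y)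
    {W : SortE (A.tensor B)} : TSo TA TB false X x U Y y V W ↔
      W = tso TA TB (X ++ [(x, U)]) (Y ++ [(y, V)]) (x, U) (y, V) :=
  tso_iff NA NB hU hV hx hy (.snoc NA hU hx) (.snoc NB hV hy) (List.subset_append_left _ _)
    (List.subset_append_left _ _) (by simp) (by simp)

/-- The sort `U^x ⊗ V^y` for fresh variables `x` and `y`. -/
noncomputable def tsoF (TA : Set (Judg A)) (TB : Set (Judg B)) (X : PreCtx A) (Y : PreCtx B)
    (x : A.Var) (U : SortE A) (y : B.Var) (V : SortE B) : SortE (A.tensor B) :=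
  tso TA TB (X ++ [(x, U)]) (Y ++ [(y, V)]) (x, U) (y, V)

end

section
variable {chA : PreCtx A → A.Var} {chB : PreCtx B → B.Var}
variable {X : PreCtx A} {Y : PreCtx B} {u u' : Expr A} {v v' : Expr B} {U U' : SortE A}
  {V V' : SortE B}

theorem TJudg.ss_iff (NA : Nice TA) (NB : Nice TB) (hchA : FreshCh chA) (hchB : FreshCh chB)
    (hU : Derivable TA (.sort X U)) (hV : Derivable TB (.sort Y V)) {K : Judg (A.tensor B)} :
    TJudg TA TB chA chB false (.sort X U) (.sort Y V) K ↔
      K = .sort (tctx TA TB (X ++ [(chA X, U)]) (Y ++ [(chB Y, V)])).dropLast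
        (tsoF TA TB X Y (chA X) U (chB Y) V) := by
  have hZ := fun Z => tctx_iff (Z := Z) NA NB (.snoc NA hU (hchA X)) (.snoc NB hV (hchB Y))
  constructor
  · intro h
    cases h with
    | ss hZ' hW => rw [(hZ _).1 hZ', (tso_fresh NA NB hU hV (hchA X) (hchB Y)).1 hW, tsoF]
  · rintro rfl
    exact .ss ((hZ _).2 rfl) ((tso_fresh NA NB hU hV (hchA X) (hchB Y)).2 rfl)

theorem TJudg.st_iff (NA : Nice TA) (NB : Nice TB) (hchA : FreshCh chA) (hchB : FreshCh chB)
    (hU : Derivable TA (.sort X U)) (hv : Derivable TB (.term Y v V)) {K : Judg (A.tensor B)} :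
    TJudg TA TB chA chB false (.sort X U) (.term Y v V) K ↔
      K = .term (tctx TA TB (X ++ [(chA X, U)]) Y)
        (ct TA TB (X ++ [(chA X, U)]) Y (.var (chA X)) v)
        ((tsoF TA TB X Y (chA X) U (chB Y) V).subst (rhoR TA TB X Y v (chB Y))) := by
  have hX : Derivable TA (.ctx X) := Derivable.ctx hU
  have hZ := fun Z => tctx_iff (Z := Z) NA NB (.snoc NA hU (hchA X)) (DerTerm.ctx ⟨_, hv⟩)
  constructor
  · intro h
    cases h with
    | st hZ' he hW hg =>
      rw [(hZ _).1 hZ', (tso_fresh NA NB hU hv.sort_of_term (hchA X) (hchB Y)).1 hW,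
        (ttg_fresh_left NA NB hU (hchA X) hv).1 he, SortE.substL, lookupV_pairsL_eq hX.nodup
          fun i hi => (ttg_var_left NA NB hX hi hv).1 (hg i hi), tsoF]
  · rintro rfl
    obtain ⟨g, hg⟩ := exists_fun_of_lt (n := X.length) (P := fun i (hi : i < X.length) e =>
      e = ct TA TB X Y (.var (X[i]).1) v) fun i hi => ⟨_, rfl⟩
    rw [← lookupV_pairsL_eq hX.nodup hg]
    exact .st ((hZ _).2 rfl) ((ttg_fresh_left NA NB hU (hchA X) hv).2 rfl)
      ((tso_fresh NA NB hU hv.sort_of_term (hchA X) (hchB Y)).2 rfl)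
      fun i hi => (ttg_var_left NA NB hX hi hv).2 (hg i hi)

theorem TJudg.ts_iff (NA : Nice TA) (NB : Nice TB) (hchA : FreshCh chA) (hchB : FreshCh chB)
    (hu : Derivable TA (.term X u U)) (hV : Derivable TB (.sort Y V)) {K : Judg (A.tensor B)} :
    TJudg TA TB chA chB false (.term X u U) (.sort Y V) K ↔
      K = .term (tctx TA TB X (Y ++ [(chB Y, V)]))
        (ct TA TB X (Y ++ [(chB Y, V)]) u (.var (chB Y)))
        ((tsoF TA TB X Y (chA X) U (chB Y) V).subst (rhoL TA TB X Y u (chA X))) := by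
  have hY : Derivable TB (.ctx Y) := Derivable.ctx hV
  have hZ := fun Z => tctx_iff (Z := Z) NA NB (DerTerm.ctx ⟨_, hu⟩) (.snoc NB hV (hchB Y))
  constructor
  · intro h
    cases h with
    | ts hZ' he hW hg =>
      rw [(hZ _).1 hZ', (tso_fresh NA NB hu.sort_of_term hV (hchA X) (hchB Y)).1 hW,
        (ttg_fresh_right NA NB hV (hchB Y) hu).1 he, SortE.substL, lookupV_pairsR_eq hY.nodup
          fun i hi => (ttg_var_right NA NB hY hi hu).1 (hg i hi), tsoF]
  · rintro rfl
    obtain ⟨g, hg⟩ := exists_fun_of_lt (n := Y.length) (P := fun j (hj : j < Y.length) e =>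
      e = ct TA TB X Y u (.var (Y[j]).1)) fun i hi => ⟨_, rfl⟩
    rw [← lookupV_pairsR_eq hY.nodup hg]
    exact .ts ((hZ _).2 rfl) ((ttg_fresh_right NA NB hV (hchB Y) hu).2 rfl)
      ((tso_fresh NA NB hu.sort_of_term hV (hchA X) (hchB Y)).2 rfl)
      fun i hi => (ttg_var_right NA NB hY hi hu).2 (hg i hi)

theorem TJudg.sseq_of (NA : Nice TA) (NB : Nice TB) (hchA : FreshCh chA) (hchB : FreshCh chB)
    (hU : Derivable TA (.sort X U)) (hV : Derivable TB (.sortEq Y V V')) :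
    TJudg TA TB chA chB false (.sort X U) (.sortEq Y V V')
      (.sortEq (tctx TA TB (X ++ [(chA X, U)]) (Y ++ [(chB Y, V)])).dropLast
        (tsoF TA TB X Y (chA X) U (chB Y) V) (tsoF TA TB X Y (chA X) U (chB Y) V')) :=
  .sseq ((tctx_iff NA NB (.snoc NA hU (hchA X)) (.snoc NB hV.sort_of_sortEq.1 (hchB Y))).2 rfl)
    ((tso_fresh NA NB hU hV.sort_of_sortEq.1 (hchA X) (hchB Y)).2 rfl)
    ((tso_fresh NA NB hU hV.sort_of_sortEq.2 (hchA X) (hchB Y)).2 rfl)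

theorem TJudg.seqs_of (NA : Nice TA) (NB : Nice TB) (hchA : FreshCh chA) (hchB : FreshCh chB)
    (hU : Derivable TA (.sortEq X U U')) (hV : Derivable TB (.sort Y V)) :
    TJudg TA TB chA chB false (.sortEq X U U') (.sort Y V)
      (.sortEq (tctx TA TB (X ++ [(chA X, U)]) (Y ++ [(chB Y, V)])).dropLast
        (tsoF TA TB X Y (chA X) U (chB Y) V) (tsoF TA TB X Y (chA X) U' (chB Y) V)) :=
  .seqs ((tctx_iff NA NB (.snoc NA hU.sort_of_sortEq.1 (hchA X)) (.snoc NB hV (hchB Y))).2 rfl)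
    ((tso_fresh NA NB hU.sort_of_sortEq.1 hV (hchA X) (hchB Y)).2 rfl)
    ((tso_fresh NA NB hU.sort_of_sortEq.2 hV (hchA X) (hchB Y)).2 rfl)

theorem TJudg.exists_steq (NA : Nice TA) (NB : Nice TB) (hchA : FreshCh chA) (hchB : FreshCh chB)
    (hU : Derivable TA (.sort X U)) (hv : Derivable TB (.termEq Y v v' V)) :
    ∃ W, TJudg TA TB chA chB false (.sort X U) (.termEq Y v v' V)
      (.termEq (tctx TA TB (X ++ [(chA X, U)]) Y) (ct TA TB (X ++ [(chA X, U)]) Y (.var (chA X)) v)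
        (ct TA TB (X ++ [(chA X, U)]) Y (.var (chA X)) v') W) := by
  have hX : Derivable TA (.ctx X) := Derivable.ctx hU
  have h1 := hv.term_of_termEq.1
  obtain ⟨g, hg⟩ := exists_fun_of_lt (n := X.length) (P := fun i (hi : i < X.length) e =>
      e = ct TA TB X Y (.var (X[i]).1) v) fun i hi => ⟨_, rfl⟩
  exact ⟨_, .steq ((tctx_iff NA NB (.snoc NA hU (hchA X)) (Derivable.ctx h1)).2 rfl)
    ((ttg_fresh_left NA NB hU (hchA X) h1).2 rfl)
    ((ttg_fresh_left NA NB hU (hchA X) hv.term_of_termEq.2).2 rfl)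
    ((tso_fresh NA NB hU h1.sort_of_term (hchA X) (hchB Y)).2 rfl)
    fun i hi => (ttg_var_left NA NB hX hi h1).2 (hg i hi)⟩

theorem TJudg.exists_teqs (NA : Nice TA) (NB : Nice TB) (hchA : FreshCh chA) (hchB : FreshCh chB)
    (hu : Derivable TA (.termEq X u u' U)) (hV : Derivable TB (.sort Y V)) :
    ∃ W, TJudg TA TB chA chB false (.termEq X u u' U) (.sort Y V)
      (.termEq (tctx TA TB X (Y ++ [(chB Y, V)])) (ct TA TB X (Y ++ [(chB Y, V)]) u (.var (chB Y)))
        (ct TA TB X (Y ++ [(chB Y, V)]) u' (.var (chB Y))) W) := by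
  have hY : Derivable TB (.ctx Y) := Derivable.ctx hV
  have h1 := hu.term_of_termEq.1
  obtain ⟨g, hg⟩ := exists_fun_of_lt (n := Y.length) (P := fun j (hj : j < Y.length) e =>
      e = ct TA TB X Y u (.var (Y[j]).1)) fun i hi => ⟨_, rfl⟩
  exact ⟨_, .teqs ((tctx_iff NA NB (Derivable.ctx h1) (.snoc NB hV (hchB Y))).2 rfl)
    ((ttg_fresh_right NA NB hV (hchB Y) h1).2 rfl)
    ((ttg_fresh_right NA NB hV (hchB Y) hu.term_of_termEq.2).2 rfl)
    ((tso_fresh NA NB h1.sort_of_term hV (hchA X) (hchB Y)).2 rfl)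
    fun i hi => (ttg_var_right NA NB hY hi h1).2 (hg i hi)⟩

theorem TJudg.exists_seqt (NA : Nice TA) (NB : Nice TB) (hchA : FreshCh chA) (hchB : FreshCh chB)
    (hU : Derivable TA (.sortEq X U U')) (hv : Derivable TB (.term Y v V)) :
    ∃ W, TJudg TA TB chA chB false (.sortEq X U U') (.term Y v V)
      (.termEq (tctx TA TB (X ++ [(chA X, U)]) Y) (ct TA TB (X ++ [(chA X, U)]) Y (.var (chA X)) v)
        (ct TA TB (X ++ [(chA X, U')]) Y (.var (chA X)) v) W) := by
  have hX : Derivable TA (.ctx X) := Derivable.ctx hU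
  have h1 := hU.sort_of_sortEq.1
  obtain ⟨g, hg⟩ := exists_fun_of_lt (n := X.length) (P := fun i (hi : i < X.length) e =>
      e = ct TA TB X Y (.var (X[i]).1) v) fun i hi => ⟨_, rfl⟩
  exact ⟨_, .seqt ((tctx_iff NA NB (.snoc NA h1 (hchA X)) (Derivable.ctx hv)).2 rfl)
    ((ttg_fresh_left NA NB h1 (hchA X) hv).2 rfl)
    ((ttg_fresh_left NA NB hU.sort_of_sortEq.2 (hchA X) hv).2 rfl)
    ((tso_fresh NA NB h1 hv.sort_of_term (hchA X) (hchB Y)).2 rfl)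
    fun i hi => (ttg_var_left NA NB hX hi hv).2 (hg i hi)⟩

theorem TJudg.exists_tseq (NA : Nice TA) (NB : Nice TB) (hchA : FreshCh chA) (hchB : FreshCh chB)
    (hu : Derivable TA (.term X u U)) (hV : Derivable TB (.sortEq Y V V')) :
    ∃ W, TJudg TA TB chA chB false (.term X u U) (.sortEq Y V V')
      (.termEq (tctx TA TB X (Y ++ [(chB Y, V)])) (ct TA TB X (Y ++ [(chB Y, V)]) u (.var (chB Y)))
        (ct TA TB X (Y ++ [(chB Y, V')]) u (.var (chB Y))) W) := by
  have hY : Derivable TB (.ctx Y) := Derivable.ctx hV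
  have h1 := hV.sort_of_sortEq.1
  obtain ⟨g, hg⟩ := exists_fun_of_lt (n := Y.length) (P := fun j (hj : j < Y.length) e =>
      e = ct TA TB X Y u (.var (Y[j]).1)) fun i hi => ⟨_, rfl⟩
  exact ⟨_, .tseq ((tctx_iff NA NB (Derivable.ctx hu) (.snoc NB h1 (hchB Y))).2 rfl)
    ((ttg_fresh_right NA NB h1 (hchB Y) hu).2 rfl)
    ((ttg_fresh_right NA NB hV.sort_of_sortEq.2 (hchB Y) hu).2 rfl)
    ((tso_fresh NA NB hu.sort_of_term h1 (hchA X) (hchB Y)).2 rfl)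
    fun i hi => (ttg_var_right NA NB hY hi hu).2 (hg i hi)⟩

theorem TJudg.exists_tt (NA : Nice TA) (NB : Nice TB) (hchA : FreshCh chA) (hchB : FreshCh chB)
    {s : A.TermSym} {us : List (Expr A)} {t : B.TermSym} {ts : List (Expr B)} {y : B.Var}
    (hu : DerTerm TA X (.app s us)) (hU : CanonSort TA X (.app s us) U)
    (hv : DerTerm TB Y (.app t ts)) (hV : CanonSort TB Y (.app t ts) V)
    (hy : ∀ p ∈ Y, p.1 ≠ y) :
    ∃ W, TJudg TA TB chA chB false (.term X (.app s us) U) (.term Y (.app t ts) V)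
      (.termEq (tctx TA TB X Y) (ct TA TB X Y (.app s us) (.app t ts))
        ((ct TA TB X (Y ++ [(y, V)]) (.app s us) (.var y)).subst
          (rhoR TA TB X Y (.app t ts) y)) W) := by
  have hX : Derivable TA (.ctx X) := hu.ctx
  have hY : Derivable TB (.ctx Y) := hv.ctx
  have du := hu.canon NA hU
  have dv := hv.canon NB hV
  obtain ⟨gx, hgx⟩ := exists_fun_of_lt (n := X.length) (P := fun i (hi : i < X.length) e =>
      e = ct TA TB X Y (.var (X[i]).1) (.app t ts)) fun i hi => ⟨_, rfl⟩
  obtain ⟨gy, hgy⟩ := exists_fun_of_lt (n := Y.length) (P := fun j (hj : j < Y.length) e =>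
      e = ct TA TB X Y (.app s us) (.var (Y[j]).1)) fun i hi => ⟨_, rfl⟩
  rw [← lookupV_pairsL_eq (y := y) hX.nodup hgx]
  have hgx' := fun i (hi : i < X.length) => (ttg_var_left NA NB hX hi dv).2 (hgx i hi)
  exact ⟨_, .tt ((tctx_iff NA NB hX hY).2 rfl)
    ((ttg_iff NA NB (.canon NA hu hU) (.canon NB hv hV) hX hY (List.Subset.refl _)
      (List.Subset.refl _) ⟨_, hU⟩ ⟨_, hV⟩ (.inr hU) (.inr hV)).2 rfl)
    (.appapp_base hy _ ((ttg_fresh_right NA NB dv.sort_of_term hy du).2 rfl) gx hgx')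
    ((tso_fresh NA NB du.sort_of_term dv.sort_of_term (hchA X) (hchB Y)).2 rfl)
    hgx' fun i hi => (ttg_var_right NA NB hY hi du).2 (hgy i hi)⟩

end

end

section

variable {A B : Alphabet}
variable {TA : Set (Judg A)} {TB : Set (Judg B)}
variable {chA : PreCtx A → A.Var} {chB : PreCtx B → B.Var}
variable {X : PreCtx A} {Y : PreCtx B} {u : Expr A} {v : Expr B} {U : SortE A} {V : SortE B}

theorem ctxVars_eq_map (X : PreCtx A) : ctxVars X = X.map fun p => Expr.var p.1 := rfl

theorem ctxVars_tctx : ctxVars (tctx TA TB X Y) =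
    prodMap (fun p q => Expr.var (A := A.tensor B) (p.1, q.1)) X Y := by
  rw [ctxVars, tctx, map_prodMap]

theorem ct_vv_of_mem (NA : Nice TA) (NB : Nice TB) {p : A.Var × SortE A} {q : B.Var × SortE B}
    (hp : p ∈ X) (hq : q ∈ Y) :
    ct TA TB X Y (.var p.1) (.var q.1) = .var (p.1, q.1) :=
  ct_vv NA NB (List.mem_map_of_mem hp) (List.mem_map_of_mem hq)

theorem ct_intro_left (NA : Nice TA) (NB : Nice TB) {S : A.SortSym} {t : B.TermSym} {x : A.Var}
    (hU : Derivable TA (introSort X S)) (hx : ∀ p ∈ X, p.1 ≠ x)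
    (hv : Derivable TB (introTerm Y t V)) :
    ct TA TB (X ++ [(x, ⟨S, ctxVars X⟩)]) Y (.var x) (.app t (ctxVars Y)) =
      .app (Sum.inl (S, t)) (ctxVars (tctx TA TB (X ++ [(x, ⟨S, ctxVars X⟩)]) Y)) := by
  have hX1 := Derivable.snoc NA hU hx
  have hm : (x, (⟨S, ctxVars X⟩ : SortE A)) ∈ X ++ [(x, ⟨S, ctxVars X⟩)] := by simp
  rw [ct_va NA NB ⟨_, .var NA hX1 hm⟩ ⟨_, hv⟩ (.of_mem hm), ctxVars_tctx, prodMap_append,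
    prodMap_singleton, ctxVars_eq_map X, ctxVars_eq_map Y, prodMap_map, List.map_map]
  congr 2
  · exact prodMap_congr fun p hp q hq => ct_vv_of_mem NA NB (List.mem_append_left _ hp) hq
  · exact List.map_congr_left fun q hq => ct_vv_of_mem NA NB hm hq

theorem ct_intro_right (NA : Nice TA) (NB : Nice TB) {s : A.TermSym} {T : B.SortSym} {y : B.Var}
    (hu : Derivable TA (introTerm X s U)) (hV : Derivable TB (introSort Y T))
    (hy : ∀ p ∈ Y, p.1 ≠ y) :
    ct TA TB X (Y ++ [(y, ⟨T, ctxVars Y⟩)]) (.app s (ctxVars X)) (.var y) =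
      .app (Sum.inr (s, T)) (ctxVars (tctx TA TB X (Y ++ [(y, ⟨T, ctxVars Y⟩)]))) := by
  have hY1 := Derivable.snoc NB hV hy
  have hm : (y, (⟨T, ctxVars Y⟩ : SortE B)) ∈ Y ++ [(y, ⟨T, ctxVars Y⟩)] := by simp
  have he : ctxVars Y ++ [.var y] = ((Y ++ [(y, ⟨T, ctxVars Y⟩)] : PreCtx B).map fun q => Expr.var q.1) := by
    simp [ctxVars]
  rw [ct_av NA NB ⟨_, hu⟩ hY1 hm, ctxVars_tctx, he, ctxVars_eq_map X, prodMap_map]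
  congr 1
  exact prodMap_congr fun p hp q hq => ct_vv_of_mem NA NB hp hq

theorem nice_tensorAx (hA : IsGAT TA) (hB : IsGAT TB) (hchA : FreshCh chA) (hchB : FreshCh chB) :
    Nice (tensorAx TA TB chA chB) := by
  have NA := hA.1.nice
  have NB := hB.1.nice
  have hst : ∀ {X u U}, Judg.term X u U ∈ tensorAx TA TB chA chB →
      (∃ (X₀ : PreCtx A) (S : A.SortSym) (Y₀ : PreCtx B) (t : B.TermSym) (V : SortE B),
        introSort X₀ S ∈ TA ∧ introTerm Y₀ t V ∈ TB ∧
        X = tctx TA TB (X₀ ++ [(chA X₀, ⟨S, ctxVars X₀⟩)]) Y₀ ∧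
        u = .app (Sum.inl (S, t)) (ctxVars X) ∧
        U = (tsoF TA TB X₀ Y₀ (chA X₀) ⟨S, ctxVars X₀⟩ (chB Y₀) V).subst
          (rhoR TA TB X₀ Y₀ (.app t (ctxVars Y₀)) (chB Y₀))) ∨
      ∃ (X₀ : PreCtx A) (s : A.TermSym) (U₀ : SortE A) (Y₀ : PreCtx B) (T : B.SortSym),
        introTerm X₀ s U₀ ∈ TA ∧ introSort Y₀ T ∈ TB ∧
        X = tctx TA TB X₀ (Y₀ ++ [(chB Y₀, ⟨T, ctxVars Y₀⟩)]) ∧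
        u = .app (Sum.inr (s, T)) (ctxVars X) ∧
        U = (tsoF TA TB X₀ Y₀ (chA X₀) U₀ (chB Y₀) ⟨T, ctxVars Y₀⟩).subst
          (rhoL TA TB X₀ Y₀ (.app s (ctxVars X₀)) (chA X₀)) := by
    rintro X u U ⟨J, J', hJ, hJ', h⟩
    have h0 := h
    cases h with
    | @st X₀ U₀ Y₀ v V =>
      left
      obtain ⟨S, ss⟩ := U₀
      obtain rfl : ss = _ := hA.1.sort_shape _ _ hJ
      obtain ⟨t, rfl⟩ := hB.1.term_shape _ _ _ hJ'
      have h1 := (TJudg.st_iff NA NB hchA hchB (hA.2 _ hJ) (hB.2 _ hJ')).1 h0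
      rw [Judg.term.injEq] at h1
      obtain ⟨rfl, h2, h3⟩ := h1
      refine ⟨X₀, S, Y₀, t, V, hJ, hJ', rfl, ?_, h3⟩
      rw [h2, ct_intro_left NA NB (hA.2 _ hJ) (hchA X₀) (hB.2 _ hJ')]
    | @ts X₀ u₀ U₀ Y₀ V =>
      right
      obtain ⟨T, ts⟩ := V
      obtain rfl : ts = _ := hB.1.sort_shape _ _ hJ'
      obtain ⟨s, rfl⟩ := hA.1.term_shape _ _ _ hJ
      have h1 := (TJudg.ts_iff NA NB hchA hchB (hA.2 _ hJ) (hB.2 _ hJ')).1 h0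
      rw [Judg.term.injEq] at h1
      obtain ⟨rfl, h2, h3⟩ := h1
      refine ⟨X₀, s, U₀, Y₀, T, hJ, hJ', rfl, ?_, h3⟩
      rw [h2, ct_intro_right NA NB (hA.2 _ hJ) (hB.2 _ hJ') (hchB Y₀)]
  refine ⟨?_, ?_, ?_⟩
  · rintro X U ⟨J, J', hJ, hJ', h⟩
    have h0 := h
    cases h with
    | @ss X₀ U₀ Y₀ V Z =>
      obtain ⟨S, ss⟩ := U₀
      obtain ⟨T, ts⟩ := V
      obtain rfl : ss = _ := hA.1.sort_shape _ _ hJ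
      obtain rfl : ts = _ := hB.1.sort_shape _ _ hJ'
      have h1 := (TJudg.ss_iff NA NB hchA hchB (hA.2 _ hJ) (hB.2 _ hJ')).1 h0
      rw [Judg.sort.injEq] at h1
      rw [h1.1, h1.2, ctxVars_eq_map (List.dropLast _), List.map_dropLast, ← ctxVars_eq_map,
        ctxVars_tctx, dropLast_prodMap]
      have he : ctxVars Y₀ ++ [.var (chB Y₀)] =
          ((Y₀ ++ [(chB Y₀, ⟨T, ctxVars Y₀⟩)] : PreCtx B).map fun q => Expr.var q.1) := by simp [ctxVars]
      simp only [tsoF, tso]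
      rw [he, ctxVars_eq_map X₀, ctxVars_eq_map Y₀, prodMap_map, List.map_map]
      congr 1
      · exact prodMap_congr fun p hp q hq => ct_vv_of_mem NA NB (List.mem_append_left _ hp) hq
      · exact List.map_congr_left fun q hq =>
          ct_vv_of_mem NA NB (p := (chA X₀, ⟨S, ctxVars X₀⟩))
            (List.mem_append_right _ (List.mem_singleton_self _))
            (List.mem_append_left _ hq)
  · intro X u U h
    rcases hst h with ⟨_, S, _, t, _, _, _, _, h, _⟩ | ⟨_, s, _, _, T, _, _, _, h, _⟩
    · exact ⟨_, h⟩
    · exact ⟨_, h⟩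
  · intro X X' t U U' h1 h2
    rcases hst h1 with ⟨X₀, S, Y₀, t₀, V, a1, a2, rfl, a3, rfl⟩ |
      ⟨X₀, s, U₀, Y₀, T, a1, a2, rfl, a3, rfl⟩ <;>
    rcases hst h2 with ⟨X₁, S', Y₁, t₁, V', b1, b2, rfl, b3, rfl⟩ |
      ⟨X₁, s', U₁, Y₁, T', b1, b2, rfl, b3, rfl⟩ <;>
    simp only [Expr.app.injEq] at a3 b3
    · have h3 := a3.1.symm.trans b3.1
      simp only [Sum.inl.injEq, Prod.mk.injEq] at h3
      obtain ⟨rfl, rfl⟩ := h3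
      obtain rfl := (hA.1.sort_intro S).unique a1 b1
      obtain ⟨rfl, rfl⟩ := NB.term_uniq _ _ _ _ _ a2 b2
      exact ⟨rfl, rfl⟩
    · exact absurd (a3.1.symm.trans b3.1) (by simp)
    · exact absurd (a3.1.symm.trans b3.1) (by simp)
    · have h3 := a3.1.symm.trans b3.1
      simp only [Sum.inr.injEq, Prod.mk.injEq] at h3
      obtain ⟨rfl, rfl⟩ := h3
      obtain rfl := (hB.1.sort_intro T).unique a2 b2
      obtain ⟨rfl, rfl⟩ := NA.term_uniq _ _ _ _ _ a1 b1
      exact ⟨rfl, rfl⟩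

end

section

variable {A B : Alphabet}
variable {TA : Set (Judg A)} {TB : Set (Judg B)}

/-- Two theories with chosen fresh variables whose pair is `h`-derivable. -/
structure HDer (TA : Set (Judg A)) (TB : Set (Judg B)) (chA : PreCtx A → A.Var)
    (chB : PreCtx B → B.Var) (h : ℕ) : Prop where
  gatA : IsGAT TA
  gatB : IsGAT TB
  freshA : FreshCh chA
  freshB : FreshCh chB
  hder : hDerivable TA TB chA chB h

theorem HDer.NA {chA : PreCtx A → A.Var} {chB : PreCtx B → B.Var} {h : ℕ}
    (H : HDer TA TB chA chB h) : Nice TA := H.gatA.1.nice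

theorem HDer.NB {chA : PreCtx A → A.Var} {chB : PreCtx B → B.Var} {h : ℕ}
    (H : HDer TA TB chA chB h) : Nice TB := H.gatB.1.nice

theorem HDer.NT {chA : PreCtx A → A.Var} {chB : PreCtx B → B.Var} {h : ℕ}
    (H : HDer TA TB chA chB h) : Nice (tensorAx TA TB chA chB) :=
  nice_tensorAx H.gatA H.gatB H.freshA H.freshB

theorem HDer.der {chA : PreCtx A → A.Var} {chB : PreCtx B → B.Var} {h a b : ℕ}
    (H : HDer TA TB chA chB h) {J : Judg A} {J' : Judg B} {K : Judg (A.tensor B)}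
    (hJ : DerAt TA a J) (hJ' : DerAt TB b J') (hab : a * b ≤ h)
    (hK : TJudg TA TB chA chB false J J' K) : Derivable (tensorAx TA TB chA chB) K :=
  H.hder J J' K ⟨a, hJ⟩ ⟨b, hJ'⟩
    ((Nat.mul_le_mul (Nat.sInf_le hJ) (Nat.sInf_le hJ')).trans hab) hK

/-- The renaming of tensor variables induced by renamings of the factors. -/
def renV (f : A.Var → A.Var) (g : B.Var → B.Var) (z : (A.tensor B).Var) : Expr (A.tensor B) :=
  .var (f z.1, g z.2)

/-- `f` renames the entries of `X₀` to entries of `X`. -/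
def Ren (f : A.Var → A.Var) (X₀ X : PreCtx A) : Prop :=
  ∀ p ∈ X₀, (f p.1, p.2.subst fun a => .var (f a)) ∈ X

theorem ct_ren (NA : Nice TA) (NB : Nice TB) {X X₀ : PreCtx A} {Y Y₀ : PreCtx B}
    (hX : Derivable TA (.ctx X)) (hY : Derivable TB (.ctx Y)) {f : A.Var → A.Var}
    {g : B.Var → B.Var} (hf : Ren f X₀ X) (hg : Ren g Y₀ Y) {u : Expr A} {v : Expr B}
    (hu : DerTerm TA X₀ u) (hv : DerTerm TB Y₀ v) :
    (ct TA TB X₀ Y₀ u v).subst (renV f g) =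
      ct TA TB X Y (u.subst fun a => .var (f a)) (v.subst fun a => .var (g a)) :=
  (CT.subst_strict NA NB hX hY (f := fun a => .var (f a)) (ρ := renV f g)
    (fun p hp => .of_mem (hf p hp)) hg
    (fun p hp q hq => .vv (List.mem_map_of_mem (hf p hp)) (List.mem_map_of_mem (hg q hq)))
    (CT.of_der NA NB hu hv) hu hv).eq_ct NA NB hX.nodup hY.nodup

theorem tso_ren (NA : Nice TA) (NB : Nice TB) {X X₀ : PreCtx A} {Y Y₀ : PreCtx B}
    (hX : Derivable TA (.ctx X)) (hY : Derivable TB (.ctx Y)) (hX₀ : Derivable TA (.ctx X₀))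
    (hY₀ : Derivable TB (.ctx Y₀)) {f : A.Var → A.Var} {g : B.Var → B.Var} (hf : Ren f X₀ X)
    (hg : Ren g Y₀ Y) {p : A.Var × SortE A} {q : B.Var × SortE B} (hp : p ∈ X₀) (hq : q ∈ Y₀) :
    (tso TA TB X₀ Y₀ p q).subst (renV f g) =
      tso TA TB X Y (f p.1, p.2.subst fun a => .var (f a)) (g q.1, q.2.subst fun a => .var (g a)) := by
  have dp := Derivable.var NA hX₀ hp
  have dq := Derivable.var NB hY₀ hq
  simp only [tso, SortE.subst, List.map_append, map_prodMap, List.map_map]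
  congr 2
  · rw [show List.map (Expr.subst fun a => Expr.var (g a)) q.2.args ++ [Expr.var (g q.1)] =
      List.map (Expr.subst fun a => Expr.var (g a)) (q.2.args ++ [.var q.1]) by simp [Expr.subst_var], prodMap_map]
    refine prodMap_congr fun a ha b hb => ct_ren NA NB hX hY hf hg
      (dp.sort_of_term.sort_arg NA ha) ?_
    rcases List.mem_append.1 hb with hb | hb
    · exact dq.sort_of_term.sort_arg NB hb
    · rw [List.mem_singleton.1 hb]
      exact ⟨_, dq⟩
  · refine List.map_congr_left fun b hb => ?_
    rw [Function.comp_apply, ct_ren NA NB hX hY hf hg ⟨_, dp⟩ (dq.sort_of_term.sort_arg NB hb),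
      Expr.subst_var, Function.comp_apply]

open Classical in
/-- The renaming replacing `c` by `x`. -/
noncomputable def upd (c x : A.Var) : A.Var → A.Var := Function.update id c x

theorem upd_self {c x : A.Var} : upd c x c = x := by simp [upd]

theorem upd_of_ne {c x a : A.Var} (h : a ≠ c) : upd c x a = a := by simp [upd, h]

theorem upd_entry (NA : Nice TA) {X : PreCtx A} {U : SortE A} (hU : Derivable TA (.sort X U))
    {c x : A.Var} (hc : ∀ p ∈ X, p.1 ≠ c) :
    U.subst (fun a => .var (upd c x a)) = U := by
  refine SortE.subst_eq_self U fun v hv => ?_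
  obtain ⟨p, hp, rfl⟩ := List.mem_map.1 (hU.scoped NA v hv)
  rw [upd_of_ne (hc p hp)]

theorem upd_entry_mem (NA : Nice TA) {X : PreCtx A} (hX : Derivable TA (.ctx X))
    {c x : A.Var} (hc : ∀ p ∈ X, p.1 ≠ c) {p : A.Var × SortE A} (hp : p ∈ X) :
    (upd c x p.1, p.2.subst fun a => .var (upd c x a)) = p := by
  rw [upd_of_ne (hc p hp), upd_entry NA (hX.sort_mem NA hp) hc]

theorem upd_spec (NA : Nice TA) {X : PreCtx A} {U : SortE A} (hU : Derivable TA (.sort X U))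
    {c x : A.Var} (hc : ∀ p ∈ X, p.1 ≠ c) {p : A.Var × SortE A} (hp : p ∈ X ++ [(c, U)]) :
    (upd c x p.1, p.2.subst fun a => .var (upd c x a)) ∈ X ++ [(x, U)] := by
  rcases List.mem_append.1 hp with hp | hp
  · rw [upd_entry_mem NA (Derivable.ctx hU) hc hp]
    exact List.mem_append_left _ hp
  · rw [List.mem_singleton.1 hp, upd_self, upd_entry NA hU hc]
    simp

theorem ren_id {X : PreCtx A} : Ren id X X := by
  intro p hp
  rw [show (p.2.subst fun a => Expr.var (id a)) = p.2 from SortE.subst_id p.2]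
  exact hp

theorem tctx_nodup {X : PreCtx A} {Y : PreCtx B} (hX : (X.map Prod.fst).Nodup)
    (hY : (Y.map Prod.fst).Nodup) : ((tctx TA TB X Y).map Prod.fst).Nodup := by
  rw [tctx_fst]
  exact hX.product hY

theorem length_tctx {X : PreCtx A} {Y : PreCtx B} :
    (tctx TA TB X Y).length = X.length * Y.length := length_prodMap

theorem getElem_tctx {X : PreCtx A} {Y : PreCtx B} {i j : ℕ} (hi : i < X.length)
    (hj : j < Y.length) (h : i * Y.length + j < (tctx TA TB X Y).length) :
    (tctx TA TB X Y)[i * Y.length + j] =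
      ((X[i].1, Y[j].1), tso TA TB X Y X[i] Y[j]) := getElem_prodMap i j hi hj h

theorem exists_index {k m n : ℕ} (h : k < m * n) : ∃ i, i < m ∧ ∃ j, j < n ∧ k = i * n + j := by
  have hn : 0 < n := Nat.pos_of_ne_zero fun e => by simp [e] at h
  exact ⟨k / n, Nat.div_lt_of_lt_mul (by rwa [Nat.mul_comm]), k % n, Nat.mod_lt _ hn, by
    rw [Nat.mul_comm, Nat.div_add_mod]⟩

theorem mem_tctx_take {X : PreCtx A} {Y : PreCtx B} {i j k : ℕ} (hi : i < X.length)
    (hj : j < Y.length) (hk : i * Y.length + j < k) :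
    ((X[i].1, Y[j].1), tso TA TB X Y X[i] Y[j]) ∈ (tctx TA TB X Y).take k := by
  have h : i * Y.length + j < (tctx TA TB X Y).length := by
    rw [length_tctx]; exact lex_lt hi hj
  rw [← getElem_tctx hi hj h]
  exact List.mem_take_iff_getElem.2 ⟨_, by omega, rfl⟩

end

section

variable {A B : Alphabet}
variable {TA : Set (Judg A)} {TB : Set (Judg B)}
variable {chA : PreCtx A → A.Var} {chB : PreCtx B → B.Var} {h n m : ℕ}
variable {X : PreCtx A} {Y : PreCtx B} {u u' : Expr A} {v v' : Expr B} {U U' : SortE A}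
  {V V' : SortE B}

theorem tctx_snoc_dropLast {x : A.Var} {y : B.Var} {r : (A.tensor B).Var × SortE (A.tensor B)}
    (hr : r ∈ (tctx TA TB (X ++ [(x, U)]) (Y ++ [(y, V)])).dropLast) :
    ∃ p ∈ X ++ [(x, U)], ∃ q ∈ Y ++ [(y, V)], (p ∈ X ∨ p = (x, U) ∧ q ∈ Y) ∧
      r = ((p.1, q.1), tso TA TB (X ++ [(x, U)]) (Y ++ [(y, V)]) p q) := by
  rw [tctx, dropLast_prodMap] at hr
  rcases List.mem_append.1 hr with hr | hr
  · obtain ⟨p, hp, q, hq, rfl⟩ := mem_prodMap.1 hr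
    exact ⟨p, List.mem_append_left _ hp, q, hq, .inl hp, rfl⟩
  · obtain ⟨q, hq, rfl⟩ := List.mem_map.1 hr
    exact ⟨(x, U), by simp, q, List.mem_append_left _ hq, .inr ⟨rfl, hq⟩, rfl⟩

theorem subOK_take (H : HDer TA TB chA chB h) (hX : Derivable TA (.ctx X))
    (hY : Derivable TB (.ctx Y)) {i j : ℕ} (hi : i < X.length) (hj : j < Y.length)
    {a : A.Var} {b : B.Var} (ha : ∀ p ∈ X.take i, p.1 ≠ a) (hb : ∀ p ∈ Y.take j, p.1 ≠ b)
    (hZ : Derivable (tensorAx TA TB chA chB) (.ctx ((tctx TA TB X Y).take (i * Y.length + j)))) :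
    SubOK (tensorAx TA TB chA chB) ((tctx TA TB X Y).take (i * Y.length + j))
      (renV (upd a X[i].1) (upd b Y[j].1))
      (tctx TA TB (X.take i ++ [(a, X[i].2)]) (Y.take j ++ [(b, Y[j].2)])).dropLast := by
  have NA := H.NA
  have NB := H.NB
  have sX := hX.sort_of_ctx i hi
  have sY := hY.sort_of_ctx j hj
  have cX := Derivable.snoc NA sX ha
  have cY := Derivable.snoc NB sY hb
  have hf : Ren (upd a X[i].1) (X.take i ++ [(a, X[i].2)]) X := fun p hp => by
    have := upd_spec NA sX ha (x := X[i].1) hp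
    rw [Prod.mk.eta, List.take_append_getElem] at this
    exact List.take_subset _ _ this
  have hg : Ren (upd b Y[j].1) (Y.take j ++ [(b, Y[j].2)]) Y := fun p hp => by
    have := upd_spec NB sY hb (x := Y[j].1) hp
    rw [Prod.mk.eta, List.take_append_getElem] at this
    exact List.take_subset _ _ this
  refine ⟨hZ, fun r hr => ?_⟩
  obtain ⟨p, hp, q, hq, hpq, rfl⟩ := tctx_snoc_dropLast hr
  rw [tso_ren NA NB hX hY cX cY hf hg hp hq]
  refine Derivable.var H.NT hZ (p := ((upd a X[i].1 p.1, upd b Y[j].1 q.1), tso TA TB X Y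
    (upd a X[i].1 p.1, p.2.subst fun c => .var (upd a X[i].1 c))
    (upd b Y[j].1 q.1, q.2.subst fun c => .var (upd b Y[j].1 c)))) ?_
  have key : ∃ i', ∃ hi' : i' < X.length, ∃ j', ∃ hj' : j' < Y.length,
      (upd a X[i].1 p.1, p.2.subst fun c => .var (upd a X[i].1 c)) = X[i'] ∧
      (upd b Y[j].1 q.1, q.2.subst fun c => .var (upd b Y[j].1 c)) = Y[j'] ∧
      i' * Y.length + j' < i * Y.length + j := by
    rcases hpq with hp | ⟨rfl, hq⟩
    · obtain ⟨i', hi', rfl⟩ := List.mem_take_iff_getElem.1 hp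
      have e2 : ∃ j', ∃ hj' : j' < Y.length, 
          (upd b Y[j].1 q.1, q.2.subst fun c => .var (upd b Y[j].1 c)) = Y[j'] := by
        obtain ⟨j', hj', e⟩ := List.getElem_of_mem (hg q hq)
        exact ⟨j', hj', e.symm⟩
      obtain ⟨j', hj', e⟩ := e2
      refine ⟨i', by omega, j', hj', upd_entry_mem NA (Derivable.ctx sX) ha hp, e, ?_⟩
      have : (i' + 1) * Y.length ≤ i * Y.length := Nat.mul_le_mul_right _ (by omega)
      rw [Nat.add_mul] at this
      omega
    · obtain ⟨j', hj', rfl⟩ := List.mem_take_iff_getElem.1 hq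
      refine ⟨i, hi, j', by omega, ?_, upd_entry_mem NB (Derivable.ctx sY) hb hq, by omega⟩
      rw [upd_self, upd_entry NA sX ha]
  obtain ⟨i', hi', j', hj', e1, e2, hlt⟩ := key
  rw [e1, e2, (Prod.mk.inj e1).1, (Prod.mk.inj e2).1]
  exact mem_tctx_take hi' hj' hlt

theorem HDer.ctx_take (H : HDer TA TB chA chB h) (hX : Derivable TA (.ctx X))
    (hY : Derivable TB (.ctx Y)) (aX : CtxAt TA n X) (aY : CtxAt TB m Y) (hnm : n * m ≤ h)
    (k : ℕ) (hk : k ≤ (tctx TA TB X Y).length) :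
    Derivable (tensorAx TA TB chA chB) (.ctx ((tctx TA TB X Y).take k)) := by
  have NA := H.NA
  have NB := H.NB
  induction k with
  | zero => exact .of_step (by simpa using Step.ctx_nil)
  | succ k ih =>
    have hk' := ih (by omega)
    obtain ⟨i, hi, j, hj, rfl⟩ := exists_index (by rwa [length_tctx] at hk :
      k < X.length * Y.length)
    have sX := hX.sort_of_ctx i hi
    have sY := hY.sort_of_ctx j hj
    have ha := H.freshA (X.take i)
    have hb := H.freshB (Y.take j)
    have h1 := (H.der (aX i hi) (aY j hj) hnm
      ((TJudg.ss_iff NA NB H.freshA H.freshB sX sY).2 rfl)).substSort H.NT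
      (subOK_take H hX hY hi hj ha hb hk')
    rw [← List.take_append_getElem (by omega), ← Prod.mk.eta (p := (tctx TA TB X Y)[_])]
    have cX := Derivable.snoc NA sX ha
    have cY := Derivable.snoc NB sY hb
    have hf : Ren (upd (chA (X.take i)) X[i].1) (X.take i ++ [(chA (X.take i), X[i].2)]) X :=
        fun p hp => by
      have := upd_spec NA sX ha (x := X[i].1) hp
      rw [Prod.mk.eta, List.take_append_getElem] at this
      exact List.take_subset _ _ this
    have hg : Ren (upd (chB (Y.take j)) Y[j].1) (Y.take j ++ [(chB (Y.take j), Y[j].2)]) Y :=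
        fun p hp => by
      have := upd_spec NB sY hb (x := Y[j].1) hp
      rw [Prod.mk.eta, List.take_append_getElem] at this
      exact List.take_subset _ _ this
    rw [tsoF, tso_ren NA NB hX hY cX cY hf hg (by simp) (by simp), upd_self, upd_self,
      upd_entry NA sX ha, upd_entry NB sY hb] at h1
    refine Derivable.snoc H.NT (by rw [getElem_tctx hi hj]; exact h1) fun p hp e => ?_
    have hnd := tctx_nodup (TA := TA) (TB := TB) hX.nodup hY.nodup
    obtain ⟨l, hl, rfl⟩ := List.mem_take_iff_getElem.1 hp
    have := nodup_getElem_inj hnd (i := l) (j := i * Y.length + j)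
      (by simp only [List.length_map]; omega) (by simp only [List.length_map]; omega)
      (by simpa using e)
    omega

theorem HDer.ctx (H : HDer TA TB chA chB h) (hX : Derivable TA (.ctx X))
    (hY : Derivable TB (.ctx Y)) (aX : CtxAt TA n X) (aY : CtxAt TB m Y) (hnm : n * m ≤ h) :
    Derivable (tensorAx TA TB chA chB) (.ctx (tctx TA TB X Y)) := by
  simpa using H.ctx_take hX hY aX aY hnm _ le_rfl

end

section

variable {A B : Alphabet}
variable {TA : Set (Judg A)} {TB : Set (Judg B)}
variable {chA : PreCtx A → A.Var} {chB : PreCtx B → B.Var} {h n m : ℕ}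
variable {X : PreCtx A} {Y Y' : PreCtx B} {u u' : Expr A} {v v' b : Expr B} {U U' : SortE A}
  {V V' : SortE B} {c : A.Var}

theorem prodMap_map_right {α β β' γ : Type} {F : α → β' → γ} (g : β → β') {as : List α}
    {bs : List β} : prodMap F as (bs.map g) = prodMap (fun a b => F a (g b)) as bs := by
  simpa using prodMap_map (F := F) (id : α → α) g (as := as) (bs := bs)

theorem prodMap_map_left {α α' β γ : Type} {F : α' → β → γ} (f : α → α') {as : List α}
    {bs : List β} : prodMap F (as.map f) bs = prodMap (fun a b => F (f a) b) as bs := by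
  simpa using prodMap_map (F := F) f (id : β → β) (as := as) (bs := bs)

theorem rhoL_of_mem {x : A.Var} {y : B.Var} (hy : y ∈ Y.map Prod.fst) :
    rhoL TA TB X Y u x (x, y) = ct TA TB X Y u (.var y) := if_pos ⟨rfl, hy⟩

theorem rhoL_of_ne {x : A.Var} {z : (A.tensor B).Var} (hz : z.1 ≠ x) :
    rhoL TA TB X Y u x z = .var z := if_neg fun hh => hz hh.1

theorem ct_rhoL (NA : Nice TA) (NB : Nice TB) {a : Expr A} (ha : DerTerm TA X a)
    (hb : DerTerm TB Y b) (hc : ∀ p ∈ X, p.1 ≠ c) :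
    (ct TA TB X Y a b).subst (rhoL TA TB X Y' u c) = ct TA TB X Y a b := by
  refine Expr.subst_eq_self _ fun z hz => ?_
  obtain ⟨p, hp, hpz⟩ := List.mem_map.1 ((CT.of_der NA NB ha hb).scoped hz).1
  exact rhoL_of_ne (hpz ▸ hc p hp)

/-- The tensor of `u`, regarded as a term of sort `U`, with `b`. -/
noncomputable def nc (TA : Set (Judg A)) (TB : Set (Judg B)) (c : A.Var) (X : PreCtx A)
    (Y : PreCtx B) (u : Expr A) (U : SortE A) (b : Expr B) : Expr (A.tensor B) :=
  (ct TA TB (X ++ [(c, U)]) Y (.var c) b).subst (rhoL TA TB X Y u c)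

theorem nc_var (NA : Nice TA) (NB : Nice TB) {y : B.Var} (hy : y ∈ Y.map Prod.fst) :
    nc TA TB c X Y u U (.var y) = ct TA TB X Y u (.var y) := by
  rw [nc, ct_vv NA NB (by simp) hy, Expr.subst_var, rhoL_of_mem hy]

theorem nc_app (NA : Nice TA) (NB : Nice TB) (hU : Derivable TA (.sort X U))
    (hc : ∀ p ∈ X, p.1 ≠ c) {t : B.TermSym} {ts : List (Expr B)}
    (hb : DerTerm TB Y (.app t ts)) :
    nc TA TB c X Y u U (.app t ts) = .app (Sum.inl (U.head, t))
      (prodMap (ct TA TB X Y) U.args ts ++ ts.map (nc TA TB c X Y u U)) := by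
  have hX1 := Derivable.snoc NA hU hc
  have hm : (c, U) ∈ X ++ [(c, U)] := by simp
  rw [nc, ct_va (S := U.head) (ss := U.args) NA NB ⟨_, .var NA hX1 hm⟩ hb (.of_mem hm),
    Expr.subst_app, List.map_append, map_prodMap, List.map_map]
  congr 2
  refine prodMap_congr fun a ha b hb' => ?_
  have ha := hU.sort_arg NA ha
  have hb := hb.arg NB hb'
  rw [← ct_mono NA NB hX1 hb.ctx (List.subset_append_left _ _) (List.Subset.refl _) ha hb,
    ct_rhoL NA NB ha hb hc]

theorem DerTerm.var_mem (NB : Nice TB) {y : B.Var} (hy : DerTerm TB Y (.var y)) :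
    y ∈ Y.map Prod.fst := by
  obtain ⟨U, hU⟩ := hy
  exact (hU.scoped NB).1 y (occurs_var_iff.2 rfl)

theorem nc_ren (NA : Nice TA) (NB : Nice TB) (hU : Derivable TA (.sort X U))
    (hc : ∀ p ∈ X, p.1 ≠ c) (hu : DerTerm TA X u) {g : B.Var → B.Var}
    (hY' : Derivable TB (.ctx Y')) (hg : Ren g Y Y') (hb : DerTerm TB Y b) :
    (nc TA TB c X Y u U b).subst (renV id g) =
      nc TA TB c X Y' u U (b.subst fun a => .var (g a)) := by
  have hX : Derivable TA (.ctx X) := Derivable.ctx hU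
  have hok : SubOK TB Y' (fun a => .var (g a)) Y :=
    ⟨hY', fun q hq => Derivable.var NB hY' (hg q hq)⟩
  have hid : (fun a : A.Var => Expr.var (id a)) = .var := rfl
  induction b using Expr.induct with
  | hv y =>
    have hy := hb.var_mem NB
    have hb' := hb.subst NB hok
    rw [Expr.subst_var] at hb'
    have hy' := hb'.var_mem NB
    rw [nc_var NA NB hy, ct_ren NA NB hX hY' ren_id hg hu hb, hid, Expr.subst_id,
      Expr.subst_var, nc_var NA NB hy']
  | ha t ts ih =>
    have hb' := hb.subst NB hok
    rw [Expr.subst_app] at hb' ⊢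
    rw [nc_app NA NB hU hc hb, nc_app NA NB hU hc hb', Expr.subst_app, List.map_append,
      map_prodMap, prodMap_map_right, List.map_map, List.map_map]
    congr 2
    · refine prodMap_congr fun a ha b hb' => ?_
      rw [ct_ren NA NB hX hY' ren_id hg (hU.sort_arg NA ha) (hb.arg NB hb'), hid, Expr.subst_id]
    · exact List.map_congr_left fun b hb' => ih b hb' (hb.arg NB hb')

theorem nc_mono (NA : Nice TA) (NB : Nice TB) (hU : Derivable TA (.sort X U))
    (hc : ∀ p ∈ X, p.1 ≠ c) (hu : DerTerm TA X u)
    (hY' : Derivable TB (.ctx Y')) (hs : Y ⊆ Y') (hb : DerTerm TB Y b) :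
    nc TA TB c X Y u U b = nc TA TB c X Y' u U b := by
  have := nc_ren NA NB hU hc hu hY' (g := id)
    (fun q hq => by simpa [SortE.subst_id] using hs hq) hb
  simpa only [show (fun a : B.Var => (Expr.var (id a) : Expr B)) = .var from rfl,
    show renV (A := A) (B := B) id id = .var from rfl, Expr.subst_id] using this

theorem nc_canon (NA : Nice TA) (NB : Nice TB) (hc : ∀ p ∈ X, p.1 ≠ c) (hu : DerTerm TA X u)
    (hC : CanonSort TA X u U) (hb : DerTerm TB Y b) :
    nc TA TB c X Y u U b = ct TA TB X Y u b := by
  induction b using Expr.induct with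
  | hv y => exact nc_var NA NB (hb.var_mem NB)
  | ha t ts ih =>
    have hU := (hu.canon NA hC).sort_of_term
    rw [nc_app NA NB hU hc hb, ct_va NA NB hu hb hC]
    congr 2
    exact List.map_congr_left fun b hb' => ih b hb' (hb.arg NB hb')

/-- The sort of `u ⊗ y`, where `u` is regarded as a term of sort `U`. -/
noncomputable def tsN (TA : Set (Judg A)) (TB : Set (Judg B)) (c : A.Var) (X : PreCtx A)
    (Y : PreCtx B) (u : Expr A) (U : SortE A) (q : B.Var × SortE B) : SortE (A.tensor B) :=
  ⟨(U.head, q.2.head), prodMap (ct TA TB X Y) U.args (q.2.args ++ [.var q.1]) ++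
    q.2.args.map (nc TA TB c X Y u U)⟩

theorem tso_rhoL (NA : Nice TA) (NB : Nice TB) (hU : Derivable TA (.sort X U))
    (hc : ∀ p ∈ X, p.1 ≠ c) (hu : DerTerm TA X u) (hY' : Derivable TB (.ctx Y'))
    (hs : Y ⊆ Y') {q : B.Var × SortE B} (hq : q ∈ Y') (hqY : Derivable TB (.sort Y q.2)) :
    (tso TA TB (X ++ [(c, U)]) Y' (c, U) q).subst (rhoL TA TB X Y u c) =
      tsN TA TB c X Y' u U q := by
  have hX1 := Derivable.snoc NA hU hc
  have hm : (c, U) ∈ X ++ [(c, U)] := by simp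
  rw [tso, tsN, SortE.subst]
  simp only [List.map_append, map_prodMap, List.map_map]
  congr 2
  · refine prodMap_congr fun a ha b hb => ?_
    have ha := hU.sort_arg NA ha
    have hb : DerTerm TB Y' b := by
      rcases List.mem_append.1 hb with hb | hb
      · exact (hqY.sort_arg NB hb).weaken NB hY' hs
      · rw [List.mem_singleton.1 hb]
        exact ⟨_, Derivable.var NB hY' hq⟩
    rw [← ct_mono NA NB hX1 hb.ctx (List.subset_append_left _ _) (List.Subset.refl _) ha hb,
      ct_rhoL NA NB ha hb hc]
  · refine List.map_congr_left fun b hb => ?_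
    have hb := hqY.sort_arg NB hb
    rw [← nc_mono NA NB hU hc hu hY' hs hb, Function.comp, nc,
      ct_mono NA NB hX1 hY' (List.Subset.refl _) hs ⟨_, .var NA hX1 hm⟩ hb]

theorem tso_rhoL_of_mem (NA : Nice TA) (NB : Nice TB) (hU : Derivable TA (.sort X U))
    (hc : ∀ p ∈ X, p.1 ≠ c) (hY : Derivable TB (.ctx Y)) {p : A.Var × SortE A}
    {q : B.Var × SortE B} (hp : p ∈ X) (hq : q ∈ Y) :
    (tso TA TB (X ++ [(c, U)]) Y p q).subst (rhoL TA TB X Y u c) = tso TA TB X Y p q := by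
  have hX : Derivable TA (.ctx X) := Derivable.ctx hU
  rw [← tso_mono NA NB hX hY (Derivable.snoc NA hU hc) hY (List.subset_append_left _ _)
    (List.Subset.refl _) hp hq]
  rw [tso, SortE.subst]
  simp only [List.map_append, map_prodMap, List.map_map]
  have sX := hX.sort_mem NA hp
  have sY := hY.sort_mem NB hq
  congr 2
  · refine prodMap_congr fun a ha b hb => ct_rhoL NA NB (sX.sort_arg NA ha) ?_ hc
    rcases List.mem_append.1 hb with hb | hb
    · exact sY.sort_arg NB hb
    · rw [List.mem_singleton.1 hb]
      exact ⟨_, Derivable.var NB hY hq⟩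
  · exact List.map_congr_left fun b hb =>
      ct_rhoL NA NB ⟨_, .var NA hX hp⟩ (sY.sort_arg NB hb) hc

theorem tsN_ren (NA : Nice TA) (NB : Nice TB) (hU : Derivable TA (.sort X U))
    (hc : ∀ p ∈ X, p.1 ≠ c) (hu : DerTerm TA X u) {g : B.Var → B.Var}
    (hY : Derivable TB (.ctx Y)) (hY' : Derivable TB (.ctx Y')) (hg : Ren g Y Y')
    {q : B.Var × SortE B} (hq : q ∈ Y) :
    (tsN TA TB c X Y u U q).subst (renV id g) =
      tsN TA TB c X Y' u U (g q.1, q.2.subst fun a => .var (g a)) := by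
  have hX : Derivable TA (.ctx X) := Derivable.ctx hU
  have sY := hY.sort_mem NB hq
  have hid : (fun a : A.Var => Expr.var (id a)) = .var := rfl
  rw [tsN, tsN, SortE.subst]
  simp only [List.map_append, map_prodMap, List.map_map, SortE.subst]
  congr 2
  · rw [show (List.map (Expr.subst fun a => .var (g a)) q.2.args ++ [.var (g q.1)]) =
      (q.2.args ++ [Expr.var q.1]).map (Expr.subst fun a => .var (g a)) by simp [Expr.subst_var],
      prodMap_map_right]
    refine prodMap_congr fun a ha b hb => ?_
    have hb : DerTerm TB Y b := by
      rcases List.mem_append.1 hb with hb | hb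
      · exact sY.sort_arg NB hb
      · rw [List.mem_singleton.1 hb]
        exact ⟨_, Derivable.var NB hY hq⟩
    rw [ct_ren NA NB hX hY' ren_id hg (hU.sort_arg NA ha) hb, hid, Expr.subst_id]
  · exact List.map_congr_left fun b hb => nc_ren NA NB hU hc hu hY' hg (sY.sort_arg NB hb)

end

section

variable {A B : Alphabet}
variable {TA : Set (Judg A)} {TB : Set (Judg B)}
variable {chA : PreCtx A → A.Var} {chB : PreCtx B → B.Var} {h n m : ℕ}
variable {X X' : PreCtx A} {Y Y' : PreCtx B} {u u' a : Expr A} {v v' b : Expr B} {U U' : SortE A}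
  {V V' : SortE B} {c : B.Var}

theorem rhoR_of_mem {x : A.Var} {y : B.Var} (hx : x ∈ X.map Prod.fst) :
    rhoR TA TB X Y v y (x, y) = ct TA TB X Y (.var x) v := if_pos ⟨hx, rfl⟩

theorem rhoR_of_ne {y : B.Var} {z : (A.tensor B).Var} (hz : z.2 ≠ y) :
    rhoR TA TB X Y v y z = .var z := if_neg fun hh => hz hh.2

theorem ct_rhoR (NA : Nice TA) (NB : Nice TB) {X' : PreCtx A} (ha : DerTerm TA X a)
    (hb : DerTerm TB Y b) (hc : ∀ p ∈ Y, p.1 ≠ c) :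
    (ct TA TB X Y a b).subst (rhoR TA TB X' Y v c) = ct TA TB X Y a b := by
  refine Expr.subst_eq_self _ fun z hz => ?_
  obtain ⟨p, hp, hpz⟩ := List.mem_map.1 ((CT.of_der NA NB ha hb).scoped hz).2
  exact rhoR_of_ne (hpz ▸ hc p hp)

/-- The tensor of `a` with `v`, regarded as a term of sort `V`. -/
noncomputable def ncR (TA : Set (Judg A)) (TB : Set (Judg B)) (c : B.Var) (X : PreCtx A)
    (Y : PreCtx B) (v : Expr B) (V : SortE B) (a : Expr A) : Expr (A.tensor B) :=
  (ct TA TB X (Y ++ [(c, V)]) a (.var c)).subst (rhoR TA TB X Y v c)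

theorem ncR_var (NA : Nice TA) (NB : Nice TB) {x : A.Var} (hx : x ∈ X.map Prod.fst) :
    ncR TA TB c X Y v V (.var x) = ct TA TB X Y (.var x) v := by
  rw [ncR, ct_vv NA NB hx (by simp), Expr.subst_var, rhoR_of_mem hx]

theorem prodMap_snoc {α β γ : Type} {F : α → β → γ} {as : List α} {bs : List β} {b : β} :
    prodMap F as (bs ++ [b]) = as.flatMap fun a => bs.map (F a) ++ [F a b] := by
  simp [prodMap]

theorem flatMap_snoc_congr {α β γ : Type} {F G : α → β → γ} {f g : α → γ} {as : List α}
    {bs : List β} (h : ∀ a ∈ as, (∀ b ∈ bs, F a b = G a b) ∧ f a = g a) :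
    (as.flatMap fun a => bs.map (F a) ++ [f a]) = as.flatMap fun a => bs.map (G a) ++ [g a] := by
  rw [List.flatMap_def, List.flatMap_def]
  congr 1
  exact List.map_congr_left fun a ha => by
    rw [(h a ha).2, List.map_congr_left (h a ha).1]

theorem map_flatMap_snoc {α β γ δ : Type} {F : α → β → γ} {f : α → γ} {as : List α}
    {bs : List β} (σ : γ → δ) : (as.flatMap fun a => bs.map (F a) ++ [f a]).map σ =
      as.flatMap fun a => bs.map (fun b => σ (F a b)) ++ [σ (f a)] := by
  simp [List.map_flatMap, Function.comp_def]

theorem ncR_app (NA : Nice TA) (NB : Nice TB) (hV : Derivable TB (.sort Y V))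
    (hc : ∀ p ∈ Y, p.1 ≠ c) {s : A.TermSym} {us : List (Expr A)}
    (ha : DerTerm TA X (.app s us)) :
    ncR TA TB c X Y v V (.app s us) = .app (Sum.inr (s, V.head))
      (us.flatMap fun a => V.args.map (ct TA TB X Y a) ++ [ncR TA TB c X Y v V a]) := by
  have hY1 := Derivable.snoc NB hV hc
  have hm : (c, V) ∈ Y ++ [(c, V)] := by simp
  rw [ncR, ct_av (T := V.head) (ts := V.args) NA NB ha hY1 hm,
    Expr.subst_app, prodMap_snoc, map_flatMap_snoc]
  congr 1
  refine flatMap_snoc_congr fun a ha' => ⟨fun b hb => ?_, rfl⟩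
  have ha := ha.arg NA ha'
  have hb := hV.sort_arg NB hb
  rw [← ct_mono NA NB ha.ctx hY1 (List.Subset.refl _) (List.subset_append_left _ _) ha hb,
    ct_rhoR NA NB ha hb hc]

theorem ncR_ren (NA : Nice TA) (NB : Nice TB) (hV : Derivable TB (.sort Y V))
    (hc : ∀ p ∈ Y, p.1 ≠ c) (hv : DerTerm TB Y v) {f : A.Var → A.Var}
    (hX' : Derivable TA (.ctx X')) (hf : Ren f X X') (ha : DerTerm TA X a) :
    (ncR TA TB c X Y v V a).subst (renV f id) =
      ncR TA TB c X' Y v V (a.subst fun a => .var (f a)) := by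
  have hY : Derivable TB (.ctx Y) := Derivable.ctx hV
  have hok : SubOK TA X' (fun a => .var (f a)) X :=
    ⟨hX', fun q hq => Derivable.var NA hX' (hf q hq)⟩
  have hid : (fun a : B.Var => Expr.var (id a)) = .var := rfl
  induction a using Expr.induct with
  | hv y =>
    have hb' := ha.subst NA hok
    rw [Expr.subst_var] at hb'
    rw [ncR_var NA NB (ha.var_mem NA), ct_ren NA NB hX' hY hf ren_id ha hv, hid, Expr.subst_id,
      Expr.subst_var, ncR_var NA NB (hb'.var_mem NA)]
  | ha t ts ih =>
    have hb' := ha.subst NA hok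
    rw [Expr.subst_app] at hb' ⊢
    rw [ncR_app NA NB hV hc ha, ncR_app NA NB hV hc hb', Expr.subst_app, map_flatMap_snoc,
      List.flatMap_map]
    congr 1
    refine flatMap_snoc_congr fun a ha' => ⟨fun b hb => ?_, ih a ha' (ha.arg NA ha')⟩
    rw [ct_ren NA NB hX' hY hf ren_id (ha.arg NA ha') (hV.sort_arg NB hb), hid, Expr.subst_id]

theorem ncR_mono (NA : Nice TA) (NB : Nice TB) (hV : Derivable TB (.sort Y V))
    (hc : ∀ p ∈ Y, p.1 ≠ c) (hv : DerTerm TB Y v)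
    (hX' : Derivable TA (.ctx X')) (hs : X ⊆ X') (ha : DerTerm TA X a) :
    ncR TA TB c X Y v V a = ncR TA TB c X' Y v V a := by
  have := ncR_ren NA NB hV hc hv hX' (f := id)
    (fun q hq => by simpa [SortE.subst_id] using hs hq) ha
  simpa only [show (fun a : A.Var => (Expr.var (id a) : Expr A)) = .var from rfl,
    show renV (A := A) (B := B) id id = .var from rfl, Expr.subst_id] using this

theorem ncR_var_right (NA : Nice TA) (NB : Nice TB) {y : B.Var} (hc : ∀ p ∈ Y, p.1 ≠ c)
    (hY : Derivable TB (.ctx Y)) (hC : (y, V) ∈ Y) (ha : DerTerm TA X a) :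
    ncR TA TB c X Y (.var y) V a = ct TA TB X Y a (.var y) := by
  induction a using Expr.induct with
  | hv x => exact ncR_var NA NB (ha.var_mem NA)
  | ha s us ih =>
    have hV := hY.sort_mem NB hC
    rw [ncR_app NA NB hV hc ha, ct_av (T := V.head) (ts := V.args) NA NB ha hY hC, prodMap_snoc]
    congr 1
    exact flatMap_snoc_congr fun a ha' => ⟨fun b hb => rfl, ih a ha' (ha.arg NA ha')⟩

/-- The sort of `x ⊗ v`, where `v` is regarded as a term of sort `V`. -/
noncomputable def tsNR (TA : Set (Judg A)) (TB : Set (Judg B)) (c : B.Var) (X : PreCtx A)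
    (Y : PreCtx B) (v : Expr B) (V : SortE B) (p : A.Var × SortE A) : SortE (A.tensor B) :=
  ⟨(p.2.head, V.head),
    (p.2.args.flatMap fun a => V.args.map (ct TA TB X Y a) ++ [ncR TA TB c X Y v V a]) ++
      V.args.map (ct TA TB X Y (.var p.1))⟩

theorem tso_rhoR (NA : Nice TA) (NB : Nice TB) (hV : Derivable TB (.sort Y V))
    (hc : ∀ p ∈ Y, p.1 ≠ c) (hv : DerTerm TB Y v) (hX' : Derivable TA (.ctx X'))
    (hs : X ⊆ X') {p : A.Var × SortE A} (hp : p ∈ X') (hpX : Derivable TA (.sort X p.2)) :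
    (tso TA TB X' (Y ++ [(c, V)]) p (c, V)).subst (rhoR TA TB X Y v c) =
      tsNR TA TB c X' Y v V p := by
  have hY : Derivable TB (.ctx Y) := Derivable.ctx hV
  have hY1 := Derivable.snoc NB hV hc
  have hm : (c, V) ∈ Y ++ [(c, V)] := by simp
  rw [tso, tsNR, SortE.subst, prodMap_snoc, List.map_append, map_flatMap_snoc, List.map_map]
  have fix : ∀ a b, DerTerm TA X' a → DerTerm TB Y b →
      (ct TA TB X' (Y ++ [(c, V)]) a b).subst (rhoR TA TB X Y v c) = ct TA TB X' Y a b :=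
    fun a b ha hb => by
      rw [← ct_mono NA NB hX' hY1 (List.Subset.refl _) (List.subset_append_left _ _) ha hb,
        ct_rhoR NA NB ha hb hc]
  congr 2
  · refine flatMap_snoc_congr fun a ha => ⟨fun b hb => ?_, ?_⟩
    · exact fix a b ((hpX.sort_arg NA ha).weaken NA hX' hs) (hV.sort_arg NB hb)
    · have ha := hpX.sort_arg NA ha
      rw [← ncR_mono NA NB hV hc hv hX' hs ha, ncR,
        ct_mono NA NB hX' hY1 hs (List.Subset.refl _) ha ⟨_, .var NB hY1 hm⟩]
  · exact List.map_congr_left fun b hb => fix _ b ⟨_, .var NA hX' hp⟩ (hV.sort_arg NB hb)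

theorem tso_rhoR_of_mem (NA : Nice TA) (NB : Nice TB) (hV : Derivable TB (.sort Y V))
    (hc : ∀ p ∈ Y, p.1 ≠ c) (hX : Derivable TA (.ctx X)) {p : A.Var × SortE A}
    {q : B.Var × SortE B} (hp : p ∈ X) (hq : q ∈ Y) :
    (tso TA TB X (Y ++ [(c, V)]) p q).subst (rhoR TA TB X Y v c) = tso TA TB X Y p q := by
  have hY : Derivable TB (.ctx Y) := Derivable.ctx hV
  rw [← tso_mono NA NB hX hY hX (Derivable.snoc NB hV hc) (List.Subset.refl _)
    (List.subset_append_left _ _) hp hq]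
  rw [tso, SortE.subst]
  simp only [List.map_append, map_prodMap, List.map_map]
  have sX := hX.sort_mem NA hp
  have sY := hY.sort_mem NB hq
  congr 2
  · refine prodMap_congr fun a ha b hb => ct_rhoR NA NB (sX.sort_arg NA ha) ?_ hc
    rcases List.mem_append.1 hb with hb | hb
    · exact sY.sort_arg NB hb
    · rw [List.mem_singleton.1 hb]
      exact ⟨_, Derivable.var NB hY hq⟩
  · exact List.map_congr_left fun b hb =>
      ct_rhoR NA NB ⟨_, .var NA hX hp⟩ (sY.sort_arg NB hb) hc

theorem tsNR_ren (NA : Nice TA) (NB : Nice TB) (hV : Derivable TB (.sort Y V))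
    (hc : ∀ p ∈ Y, p.1 ≠ c) (hv : DerTerm TB Y v) {f : A.Var → A.Var}
    (hX : Derivable TA (.ctx X)) (hX' : Derivable TA (.ctx X')) (hf : Ren f X X')
    {p : A.Var × SortE A} (hp : p ∈ X) :
    (tsNR TA TB c X Y v V p).subst (renV f id) =
      tsNR TA TB c X' Y v V (f p.1, p.2.subst fun a => .var (f a)) := by
  have hY : Derivable TB (.ctx Y) := Derivable.ctx hV
  have sX := hX.sort_mem NA hp
  have hid : (fun a : B.Var => Expr.var (id a)) = .var := rfl
  have ren : ∀ a b, DerTerm TA X a → DerTerm TB Y b → (ct TA TB X Y a b).subst (renV f id) =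
      ct TA TB X' Y (a.subst fun a => .var (f a)) b := fun a b ha hb => by
    rw [ct_ren NA NB hX' hY hf ren_id ha hb, hid, Expr.subst_id]
  rw [tsNR, tsNR, SortE.subst, List.map_append, map_flatMap_snoc, List.map_map]
  simp only [SortE.subst, List.flatMap_map]
  congr 2
  · exact flatMap_snoc_congr fun a ha => ⟨fun b hb => ren a b (sX.sort_arg NA ha)
      (hV.sort_arg NB hb), ncR_ren NA NB hV hc hv hX' hf (sX.sort_arg NA ha)⟩
  · refine List.map_congr_left fun b hb => ?_
    rw [Function.comp, ren _ b ⟨_, .var NA hX hp⟩ (hV.sort_arg NB hb), Expr.subst_var]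

end

section

variable {A B : Alphabet}
variable {TA : Set (Judg A)} {TB : Set (Judg B)}
variable {chA : PreCtx A → A.Var} {chB : PreCtx B → B.Var} {h n m : ℕ}
variable {X X' : PreCtx A} {Y Y' : PreCtx B} {u u' a : Expr A} {v v' b : Expr B} {U U' : SortE A}
  {V V' : SortE B}

theorem ren_upd (NA : Nice TA) (hX : Derivable TA (.ctx X)) {i : ℕ} (hi : i < X.length)
    {c : A.Var} (hc : ∀ p ∈ X.take i, p.1 ≠ c) :
    Ren (upd c X[i].1) (X.take i ++ [(c, X[i].2)]) X := fun p hp => by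
  have := upd_spec NA (hX.sort_of_ctx i hi) hc (x := X[i].1) hp
  rw [Prod.mk.eta, List.take_append_getElem] at this
  exact List.take_subset _ _ this

theorem HDer.subOK_ren (H : HDer TA TB chA chB h) (hX : Derivable TA (.ctx X))
    (hX' : Derivable TA (.ctx X')) (hY : Derivable TB (.ctx Y)) (hY' : Derivable TB (.ctx Y'))
    {f : A.Var → A.Var} {g : B.Var → B.Var} (hf : Ren f X X') (hg : Ren g Y Y')
    (hZ : Derivable (tensorAx TA TB chA chB) (.ctx (tctx TA TB X' Y'))) :
    SubOK (tensorAx TA TB chA chB) (tctx TA TB X' Y') (renV f g) (tctx TA TB X Y) := by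
  refine ⟨hZ, fun r hr => ?_⟩
  obtain ⟨p, hp, q, hq, rfl⟩ := mem_tctx.1 hr
  rw [tso_ren H.NA H.NB hX' hY' hX hY hf hg hp hq]
  exact Derivable.var H.NT hZ (mem_tctx.2 ⟨_, hf p hp, _, hg q hq, rfl⟩)

theorem HDer.ctx_of_term_left (H : HDer TA TB chA chB h) (hu : DerAt TA n (.term X u U))
    (hY : Derivable TB (.ctx Y)) (aY : CtxAt TB m Y) (hnm : n * m ≤ h) :
    Derivable (tensorAx TA TB chA chB) (.ctx (tctx TA TB X Y)) := by
  obtain ⟨k, hk, hs⟩ := hu.sort_of_term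
  obtain ⟨l, hl, aX⟩ := hs.ctxAt_of_sort
  exact H.ctx (Derivable.ctx hu.derivable) hY aX aY
    ((Nat.mul_le_mul_right m (by omega : l ≤ n)).trans hnm)

theorem HDer.ctx_of_term_right (H : HDer TA TB chA chB h) (hX : Derivable TA (.ctx X))
    (aX : CtxAt TA n X) (hv : DerAt TB m (.term Y v V)) (hnm : n * m ≤ h) :
    Derivable (tensorAx TA TB chA chB) (.ctx (tctx TA TB X Y)) := by
  obtain ⟨k, hk, hs⟩ := hv.sort_of_term
  obtain ⟨l, hl, aY⟩ := hs.ctxAt_of_sort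
  exact H.ctx hX (Derivable.ctx hv.derivable) aX aY
    ((Nat.mul_le_mul_left n (by omega : l ≤ m)).trans hnm)

theorem HDer.term_left (H : HDer TA TB chA chB h) (hu : DerAt TA n (.term X u U))
    (hY : Derivable TB (.ctx Y)) (aY : CtxAt TB m Y) (hnm : n * m ≤ h)
    {q : B.Var × SortE B} (hq : q ∈ Y) :
    Derivable (tensorAx TA TB chA chB) (.term (tctx TA TB X Y) (ct TA TB X Y u (.var q.1))
      (tsN TA TB (chA X) X Y u U q)) := by
  obtain ⟨j, hj, rfl⟩ := List.getElem_of_mem hq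
  have NA := H.NA
  have NB := H.NB
  have hZ := H.ctx_of_term_left hu hY aY hnm
  have hU := hu.derivable.sort_of_term
  have hX : Derivable TA (.ctx X) := Derivable.ctx hU
  have sY := hY.sort_of_ctx j hj
  have hb := H.freshB (Y.take j)
  have hY1 := Derivable.snoc NB sY hb
  have hg := ren_upd NB hY hj hb
  have hm : (chB (Y.take j), Y[j].2) ∈ Y.take j ++ [(chB (Y.take j), Y[j].2)] := by simp
  have hu' : DerTerm TA X u := ⟨_, hu.derivable⟩
  have h1 := (H.der hu (aY j hj) hnm
    ((TJudg.ts_iff NA NB H.freshA H.freshB hu.derivable sY).2 rfl)).substTerm H.NT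
    (H.subOK_ren hX hX hY1 hY ren_id hg hZ)
  rw [tsoF, tso_rhoL NA NB hU (H.freshA X) hu' hY1 (List.subset_append_left _ _) hm sY,
    tsN_ren NA NB hU (H.freshA X) hu' hY1 hY hg hm, upd_self, upd_entry NB sY hb,
    ct_ren NA NB hX hY ren_id hg hu' ⟨_, .var NB hY1 hm⟩, Expr.subst_var, upd_self] at h1
  simpa only [show (fun a : A.Var => (Expr.var (id a) : Expr A)) = .var from rfl,
    Expr.subst_id] using h1

theorem HDer.term_right (H : HDer TA TB chA chB h) (hX : Derivable TA (.ctx X))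
    (aX : CtxAt TA n X) (hv : DerAt TB m (.term Y v V)) (hnm : n * m ≤ h)
    {p : A.Var × SortE A} (hp : p ∈ X) :
    Derivable (tensorAx TA TB chA chB) (.term (tctx TA TB X Y) (ct TA TB X Y (.var p.1) v)
      (tsNR TA TB (chB Y) X Y v V p)) := by
  obtain ⟨i, hi, rfl⟩ := List.getElem_of_mem hp
  have NA := H.NA
  have NB := H.NB
  have hZ := H.ctx_of_term_right hX aX hv hnm
  have hV := hv.derivable.sort_of_term
  have hY : Derivable TB (.ctx Y) := Derivable.ctx hV
  have sX := hX.sort_of_ctx i hi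
  have ha := H.freshA (X.take i)
  have hX1 := Derivable.snoc NA sX ha
  have hf := ren_upd NA hX hi ha
  have hm : (chA (X.take i), X[i].2) ∈ X.take i ++ [(chA (X.take i), X[i].2)] := by simp
  have hv' : DerTerm TB Y v := ⟨_, hv.derivable⟩
  have h1 := (H.der (aX i hi) hv hnm
    ((TJudg.st_iff NA NB H.freshA H.freshB sX hv.derivable).2 rfl)).substTerm H.NT
    (H.subOK_ren hX1 hX hY hY hf ren_id hZ)
  rw [tsoF, tso_rhoR NA NB hV (H.freshB Y) hv' hX1 (List.subset_append_left _ _) hm sX,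
    tsNR_ren NA NB hV (H.freshB Y) hv' hX1 hX hf hm, upd_self, upd_entry NA sX ha,
    ct_ren NA NB hX hY hf ren_id ⟨_, .var NA hX1 hm⟩ hv', Expr.subst_var, upd_self] at h1
  simpa only [show (fun a : B.Var => (Expr.var (id a) : Expr B)) = .var from rfl,
    Expr.subst_id] using h1

theorem HDer.subOK_rhoL (H : HDer TA TB chA chB h) (hu : DerAt TA n (.term X u U))
    (hY : Derivable TB (.ctx Y)) (aY : CtxAt TB m Y) (hnm : n * m ≤ h) :
    SubOK (tensorAx TA TB chA chB) (tctx TA TB X Y) (rhoL TA TB X Y u (chA X))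
      (tctx TA TB (X ++ [(chA X, U)]) Y) := by
  have hZ := H.ctx_of_term_left hu hY aY hnm
  have hU := hu.derivable.sort_of_term
  refine ⟨hZ, fun r hr => ?_⟩
  obtain ⟨p, hp, q, hq, rfl⟩ := mem_tctx.1 hr
  rcases List.mem_append.1 hp with hp | hp
  · rw [tso_rhoL_of_mem H.NA H.NB hU (H.freshA X) hY hp hq, rhoL_of_ne (H.freshA X p hp)]
    exact Derivable.var H.NT hZ (mem_tctx.2 ⟨_, hp, _, hq, rfl⟩)
  · obtain rfl := List.mem_singleton.1 hp
    rw [tso_rhoL H.NA H.NB hU (H.freshA X) ⟨_, hu.derivable⟩ hY (List.Subset.refl _) hq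
      (hY.sort_mem H.NB hq), rhoL_of_mem (List.mem_map_of_mem hq)]
    exact H.term_left hu hY aY hnm hq

theorem HDer.subOK_rhoR (H : HDer TA TB chA chB h) (hX : Derivable TA (.ctx X))
    (aX : CtxAt TA n X) (hv : DerAt TB m (.term Y v V)) (hnm : n * m ≤ h) :
    SubOK (tensorAx TA TB chA chB) (tctx TA TB X Y) (rhoR TA TB X Y v (chB Y))
      (tctx TA TB X (Y ++ [(chB Y, V)])) := by
  have hZ := H.ctx_of_term_right hX aX hv hnm
  have hV := hv.derivable.sort_of_term
  refine ⟨hZ, fun r hr => ?_⟩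
  obtain ⟨p, hp, q, hq, rfl⟩ := mem_tctx.1 hr
  rcases List.mem_append.1 hq with hq | hq
  · rw [tso_rhoR_of_mem H.NA H.NB hV (H.freshB Y) hX hp hq, rhoR_of_ne (H.freshB Y q hq)]
    exact Derivable.var H.NT hZ (mem_tctx.2 ⟨_, hp, _, hq, rfl⟩)
  · obtain rfl := List.mem_singleton.1 hq
    rw [tso_rhoR H.NA H.NB hV (H.freshB Y) ⟨_, hv.derivable⟩ hX (List.Subset.refl _) hp
      (hX.sort_mem H.NA hp), rhoR_of_mem (List.mem_map_of_mem hp)]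
    exact H.term_right hX aX hv hnm hp

theorem HDer.termEq_left (H : HDer TA TB chA chB h) (hu : DerAt TA n (.termEq X u u' U))
    (hut : DerAt TA n (.term X u U))
    (hY : Derivable TB (.ctx Y)) (aY : CtxAt TB m Y) (hnm : n * m ≤ h)
    {q : B.Var × SortE B} (hq : q ∈ Y) :
    DerTermEq (tensorAx TA TB chA chB) (tctx TA TB X Y) (ct TA TB X Y u (.var q.1))
      (ct TA TB X Y u' (.var q.1)) := by
  obtain ⟨j, hj, rfl⟩ := List.getElem_of_mem hq
  have NA := H.NA
  have NB := H.NB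
  have hZ := H.ctx_of_term_left hut hY aY hnm
  have hX : Derivable TA (.ctx X) := Derivable.ctx hu.derivable
  have sY := hY.sort_of_ctx j hj
  have hb := H.freshB (Y.take j)
  have hY1 := Derivable.snoc NB sY hb
  have hg := ren_upd NB hY hj hb
  have hm : (chB (Y.take j), Y[j].2) ∈ Y.take j ++ [(chB (Y.take j), Y[j].2)] := by simp
  have hu1 : DerTerm TA X u := ⟨_, hu.derivable.term_of_termEq.1⟩
  have hu2 : DerTerm TA X u' := ⟨_, hu.derivable.term_of_termEq.2⟩
  obtain ⟨W, hW⟩ := TJudg.exists_teqs NA NB H.freshA H.freshB hu.derivable sY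
  have h1 := (H.der hu (aY j hj) hnm hW).substTermEq H.NT
    (H.subOK_ren hX hX hY1 hY ren_id hg hZ)
  rw [ct_ren NA NB hX hY ren_id hg hu1 ⟨_, .var NB hY1 hm⟩,
    ct_ren NA NB hX hY ren_id hg hu2 ⟨_, .var NB hY1 hm⟩, Expr.subst_var, upd_self] at h1
  exact ⟨_, by simpa only [show (fun a : A.Var => (Expr.var (id a) : Expr A)) = .var from rfl,
    Expr.subst_id] using h1⟩

theorem HDer.termEq_right (H : HDer TA TB chA chB h) (hX : Derivable TA (.ctx X))
    (aX : CtxAt TA n X) (hv : DerAt TB m (.termEq Y v v' V)) (hvt : DerAt TB m (.term Y v V))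
    (hnm : n * m ≤ h) {p : A.Var × SortE A} (hp : p ∈ X) :
    DerTermEq (tensorAx TA TB chA chB) (tctx TA TB X Y) (ct TA TB X Y (.var p.1) v)
      (ct TA TB X Y (.var p.1) v') := by
  obtain ⟨i, hi, rfl⟩ := List.getElem_of_mem hp
  have NA := H.NA
  have NB := H.NB
  have hZ := H.ctx_of_term_right hX aX hvt hnm
  have hY : Derivable TB (.ctx Y) := Derivable.ctx hv.derivable
  have sX := hX.sort_of_ctx i hi
  have ha := H.freshA (X.take i)
  have hX1 := Derivable.snoc NA sX ha
  have hf := ren_upd NA hX hi ha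
  have hm : (chA (X.take i), X[i].2) ∈ X.take i ++ [(chA (X.take i), X[i].2)] := by simp
  have hv1 : DerTerm TB Y v := ⟨_, hv.derivable.term_of_termEq.1⟩
  have hv2 : DerTerm TB Y v' := ⟨_, hv.derivable.term_of_termEq.2⟩
  obtain ⟨W, hW⟩ := TJudg.exists_steq NA NB H.freshA H.freshB sX hv.derivable
  have h1 := (H.der (aX i hi) hv hnm hW).substTermEq H.NT
    (H.subOK_ren hX1 hX hY hY hf ren_id hZ)
  rw [ct_ren NA NB hX hY hf ren_id ⟨_, .var NA hX1 hm⟩ hv1,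
    ct_ren NA NB hX hY hf ren_id ⟨_, .var NA hX1 hm⟩ hv2, Expr.subst_var, upd_self] at h1
  exact ⟨_, by simpa only [show (fun a : B.Var => (Expr.var (id a) : Expr B)) = .var from rfl,
    Expr.subst_id] using h1⟩

/-- `v` is a term of height at most `m` over some initial segment of `Y`. -/
def TmAt (TB : Set (Judg B)) (m : ℕ) (Y : PreCtx B) (v : Expr B) : Prop :=
  ∃ l V, DerAt TB m (.term (Y.take l) v V)

theorem TmAt.derTerm (NB : Nice TB) (hY : Derivable TB (.ctx Y)) (h : TmAt TB m Y v) :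
    DerTerm TB Y v := by
  obtain ⟨l, V, h⟩ := h
  exact DerTerm.weaken NB ⟨V, h.derivable⟩ hY (List.take_subset _ _)

theorem TmAt.arg (NB : Nice TB) {t : B.TermSym} {ts : List (Expr B)}
    (h : TmAt TB m Y (.app t ts)) (hb : b ∈ ts) : TmAt TB m Y b := by
  obtain ⟨l, V, h⟩ := h
  obtain ⟨W, k, hk, h⟩ := h.term_arg NB hb
  exact ⟨l, W, h.mono hk.le⟩

theorem TmAt.entry_arg (NB : Nice TB) (aY : CtxAt TB m Y) {q : B.Var × SortE B} (hq : q ∈ Y)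
    (hb : b ∈ q.2.args) : TmAt TB m Y b := by
  obtain ⟨j, hj, rfl⟩ := List.getElem_of_mem hq
  obtain ⟨W, k, hk, h⟩ := (aY j hj).sort_arg NB hb
  exact ⟨j, W, h.mono hk.le⟩

theorem ctxAt_of_term (h : DerAt TB m (.term Y v V)) : CtxAt TB m Y := by
  obtain ⟨k, hk, hs⟩ := h.sort_of_term
  obtain ⟨l, hl, aY⟩ := hs.ctxAt_of_sort
  exact aY.mono (by omega)

theorem HDer.weakenEq (H : HDer TA TB chA chB h) (hX : Derivable TA (.ctx X))
    (hX' : Derivable TA (.ctx X')) (hY : Derivable TB (.ctx Y)) (hY' : Derivable TB (.ctx Y'))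
    (sX : X ⊆ X') (sY : Y ⊆ Y')
    (hZ : Derivable (tensorAx TA TB chA chB) (.ctx (tctx TA TB X' Y')))
    {e e' : Expr (A.tensor B)}
    (he : DerTermEq (tensorAx TA TB chA chB) (tctx TA TB X Y) e e') :
    DerTermEq (tensorAx TA TB chA chB) (tctx TA TB X' Y') e e' := by
  have := he.subst H.NT (SubOK.of_subset H.NT hZ (Γ := tctx TA TB X Y) fun r hr => by
    obtain ⟨p, hp, q, hq, rfl⟩ := mem_tctx.1 hr
    rw [tso_mono H.NA H.NB hX hY hX' hY' sX sY hp hq]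
    exact mem_tctx.2 ⟨p, sX hp, q, sY hq, rfl⟩)
  simpa only [Expr.subst_id] using this

theorem HDer.nc_eq (H : HDer TA TB chA chB h) (hu : DerAt TA n (.term X u U))
    (hY : Derivable TB (.ctx Y)) (aY : CtxAt TB m Y) (hnm : n * m ≤ h) (hv : TmAt TB m Y v) :
    DerTermEq (tensorAx TA TB chA chB) (tctx TA TB X Y) (ct TA TB X Y u v)
      (nc TA TB (chA X) X Y u U v) := by
  have NA := H.NA
  have NB := H.NB
  have hZ := H.ctx_of_term_left hu hY aY hnm
  have hu' : DerTerm TA X u := ⟨_, hu.derivable⟩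
  have hX := hu'.ctx
  have hU := hu.derivable.sort_of_term
  obtain ⟨l, V, hv⟩ := hv
  have hv' : DerTerm TB (Y.take l) v := ⟨_, hv.derivable⟩
  obtain ⟨C, hC⟩ := hu'.exists_canon NA
  obtain ⟨hu1, hCU⟩ := hu.canon NA hC
  obtain ⟨W, hW⟩ := TJudg.exists_seqt NA NB H.freshA H.freshB hCU.derivable hv.derivable
  have h1 : DerTermEq (tensorAx TA TB chA chB) (tctx TA TB X (Y.take l))
      (nc TA TB (chA X) X (Y.take l) u C v) (nc TA TB (chA X) X (Y.take l) u U v) :=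
    ⟨_, (H.der hCU hv hnm hW).substTermEq H.NT
      (H.subOK_rhoL hu1 hv'.ctx (ctxAt_of_term hv) hnm)⟩
  rw [nc_canon NA NB (H.freshA X) hu' hC hv',
    nc_mono NA NB hU (H.freshA X) hu' hY (List.take_subset _ _) hv',
    ct_mono NA NB hX hY (List.Subset.refl _) (List.take_subset _ _) hu' hv'] at h1
  exact H.weakenEq hX hX hv'.ctx hY (List.Subset.refl _) (List.take_subset _ _) hZ h1

theorem HDer.ncR_eq (H : HDer TA TB chA chB h) (hX : Derivable TA (.ctx X))
    (aX : CtxAt TA n X) (hv : DerAt TB m (.term Y v V)) (hnm : n * m ≤ h) (hu : TmAt TA n X u) :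
    DerTermEq (tensorAx TA TB chA chB) (tctx TA TB X Y) (ct TA TB X Y u v)
      (ncR TA TB (chB Y) X Y v V u) := by
  have NA := H.NA
  have NB := H.NB
  have hZ := H.ctx_of_term_right hX aX hv hnm
  have hv' : DerTerm TB Y v := ⟨_, hv.derivable⟩
  have hY := hv'.ctx
  have hV := hv.derivable.sort_of_term
  obtain ⟨l, U, hu⟩ := hu
  have hu' : DerTerm TA (X.take l) u := ⟨_, hu.derivable⟩
  obtain ⟨C, hC⟩ := hv'.exists_canon NB
  obtain ⟨hv1, hCV⟩ := hv.canon NB hC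
  obtain ⟨W, hW⟩ := TJudg.exists_tseq NA NB H.freshA H.freshB hu.derivable hCV.derivable
  have h1 : DerTermEq (tensorAx TA TB chA chB) (tctx TA TB (X.take l) Y)
      (ncR TA TB (chB Y) (X.take l) Y v C u) (ncR TA TB (chB Y) (X.take l) Y v V u) :=
    ⟨_, (H.der hu hCV hnm hW).substTermEq H.NT
      (H.subOK_rhoR hu'.ctx (ctxAt_of_term hu) hv1 hnm)⟩
  have h2 : DerTermEq (tensorAx TA TB chA chB) (tctx TA TB (X.take l) Y)
      (ct TA TB (X.take l) Y u v) (ncR TA TB (chB Y) (X.take l) Y v C u) := by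
    cases v with
    | var y =>
      rw [ncR_var_right NA NB (H.freshB Y) hY hC.var_mem hu'] at h1 ⊢
      exact h1.left.refl
    | app t ts =>
      cases u with
      | var x =>
        rw [ncR_var NA NB (hu'.var_mem NA)] at h1 ⊢
        exact h1.left.refl
      | app s us =>
        obtain ⟨D, hD⟩ := hu'.exists_canon NA
        obtain ⟨W', hW'⟩ := TJudg.exists_tt NA NB H.freshA H.freshB hu' hD hv' hC (H.freshB Y)
        exact ⟨_, H.der (hu.canon NA hD).1 hv1 hnm hW'⟩
  have h3 := h2.trans H.NT h1
  rw [ncR_mono NA NB hV (H.freshB Y) hv' hX (List.take_subset _ _) hu',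
    ct_mono NA NB hX hY (List.take_subset _ _) (List.Subset.refl _) hu' hv'] at h3
  exact H.weakenEq hu'.ctx hX hY hY (List.take_subset _ _) (List.Subset.refl _) hZ h3

end

section

variable {A B : Alphabet}
variable {TA : Set (Judg A)} {TB : Set (Judg B)}
variable {chA : PreCtx A → A.Var} {chB : PreCtx B → B.Var} {h n m : ℕ}
variable {X X' : PreCtx A} {Y Y' : PreCtx B} {u u' a : Expr A} {v v' b : Expr B} {U U' : SortE A}
  {V V' : SortE B}

theorem mem_prodMap_of {α β γ : Type} {F : α → β → γ} {as : List α} {bs : List β} {a : α} {b : β}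
    (ha : a ∈ as) (hb : b ∈ bs) : F a b ∈ prodMap F as bs :=
  mem_prodMap.2 ⟨a, ha, b, hb, rfl⟩

theorem TmAt.canon_arg (NA : Nice TA) (hX : Derivable TA (.ctx X)) (hu : TmAt TA n X u)
    (hC : CanonSort TA X u U) (ha : a ∈ U.args) : TmAt TA n X a := by
  obtain ⟨l, W, hu⟩ := hu
  obtain ⟨C, hC'⟩ := DerTerm.exists_canon NA ⟨_, hu.derivable⟩
  obtain rfl := CanonSort.unique NA hX.nodup hC (hC'.mono (List.take_subset l X))
  obtain ⟨k, hk, hs⟩ := (hu.canon NA hC').1.sort_of_term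
  obtain ⟨W', k', hk', hs⟩ := hs.sort_arg NA ha
  exact ⟨l, W', hs.mono (by omega)⟩

/-- `v` is either a variable of `Y` or a term derivable at stage `m` in an initial segment
of `Y`. -/
def TmOrVar (TB : Set (Judg B)) (m : ℕ) (Y : PreCtx B) (v : Expr B) : Prop :=
  TmAt TB m Y v ∨ ∃ q ∈ Y, v = .var q.1

theorem TmOrVar.of_mem {q : B.Var × SortE B} (hq : q ∈ Y) : TmOrVar TB m Y (.var q.1) :=
  .inr ⟨q, hq, rfl⟩

theorem TmOrVar.derTerm (NB : Nice TB) (hY : Derivable TB (.ctx Y)) (h : TmOrVar TB m Y v) :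
    DerTerm TB Y v := by
  obtain h | ⟨q, hq, rfl⟩ := h
  · exact h.derTerm NB hY
  · exact ⟨_, .var NB hY hq⟩

theorem TmOrVar.arg (NB : Nice TB) {t : B.TermSym} {ts : List (Expr B)}
    (h : TmOrVar TB m Y (.app t ts)) (hb : b ∈ ts) : TmOrVar TB m Y b := by
  obtain h | ⟨q, hq, h⟩ := h
  · exact .inl (h.arg NB hb)
  · cases h

theorem TmOrVar.entry_arg (NB : Nice TB) (aY : CtxAt TB m Y) {q : B.Var × SortE B} (hq : q ∈ Y)
    (hb : b ∈ q.2.args) : TmOrVar TB m Y b := .inl (.entry_arg NB aY hq hb)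

theorem TmOrVar.canon_arg (NA : Nice TA) (hX : Derivable TA (.ctx X)) (aX : CtxAt TA n X)
    (hu : TmOrVar TA n X u) (hC : CanonSort TA X u U) (ha : a ∈ U.args) : TmOrVar TA n X a := by
  obtain hu | ⟨q, hq, rfl⟩ := hu
  · exact .inl (hu.canon_arg NA hX hC ha)
  · exact .entry_arg NA aX hC.var_mem ha

theorem HDer.nc_eq_of_var (H : HDer TA TB chA chB h) (hu : DerAt TA n (.term X u U))
    (hY : Derivable TB (.ctx Y)) (aY : CtxAt TB m Y) (hnm : n * m ≤ h) (hv : TmOrVar TB m Y v) :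
    DerTermEq (tensorAx TA TB chA chB) (tctx TA TB X Y) (ct TA TB X Y u v)
      (nc TA TB (chA X) X Y u U v) := by
  obtain hv | ⟨q, hq, rfl⟩ := hv
  · exact H.nc_eq hu hY aY hnm hv
  · rw [nc_var H.NA H.NB (List.mem_map_of_mem hq)]
    exact DerTerm.refl ⟨_, H.term_left hu hY aY hnm hq⟩

theorem HDer.ncR_eq_of_var (H : HDer TA TB chA chB h) (hX : Derivable TA (.ctx X))
    (aX : CtxAt TA n X) (hv : DerAt TB m (.term Y v V)) (hnm : n * m ≤ h)
    (hu : TmOrVar TA n X u) :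
    DerTermEq (tensorAx TA TB chA chB) (tctx TA TB X Y) (ct TA TB X Y u v)
      (ncR TA TB (chB Y) X Y v V u) := by
  obtain hu | ⟨q, hq, rfl⟩ := hu
  · exact H.ncR_eq hX aX hv hnm hu
  · rw [ncR_var H.NA H.NB (List.mem_map_of_mem hq)]
    exact DerTerm.refl ⟨_, H.term_right hX aX hv hnm hq⟩

theorem HDer.subst_left (H : HDer TA TB chA chB h) {Ac : PreCtx A} {φ : A.Var → Expr A}
    {σ : (A.tensor B).Var → Expr (A.tensor B)} (hX : Derivable TA (.ctx X))
    (hY : Derivable TB (.ctx Y)) (aY : CtxAt TB m Y) (hnm : n * m ≤ h)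
    (hAc : Derivable TA (.ctx Ac))
    (hφ : ∀ p ∈ Ac, DerAt TA n (.term X (φ p.1) (p.2.subst φ)))
    (hσ : ∀ x y, σ (x, y) = ct TA TB X Y (φ x) (.var y))
    (hu : DerTerm TA Ac u) (hv : TmOrVar TB m Y v)
    (h1 : DerTerm (tensorAx TA TB chA chB) (tctx TA TB X Y) ((ct TA TB Ac Y u v).subst σ))
    (h2 : DerTerm (tensorAx TA TB chA chB) (tctx TA TB X Y) (ct TA TB X Y (u.subst φ) v)) :
    DerTermEq (tensorAx TA TB chA chB) (tctx TA TB X Y) ((ct TA TB Ac Y u v).subst σ)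
      (ct TA TB X Y (u.subst φ) v) := by
  have NA := H.NA
  have NB := H.NB
  have NT := H.NT
  have hφ' : SubOK TA X φ Ac := ⟨hX, fun p hp => (hφ p hp).derivable⟩
  have hct := CT.of_der NA NB hu (hv.derTerm NB hY)
  generalize ct TA TB Ac Y u v = e at hct h1
  replace h2 := id h2
  induction hct with
  | vv hx hy =>
    rw [Expr.subst_var φ] at h2 ⊢
    rw [Expr.subst_var, hσ] at h1 ⊢
    exact h1.refl
  | @va u S ss t ts M hC hM hMu ihM ihu =>
    have hss : ∀ a ∈ ss, DerTerm TA Ac a := fun a ha =>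
      (hu.canon NA hC).sort_of_term.sort_arg NA ha
    have hv' := hv.derTerm NB hY
    cases u with
    | var x =>
      have hx := hφ _ hC.var_mem
      have hx' : DerTerm TA X (φ x) := ⟨_, hx.derivable⟩
      have e := H.nc_eq_of_var hx hY aY hnm hv
      rw [Expr.subst_var φ] at h2 ihu ⊢
      refine DerTermEq.trans NT ?_ e.symm
      have e2 := e.right
      rw [nc_app NA NB hx.derivable.sort_of_term (H.freshA X) hv'] at e2 ⊢
      rw [Expr.subst_app] at h1 ⊢
      refine DerTerm.app_congr NT h1 e2 ?_
      rw [List.map_append, map_prodMap, List.map_map]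
      refine forall₂_append ?_ (forall₂_map_map fun b hb => ?_)
      · change List.Forall₂ _ _ (prodMap _ (ss.map _) ts)
        rw [prodMap_map_left]
        refine forall₂_prodMap fun a ha b hb => ?_
        refine ihM a ha b hb (hss a ha) (hv.arg NB hb) (h1.arg NT ?_) (e2.arg NT ?_)
        · exact List.mem_map_of_mem (List.mem_append_left _ (mem_prodMap_of ha hb))
        · exact List.mem_append_left _ (mem_prodMap_of (List.mem_map_of_mem ha) hb)
      · have e3 := H.nc_eq_of_var hx hY aY hnm (hv.arg NB hb)
        refine DerTermEq.trans NT (ihu b hb hu (hv.arg NB hb) (h1.arg NT ?_) e3.left) e3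
        exact List.mem_map_of_mem (List.mem_append_right _ (List.mem_map_of_mem hb))
    | app s us =>
      have hu' := hu.subst NA hφ'
      have hC' := CanonSort.subst (Y := X) NA hu hC φ
      rw [Expr.subst_app φ] at hu' h2 ⊢ ihu
      change CanonSort TA X _ ⟨S, ss.map _⟩ at hC'
      rw [ct_va NA NB hu' hv' hC'] at h2 ⊢
      rw [Expr.subst_app] at h1 ⊢
      refine DerTerm.app_congr NT h1 h2 ?_
      rw [List.map_append, map_prodMap, List.map_map]
      refine forall₂_append ?_ (forall₂_map_map fun b hb => ?_)
      · rw [prodMap_map_left]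
        refine forall₂_prodMap fun a ha b hb => ?_
        refine ihM a ha b hb (hss a ha) (hv.arg NB hb) (h1.arg NT ?_) (h2.arg NT ?_)
        · exact List.mem_map_of_mem (List.mem_append_left _ (mem_prodMap_of ha hb))
        · exact List.mem_append_left _ (mem_prodMap_of (List.mem_map_of_mem ha) hb)
      · refine ihu b hb hu (hv.arg NB hb) (h1.arg NT ?_) (h2.arg NT ?_)
        · exact List.mem_map_of_mem (List.mem_append_right _ (List.mem_map_of_mem hb))
        · exact List.mem_append_right _ (List.mem_map_of_mem hb)
  | @av s us y T ts M hC hM hMy ihM ihy =>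
    have hm := hC.var_mem
    have hu' := hu.subst NA hφ'
    rw [Expr.subst_app φ] at hu' h2 ⊢
    rw [ct_av NA NB hu' hY hm] at h2 ⊢
    rw [Expr.subst_app] at h1 ⊢
    refine DerTerm.app_congr NT h1 h2 ?_
    rw [map_prodMap, prodMap_map_left]
    refine forall₂_prodMap fun a ha b hb => ?_
    have k1 := h1.arg NT (List.mem_map_of_mem (mem_prodMap_of ha hb))
    have k2 := h2.arg NT (mem_prodMap_of (List.mem_map_of_mem ha) hb)
    rcases List.mem_append.1 hb with hb | hb
    · exact ihM a ha b hb (hu.arg NA ha) (hv := TmOrVar.entry_arg NB aY hm hb) k1 k2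
    · obtain rfl := List.mem_singleton.1 hb
      exact ihy a ha (hu.arg NA ha) hv k1 k2

theorem HDer.subst_right (H : HDer TA TB chA chB h) {Bc : PreCtx B} {ψ : B.Var → Expr B}
    {σ : (A.tensor B).Var → Expr (A.tensor B)} (hX : Derivable TA (.ctx X))
    (aX : CtxAt TA n X) (hY : Derivable TB (.ctx Y)) (hnm : n * m ≤ h)
    (hBc : Derivable TB (.ctx Bc))
    (hψ : ∀ q ∈ Bc, DerAt TB m (.term Y (ψ q.1) (q.2.subst ψ)))
    (hσ : ∀ x y, σ (x, y) = ct TA TB X Y (.var x) (ψ y))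
    (hu : TmOrVar TA n X u) (hv : DerTerm TB Bc v)
    (h1 : DerTerm (tensorAx TA TB chA chB) (tctx TA TB X Y) ((ct TA TB X Bc u v).subst σ))
    (h2 : DerTerm (tensorAx TA TB chA chB) (tctx TA TB X Y) (ct TA TB X Y u (v.subst ψ))) :
    DerTermEq (tensorAx TA TB chA chB) (tctx TA TB X Y) ((ct TA TB X Bc u v).subst σ)
      (ct TA TB X Y u (v.subst ψ)) := by
  have NA := H.NA
  have NB := H.NB
  have NT := H.NT
  have hψ' : SubOK TB Y ψ Bc := ⟨hY, fun p hp => (hψ p hp).derivable⟩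
  have hct := CT.of_der NA NB (hu.derTerm NA hX) hv
  generalize ct TA TB X Bc u v = e at hct h1
  replace h2 := id h2
  induction hct with
  | vv hx hy =>
    rw [Expr.subst_var ψ] at h2 ⊢
    rw [Expr.subst_var, hσ] at h1 ⊢
    exact h1.refl
  | @va u S ss t ts M hC hM hMu ihM ihu =>
    have hv' := hv.subst NB hψ'
    rw [Expr.subst_app ψ] at hv' h2 ⊢
    rw [ct_va NA NB (hu.derTerm NA hX) hv' hC] at h2 ⊢
    rw [Expr.subst_app] at h1 ⊢
    refine DerTerm.app_congr NT h1 h2 ?_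
    rw [List.map_append, map_prodMap, List.map_map, List.map_map]
    refine forall₂_append ?_ (forall₂_map_map fun b hb => ?_)
    · rw [prodMap_map_right]
      refine forall₂_prodMap fun a ha b hb => ?_
      refine ihM a ha b hb (hu.canon_arg NA hX aX hC ha) (hv.arg NB hb) (h1.arg NT ?_) (h2.arg NT ?_)
      · exact List.mem_map_of_mem (List.mem_append_left _ (mem_prodMap_of ha hb))
      · exact List.mem_append_left _ (mem_prodMap_of ha (List.mem_map_of_mem hb))
    · refine ihu b hb hu (hv.arg NB hb) (h1.arg NT ?_) (h2.arg NT ?_)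
      · exact List.mem_map_of_mem (List.mem_append_right _ (List.mem_map_of_mem hb))
      · exact List.mem_append_right _ (List.mem_map_of_mem (List.mem_map_of_mem hb))
  | @av s us y T ts M hC hM hMy ihM ihy =>
    have hy := hψ _ hC.var_mem
    have hts : ∀ b ∈ ts, DerTerm TB Bc b := fun b hb =>
      (hBc.sort_mem NB hC.var_mem).sort_arg NB hb
    have e := H.ncR_eq_of_var hX aX hy hnm hu
    rw [Expr.subst_var ψ] at h2 ihy ⊢
    refine DerTermEq.trans NT ?_ e.symm
    have e2 := e.right
    rw [ncR_app NA NB hy.derivable.sort_of_term (H.freshB Y) (hu.derTerm NA hX)] at e2 ⊢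
    rw [Expr.subst_app, prodMap_snoc, map_flatMap_snoc] at h1 ⊢
    refine DerTerm.app_congr NT h1 e2 (forall₂_flatMap fun a ha => ?_)
    have e3 := H.ncR_eq_of_var hX aX hy hnm (hu.arg NA ha)
    refine forall₂_append ?_ (.cons (DerTermEq.trans NT (ihy a ha (hu.arg NA ha) hv
      (h1.arg NT ?_) e3.left) e3) .nil)
    · change List.Forall₂ _ _ (List.map _ (ts.map _))
      rw [List.map_map]
      refine forall₂_map_map fun b hb => ?_
      refine ihM a ha b hb (hu.arg NA ha) (hts b hb) (h1.arg NT ?_) (e2.arg NT ?_)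
      · exact List.mem_flatMap.2 ⟨a, ha, List.mem_append_left _ (List.mem_map.2 ⟨b, hb, rfl⟩)⟩
      · exact List.mem_flatMap.2 ⟨a, ha, List.mem_append_left _
          (List.mem_map.2 ⟨_, List.mem_map.2 ⟨b, hb, rfl⟩, rfl⟩)⟩
    · exact List.mem_flatMap.2 ⟨a, ha, List.mem_append_right _ (List.mem_singleton.2 rfl)⟩

end

section

variable {A B : Alphabet}
variable {TA : Set (Judg A)} {TB : Set (Judg B)}
variable {chA : PreCtx A → A.Var} {chB : PreCtx B → B.Var} {h n m : ℕ}
variable {X X' : PreCtx A} {Y Y' : PreCtx B} {u u' a : Expr A} {v v' b : Expr B} {U U' : SortE A}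
  {V V' : SortE B}

theorem HDer.subOK_left (H : HDer TA TB chA chB h) {Ac : PreCtx A} {φ : A.Var → Expr A}
    {σ : (A.tensor B).Var → Expr (A.tensor B)} (hX : Derivable TA (.ctx X))
    (hY : Derivable TB (.ctx Y)) (aY : CtxAt TB m Y) (hnm : n * m ≤ h)
    (hAc : Derivable TA (.ctx Ac))
    (hφ : ∀ p ∈ Ac, DerAt TA n (.term X (φ p.1) (p.2.subst φ)))
    (hσ : ∀ x y, σ (x, y) = ct TA TB X Y (φ x) (.var y))
    (hZ : Derivable (tensorAx TA TB chA chB) (.ctx (tctx TA TB X Y)))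
    (hZ' : Derivable (tensorAx TA TB chA chB) (.ctx (tctx TA TB Ac Y))) :
    SubOK (tensorAx TA TB chA chB) (tctx TA TB X Y) σ (tctx TA TB Ac Y) := by
  have NA := H.NA
  have NB := H.NB
  have NT := H.NT
  suffices hk : ∀ k, SubOK (tensorAx TA TB chA chB) (tctx TA TB X Y) σ
      ((tctx TA TB Ac Y).take k) by
    have := hk (tctx TA TB Ac Y).length
    rwa [List.take_length] at this
  intro k
  induction k with
  | zero => exact ⟨hZ, fun r hr => by simp at hr⟩
  | succ k ih =>
    refine ⟨hZ, fun r hr => ?_⟩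
    by_cases hk : k < (tctx TA TB Ac Y).length
    swap
    · rw [List.take_of_length_le (by omega)] at hr ih
      exact ih.2 r hr
    rw [← List.take_append_getElem hk, List.mem_append, List.mem_singleton] at hr
    obtain hr | rfl := hr
    · exact ih.2 r hr
    have hE := (hZ'.sort_of_ctx k hk).substSort NT ih
    obtain ⟨i, hi, j, hj, rfl⟩ := exists_index (length_tctx (TA := TA) (TB := TB) ▸ hk)
    rw [getElem_tctx hi hj] at hE ⊢
    have hp := List.getElem_mem hi
    have hq := List.getElem_mem hj
    generalize Ac[i] = p at hp hE ⊢
    generalize Y[j] = q at hq hE ⊢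
    dsimp only at hE ⊢
    rw [hσ]
    have hu := hφ p hp
    have ht := H.term_left hu hY aY hnm hq
    have hT := ht.sort_of_term
    refine .of_step (.seqt (.of_step (.s2 (Derivable.sort_congr NT hE hT ?_))) ht)
    have a1 := fun e he => hE.sort_arg NT (e := e) he
    have a2 := fun e he => hT.sort_arg NT (e := e) he
    dsimp only [tso, tsN, SortE.subst] at a1 a2 ⊢
    rw [List.map_append, map_prodMap, List.map_map] at a1 ⊢
    rw [prodMap_map_left] at a2 ⊢
    have hpA := (hAc.sort_mem NA hp)
    refine forall₂_append (forall₂_prodMap fun a ha b hb => ?_) (forall₂_map_map fun b hb => ?_)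
    · refine H.subst_left hX hY aY hnm hAc hφ hσ (hpA.sort_arg NA ha) ?_ ?_ ?_
      · rcases List.mem_append.1 hb with hb | hb
        · exact .entry_arg NB aY hq hb
        · obtain rfl := List.mem_singleton.1 hb
          exact .of_mem hq
      · exact a1 _ (List.mem_append_left _ (mem_prodMap_of ha hb))
      · exact a2 _ (List.mem_append_left _ (mem_prodMap_of ha hb))
    · have hb' : TmOrVar TB m Y b := .entry_arg NB aY hq hb
      have e := H.nc_eq_of_var hu hY aY hnm hb'
      refine DerTermEq.trans NT ?_ e
      have := H.subst_left (u := .var p.1) hX hY aY hnm hAc hφ hσ ⟨_, .var NA hAc hp⟩ hb'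
      rw [Expr.subst_var] at this
      exact this (a1 _ (List.mem_append_right _ (List.mem_map.2 ⟨b, hb, rfl⟩))) e.left

theorem HDer.subOK_right (H : HDer TA TB chA chB h) {Bc : PreCtx B} {ψ : B.Var → Expr B}
    {σ : (A.tensor B).Var → Expr (A.tensor B)} (hX : Derivable TA (.ctx X))
    (aX : CtxAt TA n X) (hY : Derivable TB (.ctx Y)) (hnm : n * m ≤ h)
    (hBc : Derivable TB (.ctx Bc))
    (hψ : ∀ q ∈ Bc, DerAt TB m (.term Y (ψ q.1) (q.2.subst ψ)))
    (hσ : ∀ x y, σ (x, y) = ct TA TB X Y (.var x) (ψ y))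
    (hZ : Derivable (tensorAx TA TB chA chB) (.ctx (tctx TA TB X Y)))
    (hZ' : Derivable (tensorAx TA TB chA chB) (.ctx (tctx TA TB X Bc))) :
    SubOK (tensorAx TA TB chA chB) (tctx TA TB X Y) σ (tctx TA TB X Bc) := by
  have NA := H.NA
  have NB := H.NB
  have NT := H.NT
  suffices hk : ∀ k, SubOK (tensorAx TA TB chA chB) (tctx TA TB X Y) σ
      ((tctx TA TB X Bc).take k) by
    have := hk (tctx TA TB X Bc).length
    rwa [List.take_length] at this
  intro k
  induction k with
  | zero => exact ⟨hZ, fun r hr => by simp at hr⟩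
  | succ k ih =>
    refine ⟨hZ, fun r hr => ?_⟩
    by_cases hk : k < (tctx TA TB X Bc).length
    swap
    · rw [List.take_of_length_le (by omega)] at hr ih
      exact ih.2 r hr
    rw [← List.take_append_getElem hk, List.mem_append, List.mem_singleton] at hr
    obtain hr | rfl := hr
    · exact ih.2 r hr
    have hE := (hZ'.sort_of_ctx k hk).substSort NT ih
    obtain ⟨i, hi, j, hj, rfl⟩ := exists_index (length_tctx (TA := TA) (TB := TB) ▸ hk)
    rw [getElem_tctx hi hj] at hE ⊢
    have hp := List.getElem_mem hi
    have hq := List.getElem_mem hj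
    generalize X[i] = p at hp hE ⊢
    generalize Bc[j] = q at hq hE ⊢
    dsimp only at hE ⊢
    rw [hσ]
    have hv := hψ q hq
    have ht := H.term_right hX aX hv hnm hp
    have hT := ht.sort_of_term
    refine .of_step (.seqt (.of_step (.s2 (Derivable.sort_congr NT hE hT ?_))) ht)
    have a1 := fun e he => hE.sort_arg NT (e := e) he
    have a2 := fun e he => hT.sort_arg NT (e := e) he
    dsimp only [tso, tsNR, SortE.subst] at a1 a2 ⊢
    rw [List.map_append, prodMap_snoc, map_flatMap_snoc, List.map_map] at a1 ⊢
    simp only [List.map_map] at a2 ⊢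
    have hqB := (hBc.sort_mem NB hq)
    refine forall₂_append (forall₂_flatMap fun a ha => ?_) (forall₂_map_map fun b hb => ?_)
    · have ha' : TmOrVar TA n X a := .entry_arg NA aX hp ha
      refine forall₂_append (forall₂_map_map fun b hb => ?_) (.cons ?_ .nil)
      · refine H.subst_right hX aX hY hnm hBc hψ hσ ha' (hqB.sort_arg NB hb) ?_ ?_
        · exact a1 _ (List.mem_append_left _ (List.mem_flatMap.2 ⟨a, ha,
            List.mem_append_left _ (List.mem_map.2 ⟨b, hb, rfl⟩)⟩))
        · exact a2 _ (List.mem_append_left _ (List.mem_flatMap.2 ⟨a, ha,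
            List.mem_append_left _ (List.mem_map.2 ⟨b, hb, rfl⟩)⟩))
      · have e := H.ncR_eq_of_var hX aX hv hnm ha'
        refine DerTermEq.trans NT ?_ e
        have := H.subst_right (v := .var q.1) hX aX hY hnm hBc hψ hσ ha' ⟨_, .var NB hBc hq⟩
        rw [Expr.subst_var] at this
        exact this (a1 _ (List.mem_append_left _ (List.mem_flatMap.2 ⟨a, ha,
            List.mem_append_right _ (List.mem_singleton.2 rfl)⟩))) e.left
    · exact H.subst_right hX aX hY hnm hBc hψ hσ (.of_mem hp) (hqB.sort_arg NB hb)
        (a1 _ (List.mem_append_right _ (List.mem_map.2 ⟨b, hb, rfl⟩)))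
        (a2 _ (List.mem_append_right _ (List.mem_map.2 ⟨b, hb, rfl⟩)))

end

section

variable {A B : Alphabet}
variable {TA : Set (Judg A)} {TB : Set (Judg B)}
variable {chA : PreCtx A → A.Var} {chB : PreCtx B → B.Var} {h n m : ℕ}
variable {X X' : PreCtx A} {Y Y' : PreCtx B} {u u' a : Expr A} {v v' b : Expr B} {U U' : SortE A}
  {V V' : SortE B}

theorem CtxEq.of_fst {A : Alphabet} {Ax : Set (Judg A)} {X Y : PreCtx A}
    (hX : Derivable Ax (.ctx X)) (hY : Derivable Ax (.ctx Y))
    (hXY : X.map Prod.fst = Y.map Prod.fst)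
    (he : ∀ i (hi : i < X.length) (hi' : i < Y.length),
      Derivable Ax (.sortEq (X.take i) X[i].2 Y[i].2)) : CtxEq Ax X Y := by
  refine ⟨by simpa using congrArg List.length hXY, hX, hY, fun i hi hi' => ?_⟩
  have key : ctxVars X = ctxVars Y := by
    simpa [ctxVars_eq_map, List.map_map, Function.comp_def] using congrArg (List.map Expr.var) hXY
  have : ctxVars (X.take i) = ctxVars (Y.take i) := by
    rw [ctxVars_eq_map, ctxVars_eq_map] at key ⊢
    rw [List.map_take, List.map_take, key]
  rw [this, SortE.substL, lookupV_ctxVars, SortE.subst_id]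
  exact he i hi hi'

theorem isMor_of_subOK {A : Alphabet} {Ax : Set (Judg A)} {Γ Δ : PreCtx A}
    {σ : A.Var → Expr A} {e : List (Expr A)} (hΓ : Derivable Ax (.ctx Γ)) (hσ : SubOK Ax Δ σ Γ)
    (hl : e.length = Γ.length)
    (he : ∀ i (hi : i < Γ.length) (hi' : i < e.length), e[i] = σ Γ[i].1) :
    IsMor Ax Δ Γ e ∧ ∀ i (hi : i < Γ.length), subPre Γ e i hi = Γ[i].2.subst σ := by
  have hsub : ∀ i (hi : i < Γ.length), subPre Γ e i hi = Γ[i].2.subst σ := fun i hi => by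
    rw [subPre_eq_subst hΓ.isPreCtx hl]
    refine SortE.subst_congr _ fun v hv => ?_
    obtain ⟨p, hp, rfl⟩ := List.mem_map.1 (hΓ.isPreCtx.scoped (List.getElem_mem hi) v hv)
    obtain ⟨k, hk, rfl⟩ := List.getElem_of_mem hp
    rw [lookupV_mkSub hΓ.nodup hk (by omega), he k hk (by omega)]
  refine ⟨⟨hσ.1, hΓ, hl, fun i hi hi' => ?_⟩, hsub⟩
  rw [hsub, he i hi hi']
  exact hσ.2 _ (List.getElem_mem hi)

theorem Derivable.derAt {A : Alphabet} {Ax : Set (Judg A)} {J : Judg A} {n : ℕ}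
    (hJ : Derivable Ax J) (hn : ht Ax J ≤ n) : DerAt Ax n J :=
  DerAt.mono hn (Nat.sInf_mem hJ)

theorem Derivable.ctxAt {A : Alphabet} {Ax : Set (Judg A)} {X : PreCtx A} {n : ℕ}
    (hX : Derivable Ax (.ctx X)) (hn : htCtx Ax X ≤ n) : CtxAt Ax n X := by
  cases X with
  | nil => intro i hi; simp at hi
  | cons p X =>
    have hne : p :: X ≠ [] := by simp
    have hs := hX.sort_of_ctx ((p :: X).length - 1) (by simp)
    rw [← List.dropLast_eq_take, ← List.getLast_eq_getElem hne] at hs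
    have hd := hs.derAt (n := n) hn
    obtain ⟨l, hl, hp⟩ := hd.ctxAt_of_sort
    have := CtxAt.append (p := (p :: X).getLast hne) (hp.mono hl.le) hd
    rwa [List.dropLast_append_getLast] at this

theorem HDer.conteq_left (H : HDer TA TB chA chB h) {x : A.Var}
    (hU : DerAt TA n (.sortEq X U U')) (hY : Derivable TB (.ctx Y)) (aY : CtxAt TB m Y)
    (hnm : n * m ≤ h) (hx : ∀ p ∈ X, p.1 ≠ x) :
    CtxEq (tensorAx TA TB chA chB) (tctx TA TB (X ++ [(x, U)]) Y)
      (tctx TA TB (X ++ [(x, U')]) Y) := by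
  have NA := H.NA
  have NB := H.NB
  obtain ⟨k, hk, s1, s2⟩ := hU.sort_of_sortEq
  obtain ⟨l, hl, aX⟩ := s1.ctxAt_of_sort
  have c1 := Derivable.snoc NA s1.derivable hx
  have c2 := Derivable.snoc NA s2.derivable hx
  have hX : Derivable TA (.ctx X) := Derivable.ctx s1.derivable
  have h1 := H.ctx c1 hY (((aX.mono hl.le).append s1).mono hk.le) aY hnm
  have h2 := H.ctx c2 hY (((aX.mono hl.le).append s2).mono hk.le) aY hnm
  refine .of_fst h1 h2 (by rw [tctx_fst, tctx_fst]; simp) fun r hr hr' => ?_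
  have hs := h1.sort_of_ctx r hr
  have hc := Derivable.ctx hs
  obtain ⟨i, hi, j, hj, rfl⟩ := exists_index (length_tctx (TA := TA) (TB := TB) ▸ hr)
  have e2 := getElem_tctx (TA := TA) (TB := TB) (X := X ++ [(x, U')]) (Y := Y) (i := i) (j := j)
    (by simpa using hi) hj hr'
  rw [e2, getElem_tctx hi hj]
  rw [getElem_tctx hi hj] at hs
  by_cases hiX : i < X.length
  · rw [List.getElem_append_left hiX] at hs ⊢
    rw [List.getElem_append_left hiX]
    have e := fun W (hW : Derivable TA (.ctx (X ++ [(x, W)]))) => tso_mono NA NB hX hY hW hY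
      (List.subset_append_left _ _) (List.Subset.refl _) (List.getElem_mem hiX) (List.getElem_mem hj)
    rw [← e _ c1] at hs ⊢
    rw [← e _ c2]
    exact .of_step (.s1 hs)
  · obtain rfl : i = X.length := by simp at hi; omega
    have sY := hY.sort_of_ctx j hj
    have ha := H.freshA X
    have hb := H.freshB (Y.take j)
    have hd := H.der hU (aY j hj) hnm
      (TJudg.seqs_of NA NB H.freshA H.freshB hU.derivable sY)
    have hσ := subOK_take (a := chA X) H c1 hY hi hj (by simpa using H.freshA X) hb hc
    simp only [List.getElem_append_right (le_refl X.length), Nat.sub_self,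
      List.getElem_cons_zero, List.take_left] at hσ ⊢
    have hd := hd.substSortEq H.NT hσ
    have hg := ren_upd NB hY hj hb
    have cY := Derivable.snoc NB sY hb
    rw [tsoF, tsoF,
      tso_ren NA NB c1 hY (.snoc NA s1.derivable ha) cY
        (fun p hp => upd_spec NA s1.derivable ha hp) hg (by simp) (by simp),
      tso_ren NA NB c2 hY (.snoc NA s2.derivable ha) cY
        (fun p hp => upd_spec NA s2.derivable ha hp) hg (by simp) (by simp),
      upd_self, upd_self, upd_entry NA s1.derivable ha, upd_entry NA s2.derivable ha,
      upd_entry NB sY hb] at hd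
    exact hd

theorem HDer.conteq_right (H : HDer TA TB chA chB h) {y : B.Var}
    (hX : Derivable TA (.ctx X)) (aX : CtxAt TA n X) (hV : DerAt TB m (.sortEq Y V V'))
    (hnm : n * m ≤ h) (hy : ∀ p ∈ Y, p.1 ≠ y) :
    CtxEq (tensorAx TA TB chA chB) (tctx TA TB X (Y ++ [(y, V)]))
      (tctx TA TB X (Y ++ [(y, V')])) := by
  have NA := H.NA
  have NB := H.NB
  obtain ⟨k, hk, s1, s2⟩ := hV.sort_of_sortEq
  obtain ⟨l, hl, aY⟩ := s1.ctxAt_of_sort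
  have c1 := Derivable.snoc NB s1.derivable hy
  have c2 := Derivable.snoc NB s2.derivable hy
  have hY : Derivable TB (.ctx Y) := Derivable.ctx s1.derivable
  have h1 := H.ctx hX c1 aX (((aY.mono hl.le).append s1).mono hk.le) hnm
  have h2 := H.ctx hX c2 aX (((aY.mono hl.le).append s2).mono hk.le) hnm
  refine .of_fst h1 h2 (by rw [tctx_fst, tctx_fst]; simp) fun r hr hr' => ?_
  have hs := h1.sort_of_ctx r hr
  have hc := Derivable.ctx hs
  obtain ⟨i, hi, j, hj, rfl⟩ := exists_index (length_tctx (TA := TA) (TB := TB) ▸ hr)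
  have e2 := getElem_tctx (TA := TA) (TB := TB) (Y := Y ++ [(y, V')]) (j := j) hi
    (by simpa using hj) (by simpa using hr')
  simp only [List.length_append, List.length_singleton] at e2 hs hc ⊢
  rw [e2]
  have e1 := getElem_tctx (TA := TA) (TB := TB) hi hj (by simpa using hr)
  simp only [List.length_append, List.length_singleton] at e1
  rw [e1] at hs ⊢
  by_cases hjY : j < Y.length
  · rw [List.getElem_append_left hjY] at hs ⊢
    rw [List.getElem_append_left hjY]
    have e := fun W (hW : Derivable TB (.ctx (Y ++ [(y, W)]))) => tso_mono NA NB hX hY hX hW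
      (List.Subset.refl _) (List.subset_append_left _ _) (List.getElem_mem hi) (List.getElem_mem hjY)
    rw [← e _ c1] at hs ⊢
    rw [← e _ c2]
    exact .of_step (.s1 hs)
  · obtain rfl : j = Y.length := by simp at hj; omega
    have sX := hX.sort_of_ctx i hi
    have ha := H.freshA (X.take i)
    have hb := H.freshB Y
    have hd := H.der (aX i hi) hV hnm
      (TJudg.sseq_of NA NB H.freshA H.freshB sX hV.derivable)
    have hσ := subOK_take (b := chB Y) H hX c1 hi hj ha (by simpa using H.freshB Y)
      (by simpa [Judg.ctxOf] using hc)
    simp only [List.getElem_append_right (le_refl Y.length), Nat.sub_self,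
      List.getElem_cons_zero, List.take_left] at hσ ⊢
    have hd := hd.substSortEq H.NT hσ
    have hf := ren_upd NA hX hi ha
    have cX := Derivable.snoc NA sX ha
    rw [tsoF, tsoF,
      tso_ren NA NB hX c1 cX (.snoc NB s1.derivable hb) hf
        (fun p hp => upd_spec NB s1.derivable hb hp) (by simp) (by simp),
      tso_ren NA NB hX c2 cX (.snoc NB s2.derivable hb) hf
        (fun p hp => upd_spec NB s2.derivable hb hp) (by simp) (by simp),
      upd_self, upd_self, upd_entry NB s1.derivable hb, upd_entry NB s2.derivable hb,
      upd_entry NA sX ha] at hd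
    simpa using hd

end

section

variable {A B : Alphabet}
variable {TA : Set (Judg A)} {TB : Set (Judg B)}
variable {chA : PreCtx A → A.Var} {chB : PreCtx B → B.Var} {h n m : ℕ}
variable {X X' : PreCtx A} {Y Y' : PreCtx B} {u u' a : Expr A} {v v' b : Expr B} {U U' : SortE A}
  {V V' : SortE B}

theorem IsMor.derAt {A : Alphabet} {Ax : Set (Judg A)} {X Y : PreCtx A} {f : List (Expr A)}
    {n : ℕ} (hf : IsMor Ax X Y f) (hn : htMor Ax X Y f ≤ n) :
    (CtxAt Ax n X ∧ CtxAt Ax n Y) ∧ ∀ i (hi : i < Y.length) (hi' : i < f.length),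
      DerAt Ax n (.term X f[i] (Y[i].2.subst (lookupV (mkSub Y f)))) := by
  obtain ⟨hX, hY, hl, hd⟩ := hf
  rw [htMor, max_le_iff, max_le_iff, Finset.sup_le_iff] at hn
  refine ⟨⟨hX.ctxAt hn.1, hY.ctxAt hn.2.1⟩, fun i hi hi' => ?_⟩
  have := hn.2.2 i (Finset.mem_range.2 hi)
  rw [dif_pos ⟨hi, hi'⟩] at this
  rw [← subPre_eq_subst hY.isPreCtx hl i hi]
  exact (hd i hi hi').derAt this

theorem IsMor.derAt_mem {A : Alphabet} {Ax : Set (Judg A)} {X Y : PreCtx A} {f : List (Expr A)}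
    {n : ℕ} (hf : IsMor Ax X Y f) (hn : htMor Ax X Y f ≤ n) :
    ∀ p ∈ Y, DerAt Ax n
      (.term X (lookupV (mkSub Y f) p.1) (p.2.subst (lookupV (mkSub Y f)))) := by
  intro p hp
  obtain ⟨i, hi, rfl⟩ := List.getElem_of_mem hp
  have hi' : i < f.length := hf.2.2.1 ▸ hi
  rw [lookupV_mkSub hf.2.1.nodup hi hi']
  exact (hf.derAt hn).2 i hi hi'

theorem HDer.isMor_left (H : HDer TA TB chA chB h) {Ac : PreCtx A} {f : List (Expr A)}
    {e : List (Expr (A.tensor B))} (hf : IsMor TA X Ac f) (hn : htMor TA X Ac f ≤ n)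
    (hY : Derivable TB (.ctx Y)) (aY : CtxAt TB m Y) (hnm : n * m ≤ h)
    (he : TMorCtx TA TB false X f Y e) :
    IsMor (tensorAx TA TB chA chB) (tctx TA TB X Y) (tctx TA TB Ac Y) e ∧
      ∀ i j (hi : i < f.length) (hj : j < Y.length) (hr : i * Y.length + j < e.length),
        e[i * Y.length + j] = ct TA TB X Y f[i] (.var Y[j].1) := by
  have NA := H.NA
  obtain ⟨⟨aX, aA⟩, hd⟩ := hf.derAt hn
  have hent : ∀ i j (hi : i < f.length) (hj : j < Y.length) (hr : i * Y.length + j < e.length),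
      e[i * Y.length + j] = ct TA TB X Y f[i] (.var Y[j].1) := fun i j hi hj hr => by
    obtain ⟨U, hU, ht⟩ := he.2 i j hi hj hr
    exact (ttg_var_right NA H.NB hY hj
      ((hd i (hf.2.2.1 ▸ hi) hi).derivable.canon NA hU).1).1 ht
  have hZ := H.ctx hf.1 hY aX aY hnm
  have hZ' := H.ctx hf.2.1 hY aA aY hnm
  have hσ := H.subOK_left (σ := fun z => ct TA TB X Y (lookupV (mkSub Ac f) z.1) (.var z.2))
    hf.1 hY aY hnm hf.2.1 (hf.derAt_mem hn) (fun _ _ => rfl) hZ hZ'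
  refine ⟨(isMor_of_subOK hZ' hσ (by rw [he.1, length_tctx, hf.2.2.1]) fun r hr hr' => ?_).1, hent⟩
  obtain ⟨i, hi, j, hj, rfl⟩ := exists_index (length_tctx (TA := TA) (TB := TB) ▸ hr)
  have hi' : i < f.length := hf.2.2.1 ▸ hi
  rw [hent i j hi' hj, getElem_tctx hi hj]
  exact congrArg (ct TA TB X Y · _) (lookupV_mkSub hf.2.1.nodup hi hi').symm

theorem HDer.isMor_right (H : HDer TA TB chA chB h) {Bc : PreCtx B} {g : List (Expr B)}
    {e : List (Expr (A.tensor B))} (hX : Derivable TA (.ctx X)) (aX : CtxAt TA n X)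
    (hg : IsMor TB Y Bc g) (hm : htMor TB Y Bc g ≤ m) (hnm : n * m ≤ h)
    (he : TCtxMor TA TB false X Y g e) :
    IsMor (tensorAx TA TB chA chB) (tctx TA TB X Y) (tctx TA TB X Bc) e ∧
      ∀ i j (hi : i < X.length) (hj : j < g.length) (hr : i * g.length + j < e.length),
        e[i * g.length + j] = ct TA TB X Y (.var X[i].1) g[j] := by
  have NB := H.NB
  obtain ⟨⟨aY, aB⟩, hd⟩ := hg.derAt hm
  have hent : ∀ i j (hi : i < X.length) (hj : j < g.length) (hr : i * g.length + j < e.length),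
      e[i * g.length + j] = ct TA TB X Y (.var X[i].1) g[j] := fun i j hi hj hr => by
    obtain ⟨V, hV, ht⟩ := he.2 i j hi hj hr
    exact (ttg_var_left H.NA NB hX hi
      ((hd j (hg.2.2.1 ▸ hj) hj).derivable.canon NB hV).1).1 ht
  have hZ := H.ctx hX hg.1 aX aY hnm
  have hZ' := H.ctx hX hg.2.1 aX aB hnm
  have hσ := H.subOK_right (σ := fun z => ct TA TB X Y (.var z.1) (lookupV (mkSub Bc g) z.2))
    hX aX hg.1 hnm hg.2.1 (hg.derAt_mem hm) (fun _ _ => rfl) hZ hZ'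
  refine ⟨(isMor_of_subOK hZ' hσ (by rw [he.1, length_tctx, hg.2.2.1]) fun r hr hr' => ?_).1, hent⟩
  obtain ⟨i, hi, j, hj, rfl⟩ := exists_index (length_tctx (TA := TA) (TB := TB) ▸ hr)
  have hj' : j < g.length := hg.2.2.1 ▸ hj
  rw [getElem_tctx hi hj]
  have := hent i j hi hj' (by rw [hg.2.2.1]; exact hr')
  simp only [hg.2.2.1] at this
  rw [this]
  exact congrArg (ct TA TB X Y _) (lookupV_mkSub hg.2.1.nodup hj hj').symm

theorem HDer.moreq_left (H : HDer TA TB chA chB h) {Ac : PreCtx A} {f g : List (Expr A)}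
    {ef eg : List (Expr (A.tensor B))} (hfg : MorEq TA X Ac f g)
    (hn : htMorEq TA X Ac f g ≤ n) (hY : Derivable TB (.ctx Y)) (aY : CtxAt TB m Y)
    (hnm : n * m ≤ h) (hef : TMorCtx TA TB false X f Y ef) (heg : TMorCtx TA TB false X g Y eg) :
    MorEq (tensorAx TA TB chA chB) (tctx TA TB X Y) (tctx TA TB Ac Y) ef eg := by
  obtain ⟨hf, hg, he⟩ := hfg
  rw [htMorEq, max_le_iff, max_le_iff, Finset.sup_le_iff] at hn
  obtain ⟨mf, ent_f⟩ := H.isMor_left hf hn.1 hY aY hnm hef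
  obtain ⟨mg, ent_g⟩ := H.isMor_left hg hn.2.1 hY aY hnm heg
  refine ⟨mf, mg, fun r hr hrf hrg => ?_⟩
  refine DerTermEq.conv H.NT ?_ (mf.2.2.2 r hr hrf)
  obtain ⟨i, hi, j, hj, rfl⟩ := exists_index (length_tctx (TA := TA) (TB := TB) ▸ hr)
  have hif : i < f.length := hf.2.2.1 ▸ hi
  have hig : i < g.length := hg.2.2.1 ▸ hi
  rw [ent_f i j hif hj hrf, ent_g i j hig hj hrg]
  have hs := hn.2.2 i (Finset.mem_range.2 hi)
  rw [dif_pos ⟨hi, hif, hig⟩] at hs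
  have hd := (he i hi hif hig).derAt hs
  rw [subPre_eq_subst hf.2.1.isPreCtx hf.2.2.1] at hd
  exact H.termEq_left hd ((hf.derAt hn.1).2 i hi hif) hY aY hnm (List.getElem_mem hj)

theorem HDer.moreq_right (H : HDer TA TB chA chB h) {Bc : PreCtx B} {f g : List (Expr B)}
    {ef eg : List (Expr (A.tensor B))} (hX : Derivable TA (.ctx X)) (aX : CtxAt TA n X)
    (hfg : MorEq TB Y Bc f g) (hm : htMorEq TB Y Bc f g ≤ m) (hnm : n * m ≤ h)
    (hef : TCtxMor TA TB false X Y f ef) (heg : TCtxMor TA TB false X Y g eg) :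
    MorEq (tensorAx TA TB chA chB) (tctx TA TB X Y) (tctx TA TB X Bc) ef eg := by
  obtain ⟨hf, hg, he⟩ := hfg
  rw [htMorEq, max_le_iff, max_le_iff, Finset.sup_le_iff] at hm
  obtain ⟨mf, ent_f⟩ := H.isMor_right hX aX hf hm.1 hnm hef
  obtain ⟨mg, ent_g⟩ := H.isMor_right hX aX hg hm.2.1 hnm heg
  simp only [hf.2.2.1] at ent_f
  simp only [hg.2.2.1] at ent_g
  refine ⟨mf, mg, fun r hr hrf hrg => ?_⟩
  refine DerTermEq.conv H.NT ?_ (mf.2.2.2 r hr hrf)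
  obtain ⟨i, hi, j, hj, rfl⟩ := exists_index (length_tctx (TA := TA) (TB := TB) ▸ hr)
  have hjf : j < f.length := hf.2.2.1 ▸ hj
  have hjg : j < g.length := hg.2.2.1 ▸ hj
  rw [ent_f i j hi hj hrf, ent_g i j hi hj hrg]
  have hs := hm.2.2 j (Finset.mem_range.2 hj)
  rw [dif_pos ⟨hj, hjf, hjg⟩] at hs
  have hd := (he j hj hjf hjg).derAt hs
  rw [subPre_eq_subst hf.2.1.isPreCtx hf.2.2.1] at hd
  exact H.termEq_right hX aX hd ((hf.derAt hm.1).2 j hj hjf) hnm (List.getElem_mem hi)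

end

/-- Suppose `(𝔸,𝔹)` is `h`-derivable.  Then:
(Conteq¹) tensoring a derivable sort equality of `𝔸` (of suitable height) with a
context of `𝔹` yields a derivable context equality in `𝔸⊗𝔹`; (Conteq²)
symmetrically; (Moreq¹) tensoring a derivable morphism equality of `𝔸` with a
context of `𝔹` yields a derivable morphism equality in `𝔸⊗𝔹`; (Moreq²)
symmetrically. -/
theorem conteq_and_moreq
    (A B : Alphabet) (TA : Set (Judg A)) (TB : Set (Judg B))
    (hA : IsGAT TA) (hB : IsGAT TB)
    (chA : PreCtx A → A.Var) (hchA : FreshCh chA)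
    (chB : PreCtx B → B.Var) (hchB : FreshCh chB)
    (h : ℕ) (hder : hDerivable TA TB chA chB h) :
    -- Conteq¹
    (∀ (X : PreCtx A) (U U' : SortE A) (Y : PreCtx B) (x : A.Var)
        (Z1 Z2 : PreCtx (A.tensor B)),
        Derivable TA (.sortEq X U U') → Derivable TB (.ctx Y) →
        ht TA (.sortEq X U U') * htCtx TB Y ≤ h →
        (∀ p ∈ X, p.1 ≠ x) →
        TCtx TA TB false (X ++ [(x, U)]) Y Z1 →
        TCtx TA TB false (X ++ [(x, U')]) Y Z2 →
        CtxEq (tensorAx TA TB chA chB) Z1 Z2) ∧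
    -- Conteq²
    (∀ (X : PreCtx A) (Y : PreCtx B) (V V' : SortE B) (y : B.Var)
        (Z1 Z2 : PreCtx (A.tensor B)),
        Derivable TA (.ctx X) → Derivable TB (.sortEq Y V V') →
        htCtx TA X * ht TB (.sortEq Y V V') ≤ h →
        (∀ p ∈ Y, p.1 ≠ y) →
        TCtx TA TB false X (Y ++ [(y, V)]) Z1 →
        TCtx TA TB false X (Y ++ [(y, V')]) Z2 →
        CtxEq (tensorAx TA TB chA chB) Z1 Z2) ∧
    -- Moreq¹
    (∀ (X Ac : PreCtx A) (f g : List (Expr A)) (Y : PreCtx B)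
        (ZXY ZAY : PreCtx (A.tensor B)) (ef eg : List (Expr (A.tensor B))),
        MorEq TA X Ac f g → Derivable TB (.ctx Y) →
        htMorEq TA X Ac f g * htCtx TB Y ≤ h →
        TCtx TA TB false X Y ZXY → TCtx TA TB false Ac Y ZAY →
        TMorCtx TA TB false X f Y ef → TMorCtx TA TB false X g Y eg →
        MorEq (tensorAx TA TB chA chB) ZXY ZAY ef eg) ∧
    -- Moreq²
    (∀ (X : PreCtx A) (Y Bc : PreCtx B) (f g : List (Expr B))
        (ZXY ZXB : PreCtx (A.tensor B)) (ef eg : List (Expr (A.tensor B))),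
        Derivable TA (.ctx X) → MorEq TB Y Bc f g →
        htCtx TA X * htMorEq TB Y Bc f g ≤ h →
        TCtx TA TB false X Y ZXY → TCtx TA TB false X Bc ZXB →
        TCtxMor TA TB false X Y f ef → TCtxMor TA TB false X Y g eg →
        MorEq (tensorAx TA TB chA chB) ZXY ZXB ef eg) := by
  have H : HDer TA TB chA chB h := ⟨hA, hB, hchA, hchB, hder⟩
  have NA := H.NA
  have NB := H.NB
  refine ⟨?_, ?_, ?_, ?_⟩
  · intro X U U' Y x Z1 Z2 hU hY hh hx h1 h2
    obtain ⟨k, -, s1, s2⟩ := (hU.derAt le_rfl).sort_of_sortEq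
    rw [(tctx_iff NA NB (.snoc NA s1.derivable hx) hY).1 h1,
      (tctx_iff NA NB (.snoc NA s2.derivable hx) hY).1 h2]
    exact H.conteq_left (hU.derAt le_rfl) hY (hY.ctxAt le_rfl) hh hx
  · intro X Y V V' y Z1 Z2 hX hV hh hy h1 h2
    obtain ⟨k, -, s1, s2⟩ := (hV.derAt le_rfl).sort_of_sortEq
    rw [(tctx_iff NA NB hX (.snoc NB s1.derivable hy)).1 h1,
      (tctx_iff NA NB hX (.snoc NB s2.derivable hy)).1 h2]
    exact H.conteq_right hX (hX.ctxAt le_rfl) (hV.derAt le_rfl) hh hy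
  · intro X Ac f g Y ZXY ZAY ef eg hfg hY hh h1 h2 hef heg
    rw [(tctx_iff NA NB hfg.1.1 hY).1 h1, (tctx_iff NA NB hfg.1.2.1 hY).1 h2]
    exact H.moreq_left hfg le_rfl hY (hY.ctxAt le_rfl) hh hef heg
  · intro X Y Bc f g ZXY ZXB ef eg hX hfg hh h1 h2 hef heg
    rw [(tctx_iff NA NB hX hfg.1.1).1 h1, (tctx_iff NA NB hX hfg.1.2.1).1 h2]
    exact H.moreq_right hX (hX.ctxAt le_rfl) hfg le_rfl hh hef heg

end GATPaper
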